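/- There exists an injective group homomorphism ρ from the presented group L into GL₃₅₂(𝔽₁₇) whose image acts irreducibly on the natural module 𝔽₁₇^352; that is, the only 𝔽₁₇-subspaces U of 𝔽₁₇^352 satisfying ρ(g)·U ⊆ U for all g ∈ L are U = 0 and U = 𝔽₁₇^352. -/

import Mathlib

namespace TwoFi22

/-! Free generators of the free group on ten letters, corresponding to
`a, b, c, d, e, f, g, h, i, z`. -/

def A : FreeGroup (Fin 10) := FreeGroup.of 0
def B : FreeGroup (Fin 10) := FreeGroup.of 1
def C : FreeGroup (Fin 10) := FreeGroup.of 2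
def D : FreeGroup (Fin 10) := FreeGroup.of 3
def E : FreeGroup (Fin 10) := FreeGroup.of 4
def F : FreeGroup (Fin 10) := FreeGroup.of 5
def G : FreeGroup (Fin 10) := FreeGroup.of 6
def H : FreeGroup (Fin 10) := FreeGroup.of 7
def I : FreeGroup (Fin 10) := FreeGroup.of 8
def Z : FreeGroup (Fin 10) := FreeGroup.of 9

/-- The relator set `R_L` of the presentation of the `2`-fold cover `2·Fi₂₂`. -/
def rels : Set (FreeGroup (Fin 10)) :=
  {A ^ 2, B ^ 2, C ^ 2, D ^ 2, E ^ 2, F ^ 2, G ^ 2, H ^ 2, I ^ 2,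
   (A * B) ^ 3,
   (B * C) ^ 3 * Z⁻¹, (C * D) ^ 3, (D * E) ^ 3, (E * F) ^ 3 * Z⁻¹, (F * G) ^ 3 * Z⁻¹,
   (A * C) ^ 2, (A * D) ^ 2, (A * E) ^ 2, (A * F) ^ 2, (A * G) ^ 2, (A * H) ^ 2, (A * I) ^ 2,
   (B * D) ^ 2, (B * E) ^ 2, (B * F) ^ 2, (B * G) ^ 2, (B * H) ^ 2, (B * I) ^ 2,
   (C * E) ^ 2, (C * F) ^ 2, (C * G) ^ 2, (C * H) ^ 2, (C * I) ^ 2,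
   (D * F) ^ 2, (D * G) ^ 2, (E * G) ^ 2, (E * H) ^ 2, (E * I) ^ 2,
   (D * H) ^ 3, (H * I) ^ 3,
   (D * I) ^ 2, (F * H) ^ 2, (F * I) ^ 2, (G * H) ^ 2, (G * I) ^ 2,
   (D * C * B * D * E * F * D * H * I) ^ 10,
   (A * B * C * D * E * F * H) ^ 9, (B * C * D * E * F * G * H) ^ 9,
   Z ^ 2,
   Z * A * Z⁻¹ * A⁻¹, Z * B * Z⁻¹ * B⁻¹, Z * C * Z⁻¹ * C⁻¹, Z * D * Z⁻¹ * D⁻¹,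
   Z * E * Z⁻¹ * E⁻¹, Z * F * Z⁻¹ * F⁻¹, Z * G * Z⁻¹ * G⁻¹, Z * H * Z⁻¹ * H⁻¹,
   Z * I * Z⁻¹ * I⁻¹}

/-- The presented group `L = ⟨a,b,c,d,e,f,g,h,i,z ∣ R_L⟩`, i.e. the 2-fold cover `2·Fi₂₂`
of Fischer's group `Fi₂₂`. -/
abbrev L := PresentedGroup rels

/-! The images of the ten generators in `L`. -/

def a : L := PresentedGroup.of 0
def b : L := PresentedGroup.of 1
def c : L := PresentedGroup.of 2
def d : L := PresentedGroup.of 3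
def e : L := PresentedGroup.of 4
def f : L := PresentedGroup.of 5
def g : L := PresentedGroup.of 6
def h : L := PresentedGroup.of 7
def i : L := PresentedGroup.of 8
def z : L := PresentedGroup.of 9

noncomputable section

/-! ### Words in a group generated by involutions -/

/-- The product of a word whose first letter acts first. -/
def evalWord {M : Type*} [Monoid M] (φ : ℕ → M) : List ℕ → M
  | [] => 1
  | x :: w => evalWord φ w * φ x

section evalWord
variable {M : Type*} [Monoid M] (φ : ℕ → M)

@[simp] theorem evalWord_nil : evalWord φ [] = 1 := rfl

@[simp] theorem evalWord_cons (x : ℕ) (w : List ℕ) :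
    evalWord φ (x :: w) = evalWord φ w * φ x := rfl

@[simp] theorem evalWord_append (u w : List ℕ) :
    evalWord φ (u ++ w) = evalWord φ w * evalWord φ u := by
  induction u with
  | nil => simp
  | cons x u ih => simp [ih, mul_assoc]

theorem map_evalWord {N : Type*} [Monoid N] (θ : M →* N) (w : List ℕ) :
    θ (evalWord φ w) = evalWord (fun x => θ (φ x)) w := by
  induction w with
  | nil => simp
  | cons x w ih => simp [ih]

theorem evalWord_mul_reverse (hφ : ∀ x, φ x * φ x = 1) (w : List ℕ) :
    evalWord φ w * evalWord φ w.reverse = 1 := by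
  induction w with
  | nil => simp
  | cons x w ih =>
    simp only [evalWord_cons, List.reverse_cons, evalWord_append, evalWord_nil, one_mul]
    rw [mul_assoc, ← mul_assoc (φ x), hφ, one_mul, ih]

theorem evalWord_reverse_mul (hφ : ∀ x, φ x * φ x = 1) (w : List ℕ) :
    evalWord φ w.reverse * evalWord φ w = 1 := by
  simpa using evalWord_mul_reverse φ hφ w.reverse

end evalWord

theorem evalWord_reverse {Γ : Type*} [Group Γ] (φ : ℕ → Γ) (hφ : ∀ x, φ x * φ x = 1)
    (w : List ℕ) : evalWord φ w.reverse = (evalWord φ w)⁻¹ :=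
  eq_inv_of_mul_eq_one_left (evalWord_reverse_mul φ hφ w)

/-- The word `w` repeated `n` times. -/
def repeatWord : ℕ → List ℕ → List ℕ
  | 0, _ => []
  | n + 1, w => w ++ repeatWord n w

theorem evalWord_repeatWord {M : Type*} [Monoid M] (φ : ℕ → M) (n : ℕ) (w : List ℕ) :
    evalWord φ (repeatWord n w) = evalWord φ w ^ n := by
  induction n with
  | zero => simp [repeatWord]
  | succ n ih => simp [repeatWord, ih, pow_succ]

/-- The adjacency of the diagram with edges `a-b-c-d-e-f-g` and `d-h-i`, as a bit. -/
def adjBit (x y : ℕ) : ℕ :=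
  Nat.mod (Nat.shiftRight (nat_lit 606898459303314964613634) (Nat.add (Nat.mul (nat_lit 9) x) y)) (nat_lit 2)

/-- Involutions satisfying the braid relations of the diagram. -/
structure IsCoxeterFamily {Γ : Type*} [Group Γ] (φ : ℕ → Γ) : Prop where
  sq : ∀ x, φ x * φ x = 1
  comm : ∀ x y, x < 9 → y < 9 → adjBit x y = 0 → φ x * φ y = φ y * φ x
  braid : ∀ x y, x < 9 → y < 9 → adjBit x y ≠ 0 → φ x * φ y * φ x = φ y * φ x * φ y

/-! ### Certified reduction of words -/

/-- Apply a commutation or a braid move at the head of a word. -/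
def moveHead : List ℕ → List ℕ
  | x :: y :: w =>
    if x < 9 ∧ y < 9 then
      if adjBit x y = 0 then y :: x :: w
      else match w with
        | [] => x :: y :: w
        | u :: v => if x = u then y :: x :: y :: v else x :: y :: w
    else x :: y :: w
  | w => w

/-- Apply a commutation or a braid move at a given position. -/
def moveAt : ℕ → List ℕ → List ℕ
  | 0, w => moveHead w
  | n + 1, x :: w => x :: moveAt n w
  | _ + 1, [] => []

/-- Multiply by a letter, cancelling it against the head if possible. -/
def pushLetter (x : ℕ) : List ℕ → List ℕ
  | [] => [x]
  | y :: w => if x = y then w else x :: y :: w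

/-- Multiply by successive letters, each one preceded by a list of moves. -/
def reduceWord : List ℕ → List (List ℕ) → List ℕ → List ℕ
  | [], _, st => st
  | x :: w, [], st => reduceWord w [] (pushLetter x st)
  | x :: w, m :: ms, st => reduceWord w ms (pushLetter x (m.foldl (fun s q => moveAt q s) st))

section reduceWord
variable {Γ : Type*} [Group Γ] {φ : ℕ → Γ}

theorem prod_moveHead (hφ : IsCoxeterFamily φ) (w : List ℕ) :
    ((moveHead w).map φ).prod = (w.map φ).prod := by
  match w with
  | [] => rfl
  | [x] => rfl
  | x :: y :: w =>
    unfold moveHead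
    dsimp only
    split_ifs with hxy h
    · simp only [List.map_cons, List.prod_cons, ← mul_assoc]
      rw [hφ.comm x y hxy.1 hxy.2 h]
    · match w with
      | [] => rfl
      | u :: v =>
        dsimp only
        split_ifs with hu
        · subst hu
          simp only [List.map_cons, List.prod_cons, ← mul_assoc]
          rw [hφ.braid x y hxy.1 hxy.2 h]
        · rfl
    · rfl

theorem prod_moveAt (hφ : IsCoxeterFamily φ) (n : ℕ) (w : List ℕ) :
    ((moveAt n w).map φ).prod = (w.map φ).prod := by
  induction n generalizing w with
  | zero => exact prod_moveHead hφ w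
  | succ n ih =>
    match w with
    | [] => rfl
    | x :: w => simp [moveAt, ih]

theorem prod_pushLetter (hφ : IsCoxeterFamily φ) (x : ℕ) (w : List ℕ) :
    ((pushLetter x w).map φ).prod = φ x * (w.map φ).prod := by
  match w with
  | [] => simp [pushLetter]
  | y :: w =>
    unfold pushLetter
    dsimp only
    split_ifs with h
    · subst h
      rw [List.map_cons, List.prod_cons, ← mul_assoc, hφ.sq, one_mul]
    · simp

theorem prod_reduceWord (hφ : IsCoxeterFamily φ) (w : List ℕ) (ms : List (List ℕ))
    (st : List ℕ) :
    ((reduceWord w ms st).map φ).prod = evalWord φ w * (st.map φ).prod := by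
  induction w generalizing ms st with
  | nil => simp [reduceWord]
  | cons x w ih =>
    have key : ∀ (m st : List ℕ),
        ((m.foldl (fun s q => moveAt q s) st).map φ).prod = (st.map φ).prod := by
      intro m
      induction m with
      | nil => intro st; rfl
      | cons q m ihm => intro st; rw [List.foldl_cons, ihm, prod_moveAt hφ]
    match ms with
    | [] => rw [reduceWord, ih, prod_pushLetter hφ, evalWord_cons, mul_assoc]
    | m :: ms => rw [reduceWord, ih, prod_pushLetter hφ, key, evalWord_cons, mul_assoc]

end reduceWord

/-- The word `dcbdefdhi`. -/
def wordS : List ℕ := [3, 2, 1, 3, 4, 5, 3, 7, 8]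

/-- The word `efdecdhibcdh`, whose fourth power is a consequence of `dcbdefdhi ^ 10 = 1`. -/
def wordV : List ℕ := [4, 5, 3, 4, 2, 3, 7, 8, 1, 2, 3, 7]

/-- The word `ifcdc`. -/
def wordU : List ℕ := [8, 5, 2, 3, 2]

def movesV : List (List ℕ) :=
  [
    [], [], [], [], [], [], [], [], [], [], [], [], [], [], [], [], [], [], [], [], [], [], [], [], [], [],
    [], [], [], [], [], [], [], [], [], [], [], [], [], [], [], [], [], [], [], [], [], [], [], [], [], [],
    [], [], [], [], [], [], [], [], [], [], [], [], [], [], [], [], [], [], [], [], [], [], [], [], [], [],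
    [], [], [], [], [], [], [], [], [], [], [], [], [], [1, 0], [], [], [], [0], [], [4, 3, 2, 1, 0], [], [1,
    0], [], [], [1, 2, 0], [5, 4, 3, 2, 6, 5, 4, 3, 1, 0], [], [3, 2, 1, 0], [8, 7, 6, 5, 4, 3, 2, 1, 0], [],
    [6, 5, 3, 2, 1, 7, 5, 4, 3, 7, 6, 5, 11, 10, 12, 11, 9, 8, 7, 6, 4, 2, 0], [5, 4, 3, 2, 6, 5, 7, 6, 4, 3,
    1, 0], [], [1, 0], [3, 2, 1, 0], [1, 9, 8, 7, 6, 5, 4, 2, 0], [6, 7, 5, 4, 3, 2, 14, 13, 12, 11, 10, 8, 7,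
    5, 10, 9, 8, 15, 14, 13, 11, 10, 20, 19, 18, 17, 16, 14, 21, 20, 19, 18, 16, 15, 13, 12, 11, 9, 7, 6, 4,
    3, 1, 0], [], [], [1, 2, 0], [3, 2, 4, 3, 1, 0], [], [4, 3, 2, 1, 0], [8, 7, 6, 9, 8, 7, 5, 4, 3, 2, 1,
    0], [], [12, 11, 10, 12, 14, 15, 13, 11, 9, 8, 7, 6, 5, 3, 2, 1, 9, 8, 7, 5, 4, 3, 9, 8, 11, 10, 13, 12,
    20, 19, 18, 17, 16, 15, 14, 13, 11, 9, 7, 6, 5, 17, 16, 15, 14, 13, 12, 11, 10, 18, 19, 17, 16, 15, 14,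
    13, 26, 25, 24, 23, 22, 20, 19, 17, 16, 22, 21, 20, 27, 26, 25, 23, 22, 32, 31, 30, 29, 28, 26, 33, 32,
    31, 30, 28, 27, 25, 24, 23, 21, 19, 18, 17, 15, 14, 12, 11, 9, 8, 7, 6, 4, 2, 0], [5, 4, 3, 2, 6, 5, 7, 6,
    4, 3, 1, 0], [], [1, 0], [3, 2, 1, 0], [1, 12, 11, 10, 9, 8, 7, 6, 5, 4, 2, 0], [6, 7, 5, 4, 3, 2, 21, 20,
    19, 18, 17, 23, 21, 20, 19, 24, 23, 21, 20, 18, 16, 15, 14, 13, 12, 11, 10, 8, 7, 5, 13, 12, 11, 10, 9, 8,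
    15, 13, 12, 16, 18, 29, 28, 27, 26, 25, 24, 23, 21, 20, 19, 17, 15, 14, 13, 11, 10, 26, 25, 24, 23, 22,
    21, 20, 19, 18, 17, 16, 14, 27, 26, 28, 35, 34, 33, 32, 31, 29, 27, 25, 24, 23, 22, 21, 31, 30, 36, 35,
    34, 32, 31, 29, 28, 27, 25, 24, 28, 41, 40, 39, 38, 37, 35, 42, 41, 40, 39, 37, 36, 34, 33, 32, 31, 29,
    27, 26, 25, 23, 22, 20, 19, 18, 16, 15, 13, 12, 11, 9, 7, 6, 4, 3, 1, 0], [], [], [1, 2, 0], [3, 2, 4, 3,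
    1, 0], [], [4, 3, 2, 1, 0], [8, 7, 6, 9, 8, 7, 5, 4, 3, 2, 1, 0], [], [12, 11, 10, 12, 14, 15, 13, 11, 9,
    8, 7, 6, 5, 3, 2, 1, 9, 8, 7, 5, 4, 3, 9, 8, 11, 10, 13, 12, 19, 18, 17, 16, 15, 14, 13, 11, 9, 7, 6, 5,
    22, 21, 20, 19, 23, 22, 21, 25, 23, 26, 27, 25, 24, 22, 20, 18, 17, 16, 15, 14, 13, 12, 11, 10, 18, 20,
    19, 17, 16, 15, 14, 13, 22, 21, 33, 32, 31, 30, 29, 28, 35, 33, 32, 31, 36, 35, 33, 32, 30, 29, 27, 26,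
    25, 24, 23, 22, 20, 19, 17, 16, 25, 24, 23, 22, 21, 20, 29, 28, 27, 25, 24, 28, 30, 41, 40, 39, 38, 37,
    36, 35, 33, 32, 31, 29, 27, 26, 25, 23, 22, 38, 37, 36, 35, 34, 33, 32, 31, 30, 29, 28, 26, 39, 38, 40,
    47, 46, 45, 44, 43, 41, 39, 37, 36, 35, 34, 33, 43, 42, 48, 47, 46, 44, 43, 41, 40, 39, 37, 36, 40, 53,
    52, 51, 50, 49, 47, 54, 53, 52, 51, 49, 48, 46, 45, 44, 43, 41, 39, 38, 37, 35, 34, 32, 31, 30, 28, 27,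
    25, 24, 23, 21, 19, 18, 17, 15, 14, 12, 11, 9, 8, 7, 6, 4, 2, 0], [5, 4, 3, 2, 6, 5, 7, 6, 4, 3, 1, 0],
    [], [1, 0], [3, 2, 1, 0], [1, 12, 11, 10, 9, 8, 7, 6, 5, 4, 2, 0], [], [], [], [2, 1, 9, 10, 8, 7, 6, 5,
    3, 2, 0], [4, 3, 2, 23, 22, 21, 20, 19, 25, 23, 22, 21, 26, 25, 23, 22, 20, 18, 17, 16, 15, 14, 13, 12,
    10, 9, 7, 5, 4, 3, 1, 0], [], [5, 13, 12, 11, 10, 9, 8, 6, 4, 3, 2, 1, 0], [8, 7, 6, 9, 14, 12, 11, 30,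
    29, 28, 27, 26, 31, 30, 29, 28, 33, 31, 30, 34, 35, 33, 32, 31, 29, 27, 25, 24, 23, 22, 21, 20, 19, 18,
    17, 16, 15, 14, 12, 10, 8, 7, 5, 4, 3, 2, 1, 0], [], [], [3, 2, 1, 4, 3, 5, 8, 7, 21, 20, 19, 18, 22, 23,
    21, 20, 19, 17, 16, 15, 14, 13, 12, 11, 10, 9, 8, 6, 4, 2, 0], [1, 13, 14, 12, 11, 10, 9, 8, 7, 6, 5, 4,
    2, 0], [3, 2, 11, 13, 17, 16, 15, 14, 12, 10, 9, 8, 7, 6, 4, 3, 1, 0], [5, 4, 3, 9, 11, 17, 16, 15, 14,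
    13, 12, 10, 8, 6, 5, 4, 2, 1, 0], [13, 17, 28, 27, 26, 25, 24, 23, 22, 21, 20, 18, 16, 14, 12, 11, 10, 9,
    8, 7, 6, 4, 3, 2, 0], [], [], [], [2, 1, 10, 18, 25, 27, 26, 24, 23, 22, 21, 19, 17, 16, 15, 14, 13, 11,
    9, 8, 7, 6, 5, 3, 2, 0], [6, 5, 4, 3, 2, 7, 6, 8, 10, 20, 19, 28, 27, 39, 38, 37, 36, 35, 34, 41, 39, 38,
    37, 42, 41, 39, 38, 36, 35, 33, 32, 31, 30, 29, 28, 26, 25, 23, 21, 20, 18, 17, 16, 15, 14, 13, 12, 11, 9,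
    7, 5, 4, 3, 1, 0], [], [5, 13, 12, 15, 21, 29, 28, 27, 26, 25, 24, 22, 20, 19, 18, 17, 16, 14, 13, 11, 10,
    9, 8, 6, 4, 3, 2, 1, 0], [7, 6, 24, 23, 22, 25, 32, 31, 30, 28, 27, 40, 39, 38, 37, 36, 35, 34, 33, 32,
    31, 30, 28, 26, 24, 23, 21, 20, 19, 18, 17, 16, 15, 13, 12, 10, 8, 7, 5, 4, 3, 2, 1, 0], [], [], [3, 2, 1,
    4, 3, 5, 8, 7, 17, 16, 15, 20, 19, 21, 24, 23, 37, 36, 35, 34, 38, 39, 37, 36, 35, 33, 32, 31, 30, 29, 28,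
    27, 26, 25, 24, 22, 20, 18, 17, 16, 14, 13, 12, 11, 10, 9, 8, 6, 4, 2, 0], [1, 15, 14, 13, 16, 15, 17, 29,
    30, 28, 27, 26, 25, 24, 23, 22, 21, 20, 18, 16, 14, 12, 11, 10, 9, 8, 7, 6, 5, 4, 2, 0], [3, 2, 11, 13,
    19, 18, 27, 29, 33, 32, 31, 30, 28, 26, 25, 24, 23, 22, 20, 19, 17, 16, 15, 14, 12, 10, 9, 8, 7, 6, 4, 3,
    1, 0], [5, 4, 3, 9, 11, 21, 20, 19, 25, 27, 33, 32, 31, 30, 29, 28, 26, 24, 22, 21, 20, 18, 17, 16, 15,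
    14, 13, 12, 10, 8, 6, 5, 4, 2, 1, 0], [13, 29, 33, 41, 40, 39, 38, 37, 36, 34, 32, 30, 28, 27, 26, 25, 24,
    23, 22, 20, 19, 18, 16, 14, 12, 11, 10, 9, 8, 7, 6, 4, 3, 2, 0], [], [], [], [2, 1, 10, 18, 26, 34, 41,
    42, 40, 39, 38, 37, 35, 33, 32, 31, 30, 29, 27, 25, 24, 23, 22, 21, 19, 17, 16, 15, 14, 13, 11, 9, 8, 7,
    6, 5, 3, 2, 0], [6, 5, 4, 3, 2, 7, 6, 8, 10, 22, 21, 20, 19, 23, 22, 24, 26, 36, 35, 48, 47, 46, 45, 44,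
    42, 41, 39, 37, 36, 34, 33, 32, 31, 30, 29, 28, 27, 25, 23, 21, 20, 18, 17, 16, 15, 14, 13, 12, 11, 9, 7,
    5, 4, 3, 1, 0], [], [5, 13, 12, 15, 21, 29, 28, 31, 37, 42, 41, 40, 38, 36, 35, 34, 33, 32, 30, 29, 27,
    26, 25, 24, 22, 20, 19, 18, 17, 16, 14, 13, 11, 10, 9, 8, 6, 4, 3, 2, 1, 0], [], [], [], [], [3, 13, 12,
    20, 29, 28, 36, 50, 49, 48, 46, 45, 43, 42, 41, 39, 38, 37, 35, 34, 33, 32, 30, 29, 27, 26, 25, 23, 22,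
    21, 19, 18, 17, 16, 14, 13, 11, 10, 9, 7, 6, 5, 4, 2, 1, 0], [16, 15, 14, 13, 17, 22, 32, 31, 30, 29, 33,
    38, 47, 46, 45, 48, 47, 46, 44, 43, 42, 41, 40, 39, 37, 36, 34, 32, 31, 30, 28, 27, 26, 25, 24, 23, 21,
    20, 18, 16, 15, 14, 12, 11, 10, 9, 8, 6, 5, 4, 3, 1, 0], [23, 39, 49, 47, 46, 45, 43, 42, 41, 40, 38, 37,
    35, 34, 33, 31, 30, 29, 27, 26, 25, 24, 22, 21, 19, 18, 17, 15, 14, 13, 11, 10, 9, 7, 6, 5, 4, 2, 1, 0],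
    [3, 2, 1, 0], [], [], [], [], [], [], [], [], [0], [], [], [1, 0], [1, 0], [], [0], [1, 0], [3, 2, 1, 0],
    [], [], [], [0], [], [], [], [0], [], [], [], [], [], [], [], [], [], [], [0], [0], [], [], [0], [4, 3, 2,
    1, 0], [], [], [], [1, 0], [], [0], [], []]

theorem reduceWord_movesV :
    reduceWord (repeatWord 10 wordS ++ (wordU ++ (repeatWord 10 wordS ++
      (wordU.reverse ++ repeatWord 4 wordV.reverse)))) movesV [] = [] := by
  decide +kernel

theorem evalWord_wordV {Γ : Type*} [Group Γ] {φ : ℕ → Γ} (hφ : IsCoxeterFamily φ)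
    (hS : evalWord φ wordS ^ 10 = 1) : evalWord φ wordV ^ 4 = 1 := by
  have h := prod_reduceWord hφ (repeatWord 10 wordS ++ (wordU ++ (repeatWord 10 wordS ++
      (wordU.reverse ++ repeatWord 4 wordV.reverse)))) movesV []
  rw [reduceWord_movesV] at h
  simpa [evalWord_repeatWord, hS, evalWord_reverse φ hφ.sq] using h.symm

/-! ### The generators of `L` up to sign -/

/-- The generators, multiplied by `z` where needed to make all cubic relators trivial. -/
def twist : ℕ → L
  | 0 => a
  | 1 => b
  | 2 => c * z
  | 3 => d * z
  | 4 => e * z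
  | 5 => f
  | 6 => g * z
  | 7 => h * z
  | 8 => i * z
  | _ => 1

/-- The relators hold for `φ` if and only if the relations of the presentation do. -/
theorem forall_rels_iff {Γ : Type*} [Group Γ] (φ : Fin 10 → Γ) :
    (∀ r ∈ rels, FreeGroup.lift φ r = 1) ↔
      φ 0 ^ 2 = 1 ∧ φ 1 ^ 2 = 1 ∧ φ 2 ^ 2 = 1 ∧ φ 3 ^ 2 = 1 ∧ φ 4 ^ 2 = 1 ∧ φ 5 ^ 2 = 1 ∧ φ 6 ^
      2 = 1 ∧ φ 7 ^ 2 = 1 ∧ φ 8 ^ 2 = 1 ∧ (φ 0 * φ 1) ^ 3 = 1 ∧ (φ 1 * φ 2) ^ 3 = φ 9 ∧ (φ 2 * φ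
      3) ^ 3 = 1 ∧ (φ 3 * φ 4) ^ 3 = 1 ∧ (φ 4 * φ 5) ^ 3 = φ 9 ∧ (φ 5 * φ 6) ^ 3 = φ 9 ∧ (φ 0 *
      φ 2) ^ 2 = 1 ∧ (φ 0 * φ 3) ^ 2 = 1 ∧ (φ 0 * φ 4) ^ 2 = 1 ∧ (φ 0 * φ 5) ^ 2 = 1 ∧ (φ 0 * φ
      6) ^ 2 = 1 ∧ (φ 0 * φ 7) ^ 2 = 1 ∧ (φ 0 * φ 8) ^ 2 = 1 ∧ (φ 1 * φ 3) ^ 2 = 1 ∧ (φ 1 * φ 4)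
      ^ 2 = 1 ∧ (φ 1 * φ 5) ^ 2 = 1 ∧ (φ 1 * φ 6) ^ 2 = 1 ∧ (φ 1 * φ 7) ^ 2 = 1 ∧ (φ 1 * φ 8) ^
      2 = 1 ∧ (φ 2 * φ 4) ^ 2 = 1 ∧ (φ 2 * φ 5) ^ 2 = 1 ∧ (φ 2 * φ 6) ^ 2 = 1 ∧ (φ 2 * φ 7) ^ 2
      = 1 ∧ (φ 2 * φ 8) ^ 2 = 1 ∧ (φ 3 * φ 5) ^ 2 = 1 ∧ (φ 3 * φ 6) ^ 2 = 1 ∧ (φ 4 * φ 6) ^ 2 =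
      1 ∧ (φ 4 * φ 7) ^ 2 = 1 ∧ (φ 4 * φ 8) ^ 2 = 1 ∧ (φ 3 * φ 7) ^ 3 = 1 ∧ (φ 7 * φ 8) ^ 3 = 1
      ∧ (φ 3 * φ 8) ^ 2 = 1 ∧ (φ 5 * φ 7) ^ 2 = 1 ∧ (φ 5 * φ 8) ^ 2 = 1 ∧ (φ 6 * φ 7) ^ 2 = 1 ∧
      (φ 6 * φ 8) ^ 2 = 1 ∧ (φ 3 * φ 2 * φ 1 * φ 3 * φ 4 * φ 5 * φ 3 * φ 7 * φ 8) ^ 10 = 1 ∧ (φ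
      0 * φ 1 * φ 2 * φ 3 * φ 4 * φ 5 * φ 7) ^ 9 = 1 ∧ (φ 1 * φ 2 * φ 3 * φ 4 * φ 5 * φ 6 * φ 7)
      ^ 9 = 1 ∧ φ 9 ^ 2 = 1 ∧ φ 9 * φ 0 = φ 0 * φ 9 ∧ φ 9 * φ 1 = φ 1 * φ 9 ∧ φ 9 * φ 2 = φ 2 *
      φ 9 ∧ φ 9 * φ 3 = φ 3 * φ 9 ∧ φ 9 * φ 4 = φ 4 * φ 9 ∧ φ 9 * φ 5 = φ 5 * φ 9 ∧ φ 9 * φ 6 =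
      φ 6 * φ 9 ∧ φ 9 * φ 7 = φ 7 * φ 9 ∧ φ 9 * φ 8 = φ 8 * φ 9 := by
  simp only [rels, Set.mem_insert_iff, Set.mem_singleton_iff, forall_eq_or_imp, forall_eq, map_mul,
    map_pow, map_inv, A, B, C, D, E, F, G, H, I, Z, FreeGroup.lift_apply_of, one_mul,
    mul_inv_eq_iff_eq_mul]

theorem relations_hold :
    ((a ^ 2 = 1 ∧ b ^ 2 = 1 ∧ c ^ 2 = 1 ∧ d ^ 2 = 1 ∧ e ^ 2 = 1 ∧ f ^ 2 = 1 ∧ g ^ 2 = 1 ∧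
      h ^ 2 = 1 ∧ i ^ 2 = 1) ∧
    ((a * b) ^ 3 = 1 ∧ (b * c) ^ 3 = z ∧ (c * d) ^ 3 = 1 ∧ (d * e) ^ 3 = 1 ∧ (e * f) ^ 3 = z ∧
      (f * g) ^ 3 = z ∧ (d * h) ^ 3 = 1 ∧ (h * i) ^ 3 = 1) ∧
    ((a * c) ^ 2 = 1 ∧ (a * d) ^ 2 = 1 ∧ (a * e) ^ 2 = 1 ∧ (a * f) ^ 2 = 1 ∧ (a * g) ^ 2 = 1 ∧
      (a * h) ^ 2 = 1 ∧ (a * i) ^ 2 = 1 ∧ (b * d) ^ 2 = 1 ∧ (b * e) ^ 2 = 1 ∧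
      (b * f) ^ 2 = 1 ∧ (b * g) ^ 2 = 1 ∧ (b * h) ^ 2 = 1 ∧ (b * i) ^ 2 = 1 ∧
      (c * e) ^ 2 = 1 ∧ (c * f) ^ 2 = 1 ∧ (c * g) ^ 2 = 1 ∧ (c * h) ^ 2 = 1 ∧
      (c * i) ^ 2 = 1 ∧ (d * f) ^ 2 = 1 ∧ (d * g) ^ 2 = 1 ∧ (e * g) ^ 2 = 1 ∧
      (e * h) ^ 2 = 1 ∧ (e * i) ^ 2 = 1 ∧ (d * i) ^ 2 = 1 ∧ (f * h) ^ 2 = 1 ∧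
      (f * i) ^ 2 = 1 ∧ (g * h) ^ 2 = 1 ∧ (g * i) ^ 2 = 1)) ∧
    ((d * c * b * d * e * f * d * h * i) ^ 10 = 1 ∧ (a * b * c * d * e * f * h) ^ 9 = 1 ∧
      (b * c * d * e * f * g * h) ^ 9 = 1 ∧ z ^ 2 = 1) ∧
    (z * a = a * z ∧ z * b = b * z ∧ z * c = c * z ∧ z * d = d * z ∧ z * e = e * z ∧
      z * f = f * z ∧ z * g = g * z ∧ z * h = h * z ∧ z * i = i * z) := by
  have key : ∀ r ∈ rels, FreeGroup.lift (PresentedGroup.of : Fin 10 → L) r = 1 := by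
    intro r hr
    have : FreeGroup.lift (PresentedGroup.of : Fin 10 → L) = PresentedGroup.mk rels :=
      FreeGroup.ext_hom _ _ fun x => FreeGroup.lift_apply_of
    rw [this]
    exact PresentedGroup.one_of_mem hr
  obtain ⟨r0, r1, r2, r3, r4, r5, r6, r7, r8, r9, r10, r11, r12, r13, r14, r15, r16, r17, r18,
    r19, r20, r21, r22, r23, r24, r25, r26, r27, r28, r29, r30, r31, r32, r33, r34, r35, r36, r37,
    r38, r39, r40, r41, r42, r43, r44, r45, r46, r47, r48, r49, r50, r51, r52, r53, r54, r55, r56,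
    r57⟩ := (forall_rels_iff _).1 key
  exact ⟨⟨⟨r0, r1, r2, r3, r4, r5, r6, r7, r8⟩, ⟨r9, r10, r11, r12, r13, r14, r38, r39⟩, r15, r16,
    r17, r18, r19, r20, r21, r22, r23, r24, r25, r26, r27, r28, r29, r30, r31, r32, r33, r34, r35,
    r36, r37, r40, r41, r42, r43, r44⟩, ⟨r45, r46, r47, r48⟩, r49, r50, r51, r52, r53, r54, r55,
    r56, r57⟩

theorem z_pow_two : z ^ 2 = 1 := relations_hold.2.1.2.2.2

theorem z_mul_z : z * z = 1 := by rw [← pow_two, z_pow_two]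

theorem z_comm (x : L) : z * x = x * z := by
  have hx : x ∈ Subgroup.closure (Set.range (PresentedGroup.of : Fin 10 → L)) := by
    rw [PresentedGroup.closure_range_of]; trivial
  obtain ⟨ha, hb, hc, hd, he, hf, hg, hh, hi⟩ := relations_hold.2.2
  induction hx using Subgroup.closure_induction with
  | mem x hx =>
    obtain ⟨k, rfl⟩ := hx
    fin_cases k
    exacts [ha, hb, hc, hd, he, hf, hg, hh, hi, rfl]
  | one => simp
  | mul x y _ _ hx hy => rw [← mul_assoc, hx, mul_assoc, hy, mul_assoc]
  | inv x _ hx => exact ((Commute.inv_right (show Commute z x from hx)))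

theorem commute_of_sq {Γ : Type*} [Group Γ] {x y : Γ} (hx : x * x = 1) (hy : y * y = 1)
    (h : (x * y) ^ 2 = 1) : x * y = y * x := by
  rw [pow_two] at h
  rw [eq_inv_of_mul_eq_one_left h, mul_inv_rev, ← eq_inv_of_mul_eq_one_left hx,
    ← eq_inv_of_mul_eq_one_left hy]

theorem braid_of_cube {Γ : Type*} [Group Γ] {x y : Γ} (hx : x * x = 1) (hy : y * y = 1)
    (h : (x * y) ^ 3 = 1) : x * y * x = y * x * y := by
  have h' : (x * y * x) * (y * x * y) = 1 := by
    rw [← h]; simp only [pow_succ, pow_zero, one_mul, mul_assoc]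
  rw [eq_inv_of_mul_eq_one_left h']
  simp only [mul_inv_rev, ← eq_inv_of_mul_eq_one_left hx, ← eq_inv_of_mul_eq_one_left hy,
    mul_assoc]

/-- Signs can be collected at the end of a power of a product. -/
theorem mul_z_pow (x : L) (n : ℕ) : (x * z) ^ n = x ^ n * z ^ n :=
  (show Commute x z from (z_comm x).symm).mul_pow n

theorem mul_z_left (x y : L) : x * z * y = x * y * z := by
  rw [mul_assoc, z_comm, mul_assoc]

theorem mul_z_z (x : L) : x * z * z = x := by rw [mul_assoc, z_mul_z, mul_one]

theorem twist_sq (x : ℕ) : twist x * twist x = 1 := by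
  have hz : ∀ t : L, (t * z) ^ 2 = t ^ 2 := fun t => by rw [mul_z_pow, z_pow_two, mul_one]
  obtain ⟨ha, hb, hc, hd, he, hf, hg, hh, hi⟩ := relations_hold.1.1
  rw [← pow_two]
  match x with
  | 0 => exact ha
  | 1 => exact hb
  | 2 => exact (hz _).trans hc
  | 3 => exact (hz _).trans hd
  | 4 => exact (hz _).trans he
  | 5 => exact hf
  | 6 => exact (hz _).trans hg
  | 7 => exact (hz _).trans hh
  | 8 => exact (hz _).trans hi
  | _ + 9 => exact one_pow 2

theorem twist_pow_two_of_lt (x y : ℕ) (hxy : x < y) (hy : y < 9) (h : adjBit x y = 0) :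
    (twist x * twist y) ^ 2 = 1 := by
  have hz : ∀ t : L, (t * z) ^ 2 = t ^ 2 := fun t => by rw [mul_z_pow, z_pow_two, mul_one]
  have hz' : ∀ s t : L, (s * (t * z)) ^ 2 = (s * t) ^ 2 := fun s t => by
    rw [← mul_assoc, hz]
  have hz'' : ∀ s t : L, (s * z * t) ^ 2 = (s * t) ^ 2 := fun s t => by
    rw [mul_z_left, hz]
  have hrel := relations_hold.1.2.2
  interval_cases y <;> interval_cases x <;>
    first
    | exact absurd h (by decide)
    | (simp only [twist, hz', hz'']; simp only [hrel])

theorem twist_pow_three_of_lt (x y : ℕ) (hxy : x < y) (hy : y < 9) (h : adjBit x y ≠ 0) :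
    (twist x * twist y) ^ 3 = 1 := by
  have hz : ∀ t : L, (t * z) ^ 3 = t ^ 3 * z := fun t => by
    rw [mul_z_pow, pow_succ z, z_pow_two, one_mul]
  have hz' : ∀ s t : L, (s * (t * z)) ^ 3 = (s * t) ^ 3 * z := fun s t => by
    rw [← mul_assoc, hz]
  have hz'' : ∀ s t : L, (s * z * t) ^ 3 = (s * t) ^ 3 * z := fun s t => by
    rw [mul_z_left, hz]
  have hrel := relations_hold.1.2.1
  interval_cases y <;> interval_cases x <;>
    first
    | exact absurd (by decide) h
    | (simp only [twist, hz', hz'']; simp only [hrel, z_mul_z, one_mul])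

theorem adjBit_comm : ∀ x < 9, ∀ y < 9, adjBit x y = adjBit y x := by decide +kernel


theorem isCoxeterFamily_twist : IsCoxeterFamily twist where
  sq := twist_sq
  comm x y hx hy h := by
    rcases lt_trichotomy x y with hxy | rfl | hxy
    · exact commute_of_sq (twist_sq x) (twist_sq y) (twist_pow_two_of_lt x y hxy hy h)
    · rfl
    · rw [adjBit_comm x hx y hy] at h
      exact (commute_of_sq (twist_sq y) (twist_sq x) (twist_pow_two_of_lt y x hxy hx h)).symm
  braid x y hx hy h := by
    rcases lt_trichotomy x y with hxy | rfl | hxy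
    · exact braid_of_cube (twist_sq x) (twist_sq y) (twist_pow_three_of_lt x y hxy hy h)
    · rfl
    · rw [adjBit_comm x hx y hy] at h
      exact (braid_of_cube (twist_sq y) (twist_sq x) (twist_pow_three_of_lt y x hxy hx h)).symm

/-- The words `efdecdhibcdh ^ 4`, `abcdefh ^ 9` and `bcdefgh ^ 9`. -/
def relators : List (List ℕ) :=
  [repeatWord 4 wordV, repeatWord 9 [0, 1, 2, 3, 4, 5, 7], repeatWord 9 [1, 2, 3, 4, 5, 6, 7]]

theorem evalWord_pow_eq_one_of_reverse {w : List ℕ} {n : ℕ}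
    (h : evalWord twist w.reverse ^ n = 1) : evalWord twist w ^ n = 1 := by
  rwa [evalWord_reverse _ twist_sq, inv_pow, inv_eq_one] at h

theorem evalWord_relators : ∀ w ∈ relators, evalWord twist w = 1 ∨ evalWord twist w = z := by
  obtain ⟨hS, hA, hG, -⟩ := relations_hold.2.1
  simp only [relators, List.mem_cons, List.not_mem_nil, or_false, forall_eq_or_imp, forall_eq,
    evalWord_repeatWord]
  refine ⟨Or.inl (evalWord_wordV isCoxeterFamily_twist (evalWord_pow_eq_one_of_reverse ?_)),
    Or.inl (evalWord_pow_eq_one_of_reverse ?_), Or.inr ?_⟩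
  · have h10 : z ^ 10 = 1 := (pow_mul z 2 5).trans (by rw [z_pow_two, one_pow])
    simp only [wordS, List.reverse_cons, List.reverse_nil, List.nil_append, List.cons_append,
      evalWord_cons, evalWord_nil, twist, one_mul, ← mul_assoc, mul_z_left, mul_z_z,
      mul_z_pow, hS, h10]
  · rw [← hA]
    simp only [List.reverse_cons, List.reverse_nil, List.nil_append, List.cons_append,
      evalWord_cons, evalWord_nil, twist, one_mul, ← mul_assoc, mul_z_left, mul_z_z]
  · have h9 : z ^ 9 = z := by
      rw [show 9 = 2 * 4 + 1 from rfl, pow_succ, pow_mul, z_pow_two, one_pow, one_mul]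
    have key : evalWord twist [7, 6, 5, 4, 3, 2, 1] ^ 9 = z := by
      simp only [evalWord_cons, evalWord_nil, twist, one_mul, ← mul_assoc, mul_z_left, mul_z_z,
        mul_z_pow, hG, h9]
    rw [show [1, 2, 3, 4, 5, 6, 7] = [7, 6, 5, 4, 3, 2, 1].reverse from rfl,
      evalWord_reverse _ twist_sq, inv_pow, key]
    exact inv_eq_of_mul_eq_one_left z_mul_z

/-! ### A coset enumeration machine for kernel evaluation -/

/-- A binary trie whose leaves are natural numbers packing 16-bit slots above 64 scratch bits. -/
inductive Trie where
  | leaf (n : ℕ) : Trie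
  | node (l r : Trie) : Trie

/-- The state of an enumeration: edge table, number of points, cursor. -/
inductive EnumState where
  | mk (t : Trie) (n p : ℕ) : EnumState

def forceNat {α : Type} (n : ℕ) (k : ℕ → α) : α :=
  Nat.rec (k (nat_lit 0)) (fun m _ => k (Nat.succ m)) n

def Trie.force {α : Type} (t : Trie) (k : Trie → α) : α :=
  Trie.rec (fun n => k (.leaf n)) (fun l r _ _ => k (.node l r)) t

def slotGet (n q : ℕ) : ℕ :=
  Nat.mod (Nat.shiftRight n (Nat.add (nat_lit 64) (Nat.mul (nat_lit 16) q))) (nat_lit 65536)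

/-- The low 64 bits only diversify hash values. -/
def slotPatch (d : ℕ) : ℕ :=
  Nat.add (Nat.shiftLeft d (nat_lit 64)) (Nat.mod d (nat_lit 2305843009213693951))

def slotSet (n q y : ℕ) : ℕ :=
  Nat.xor n (slotPatch (Nat.shiftLeft (Nat.xor (slotGet n q) y) (Nat.mul (nat_lit 16) q)))

def Trie.get (t : Trie) : ℕ → ℕ :=
  Trie.rec (fun n q => slotGet n q)
    (fun _ _ gl gr q => Nat.rec gl (fun _ _ => gr) (Nat.mod q (nat_lit 2)) (Nat.div q (nat_lit 2))) t

def nodeLeft (r l : Trie) : Trie := .node l r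

def Trie.set (t : Trie) : ℕ → ℕ → Trie :=
  Trie.rec (fun n q y => forceNat (slotSet n q y) .leaf)
    (fun l r sl sr q y => Nat.rec ((sl (Nat.div q (nat_lit 2)) y).force (nodeLeft r))
      (fun _ _ => (sr (Nat.div q (nat_lit 2)) y).force (.node l)) (Nat.mod q (nat_lit 2))) t

def next {α : Type} (t : Trie) (x g : ℕ) (fail : α) (k : ℕ → α) : α :=
  Nat.rec fail (fun y _ => k y) (t.get (Nat.add (Nat.mul (nat_lit 9) x) g))

def link {α : Type} (t : Trie) (x g y : ℕ) (k : Trie → α) : α :=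
  ((t.set (Nat.add (Nat.mul (nat_lit 9) x) g) (Nat.succ y)).set
    (Nat.add (Nat.mul (nat_lit 9) y) g) (Nat.succ x)).force k

def dihedral {α : Type} (t : Trie) (x g s : ℕ) (fail : α) (k : ℕ → α) : α :=
  next t x s fail fun y₁ => next t y₁ g fail fun y₂ => next t y₂ s fail fun y₃ =>
    Nat.rec (k y₃) (fun _ _ => next t y₃ g fail fun y₄ => next t y₄ s fail k) (adjBit g s)

def traceFwd {α : Type} (t : Trie) (fail : α) (w : List ℕ) : ℕ → (ℕ → α) → α :=
  List.rec (fun x k => k x) (fun g _ ih x k => next t x g fail fun y => ih y k) w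

abbrev EnumCont := ℕ → Trie → ℕ → ℕ → EnumState

def stepDihedral (ih : EnumCont) (s c : ℕ) (t : Trie) (n p : ℕ) : EnumState :=
  dihedral t (Nat.div p (nat_lit 9)) (Nat.mod p (nat_lit 9)) s (ih c t n (Nat.succ p)) fun y =>
    link t (Nat.div p (nat_lit 9)) (Nat.mod p (nat_lit 9)) y fun t' => ih c t' n (Nat.succ p)

def stepDefine (ih : EnumCont) (c : ℕ) (t : Trie) (n p : ℕ) : EnumState :=
  Bool.rec (ih c t n (Nat.succ p))
    (Bool.rec (ih c t n (Nat.succ p))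
      (link t (Nat.div p (nat_lit 9)) (Nat.mod p (nat_lit 9)) n fun t' => ih c t' (Nat.succ n) (Nat.succ p))
      (Nat.ble n (nat_lit 65000)))
    (Nat.ble (Nat.succ (Nat.div p (nat_lit 9))) n)

def scanRelator {α : Type} (t : Trie) (b : ℕ) (w : List ℕ) (j : ℕ) (fail : α) (k : ℕ → ℕ → ℕ → α) : α :=
  List.rec fail (fun g v _ => traceFwd t fail (w.take j) b fun y =>
    traceFwd t fail v.reverse b fun x => k x g y) (w.drop j)

def stepRelator (ws : List (List ℕ)) (ih : EnumCont) (c : ℕ) (t : Trie) (n p : ℕ) : EnumState :=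
  let c' := Nat.div c (nat_lit 268435456)
  let b := Nat.mod c (nat_lit 65536)
  Bool.rec (ih c' t n p)
    (List.rec (ih c' t n p) (fun w _ _ => scanRelator t b w (Nat.mod (Nat.div c (nat_lit 1048576)) (nat_lit 256))
      (ih c' t n p) fun x g y => link t x g y fun t' => ih c' t' n p)
      (ws.drop (Nat.mod (Nat.div c (nat_lit 65536)) (nat_lit 16))))
    (Nat.ble (Nat.succ b) n)

def stepOther (ws : List (List ℕ)) (ih : EnumCont) (k c : ℕ) (t : Trie) (n p : ℕ) : EnumState :=
  Nat.rec (stepDefine ih c t n p) (fun k _ =>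
    Nat.rec (ih c t n (Nat.succ p)) (fun k _ =>
    Nat.rec (ih c t n (Nat.add p (nat_lit 2))) (fun k _ =>
    Nat.rec (ih (Nat.div c (nat_lit 16)) t n (Nat.add p (Nat.add (nat_lit 3) (Nat.mod c (nat_lit 16))))) (fun k _ =>
    Nat.rec (ih (Nat.div c (nat_lit 256)) t n (Nat.add p (Nat.mul (nat_lit 16) (Nat.mod c (nat_lit 256)))))
      (fun _ _ => stepRelator ws ih c t n p) k) k) k) k) k

def step (ws : List (List ℕ)) (ih : EnumCont) (c c' : ℕ) (t : Trie) (n p : ℕ) : EnumState :=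
  Nat.rec (forceNat n fun n => forceNat p fun p => .mk t n p) (fun s _ =>
    Bool.rec (stepOther ws ih (Nat.sub s (nat_lit 9)) c' t n p) (stepDihedral ih s c' t n p)
      (Nat.ble s (nat_lit 8))) c

def runChunk (ws : List (List ℕ)) (fuel : ℕ) : EnumCont :=
  Nat.rec (fun _ t n p => .mk t n p)
    (fun _ ih c => step ws ih (Nat.mod c (nat_lit 16)) (Nat.div c (nat_lit 16))) fuel

def runChunks (ws : List (List ℕ)) (cs : List ℕ) : EnumState → EnumState :=
  List.rec (fun st => st) (fun c _ ih st =>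
    EnumState.rec (fun t n p => ih (Bool.rec (runChunk ws (nat_lit 128) c t n p) (.mk t n (nat_lit 0)) (Nat.beq c (nat_lit 0)))) st) cs

def blank (d : ℕ) : Trie := Nat.rec (.leaf (nat_lit 0)) (fun _ t => t.force fun t => .node t t) d

def initial (d : ℕ) (gs : List ℕ) : Trie :=
  List.rec (blank d) (fun g _ t => t.set g (nat_lit 1)) gs

def allEdges (t : Trie) (gs : List ℕ) (x : ℕ) : Bool :=
  List.rec true (fun g _ ih => next t x g false fun _ => ih) gs

def allDyadic (f : ℕ → Bool) (d : ℕ) : ℕ → Bool :=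
  Nat.rec (fun x => f x) (fun _ ih x => Bool.rec false (forceNat (Nat.succ (Nat.mul (nat_lit 2) x)) ih)
    (forceNat (Nat.mul (nat_lit 2) x) ih)) d

def allBelow (f : ℕ → Bool) (N : ℕ) : Bool :=
  allDyadic (fun x => Bool.rec (f x) true (Nat.ble N x)) (Nat.succ (Nat.log2 N)) (nat_lit 0)

def descends (t : Trie) (us : List (List ℕ)) (x : ℕ) : Bool :=
  List.rec false (fun u _ ih => traceFwd t ih u x fun y => Bool.rec ih true (Nat.ble (Nat.succ y) x)) us

def reachesRep (t : Trie) (us reps : List (List ℕ)) (x : ℕ) : Bool :=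
  Bool.rec (List.rec false (fun r _ ih => traceFwd t ih r 0 fun y => Bool.rec ih true (Nat.beq y x)) reps) true
    (descends t us x)

def checkOrbits (t : Trie) (N : ℕ) (os : List (List (List ℕ) × List (List ℕ))) : Bool :=
  os.all fun o => allBelow (reachesRep t o.1 o.2) N

def enumerate (d : ℕ) (ws : List (List ℕ)) (sub : List ℕ) (cs : List ℕ) : EnumState :=
  runChunks ws cs (.mk (initial d sub) (nat_lit 1) (nat_lit 0))

def checkTable (st : EnumState) (gs : List ℕ) (N : ℕ) (os : List (List (List ℕ) × List (List ℕ))) : Bool :=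
  EnumState.rec (fun t n _ => Nat.beq n N && (allBelow (allEdges t gs) N && checkOrbits t N os)) st

def samePoint (t : Trie) (u v : List ℕ) : Bool :=
  traceFwd t false u (nat_lit 0) fun x => traceFwd t false v (nat_lit 0) fun y => Nat.beq x y

def checkPairs (st : EnumState) (ps : List (List ℕ × List ℕ)) : Bool :=
  EnumState.rec (fun t _ _ => ps.all fun p => samePoint t p.1 p.2) st

/-! ### Soundness of the enumeration machine -/

@[simp] theorem forceNat_eq {α : Type} (n : ℕ) (k : ℕ → α) : forceNat n k = k n := by
  cases n <;> rfl

@[simp] theorem Trie.force_eq {α : Type} (t : Trie) (k : Trie → α) : t.force k = k t := by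
  cases t <;> rfl

theorem testBit_slotGet (n q j : ℕ) :
    (slotGet n q).testBit j = (decide (j < 16) && n.testBit (64 + 16 * q + j)) := by
  change ((n >>> (64 + 16 * q)) % 2 ^ 16).testBit j = _
  rw [Nat.testBit_mod_two_pow, Nat.testBit_shiftRight]

theorem slotGet_lt (n q : ℕ) : slotGet n q < 2 ^ 16 := Nat.mod_lt _ (by decide)

theorem testBit_slotPatch (m j : ℕ) : (slotPatch m).testBit (64 + j) = m.testBit j := by
  change (m <<< 64 + m % 2305843009213693951).testBit (64 + j) = _
  have h : m % 2305843009213693951 < 2 ^ 64 :=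
    (Nat.mod_lt m (by decide)).trans (by decide)
  rw [Nat.shiftLeft_eq, mul_comm, Nat.testBit_two_pow_mul_add m h]
  simp

theorem slotGet_slotSet (n q y q' : ℕ) (hy : y < 2 ^ 16) :
    slotGet (slotSet n q y) q' = if q' = q then y else slotGet n q' := by
  have key : ∀ j, (slotGet (slotSet n q y) q').testBit j = (decide (j < 16) &&
      (n.testBit (64 + 16 * q' + j) ^^ ((slotGet n q ^^^ y) <<< (16 * q)).testBit (16 * q' + j))) := by
    intro j
    rw [testBit_slotGet]
    change (_ && (n ^^^ slotPatch ((slotGet n q ^^^ y) <<< (16 * q))).testBit _) = _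
    rw [Nat.testBit_xor, add_assoc, testBit_slotPatch]
  have hlt : slotGet n q ^^^ y < 2 ^ 16 := Nat.xor_lt_two_pow (slotGet_lt n q) hy
  apply Nat.eq_of_testBit_eq
  intro j
  rw [key, Nat.testBit_shiftLeft]
  by_cases hj : j < 16
  · split_ifs with hq
    · subst hq
      rw [show 16 * q' + j - 16 * q' = j by omega, Nat.testBit_xor, testBit_slotGet]
      simp [hj]
    · rw [testBit_slotGet]
      rcases Nat.lt_or_gt_of_ne hq with h | h
      · simp [hj, show ¬ (16 * q ≤ 16 * q' + j) by omega]
      · rw [Nat.testBit_lt_two_pow (lt_of_lt_of_le hlt (Nat.pow_le_pow_right (by decide)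
          (show 16 ≤ 16 * q' + j - 16 * q by omega)))]
        simp [hj]
  · split_ifs with hq
    · rw [Nat.testBit_lt_two_pow (lt_of_lt_of_le hy (Nat.pow_le_pow_right (by decide)
        (show 16 ≤ j by omega)))]
      simp [hj]
    · rw [testBit_slotGet]
      simp [hj]

theorem Trie.get_node (l r : Trie) (q : ℕ) :
    (Trie.node l r).get q = if q % 2 = 0 then l.get (q / 2) else r.get (q / 2) := by
  change (Nat.rec l.get (fun _ _ => r.get) (q % 2) : ℕ → ℕ) (q / 2) = _
  cases q % 2 <;> simp

theorem Trie.set_node (l r : Trie) (q y : ℕ) :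
    (Trie.node l r).set q y =
      if q % 2 = 0 then .node (l.set (q / 2) y) r else .node l (r.set (q / 2) y) := by
  change (Nat.rec ((l.set (q / 2) y).force (nodeLeft r))
    (fun _ _ => (r.set (q / 2) y).force (.node l)) (q % 2) : Trie) = _
  cases q % 2 <;> simp [nodeLeft]

theorem Trie.get_set (t : Trie) (q y q' : ℕ) (hy : y < 2 ^ 16) :
    (t.set q y).get q' = if q' = q then y else t.get q' := by
  induction t generalizing q q' with
  | leaf n =>
    change (forceNat (slotSet n q y) Trie.leaf).get q' = _
    rw [forceNat_eq]
    exact slotGet_slotSet n q y q' hy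
  | node l r hl hr =>
    have h1 := Nat.div_add_mod q 2
    have h2 := Nat.div_add_mod q' 2
    rw [Trie.set_node]
    by_cases hq : q % 2 = 0 <;> by_cases hq' : q' % 2 = 0 <;>
      simp only [hq, hq', if_true, if_false, Trie.get_node, hl, hr] <;>
      (split_ifs <;> first | rfl | omega)

section soundness

variable {Q : Type*} [MulAction L Q]

/-- The entries of `t` describe the action of the generators on the points `c 0, …, c (n - 1)`. -/
structure Describes (t : Trie) (n : ℕ) (c : ℕ → Q) : Prop where
  pos : 0 < n
  le : n ≤ 65001
  edge : ∀ q y, t.get q = y + 1 → q / 9 < n ∧ y < n ∧ twist (q % 9) • c (q / 9) = c y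

theorem next_ind {α : Type} {P : α → Prop} {t : Trie} {n : ℕ} {c : ℕ → Q}
    (hc : Describes t n c) {x g : ℕ} (hg : g < 9) {fail : α} {k : ℕ → α} (hfail : P fail)
    (hk : ∀ y, x < n → y < n → twist g • c x = c y → P (k y)) : P (next t x g fail k) := by
  change P (Nat.rec fail (fun y _ => k y) (t.get (9 * x + g)))
  cases h : t.get (9 * x + g) with
  | zero => exact hfail
  | succ y =>
    have := hc.edge _ _ h
    rw [show (9 * x + g) / 9 = x by omega, show (9 * x + g) % 9 = g by omega] at this
    exact hk y this.1 this.2.1 this.2.2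

theorem link_ind {α : Type} {P : α → Prop} {t : Trie} {n : ℕ} {c : ℕ → Q}
    (hc : Describes t n c) {x g y : ℕ} (hg : g < 9) (hx : x < n) (hy : y < n)
    (hxy : twist g • c x = c y) {k : Trie → α} (hk : ∀ t', Describes t' n c → P (k t')) :
    P (link t x g y k) := by
  have hyx : twist g • c y = c x := by rw [← hxy, smul_smul, twist_sq, one_smul]
  have := hc.le
  unfold link
  rw [Trie.force_eq]
  refine hk _ ⟨hc.pos, hc.le, fun q w => ?_⟩
  change ((t.set (9 * x + g) (y + 1)).set (9 * y + g) (x + 1)).get q = w + 1 → _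
  rw [Trie.get_set _ _ _ _ (by omega), Trie.get_set _ _ _ _ (by omega)]
  split_ifs with h1 h2
  · rintro h
    obtain rfl : x = w := by omega
    rw [h1, show (9 * y + g) / 9 = y by omega, show (9 * y + g) % 9 = g by omega]
    exact ⟨hy, hx, hyx⟩
  · rintro h
    obtain rfl : y = w := by omega
    rw [h2, show (9 * x + g) / 9 = x by omega, show (9 * x + g) % 9 = g by omega]
    exact ⟨hx, hy, hxy⟩
  · exact hc.edge q w

theorem Describes.extend {t : Trie} {n : ℕ} {c : ℕ → Q} (hc : Describes t n c) (hn : n ≤ 65000)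
    (q : Q) : Describes t (n + 1) (Function.update c n q) := by
  refine ⟨by omega, by omega, fun r y h => ?_⟩
  obtain ⟨h1, h2, h3⟩ := hc.edge r y h
  refine ⟨by omega, by omega, ?_⟩
  rw [Function.update_of_ne (by omega), Function.update_of_ne (by omega), h3]

theorem dihedral_ind {α : Type} {P : α → Prop} {t : Trie} {n : ℕ} {c : ℕ → Q}
    (hc : Describes t n c) {x g s : ℕ} (hg : g < 9) (hs : s < 9) {fail : α} {k : ℕ → α}
    (hfail : P fail) (hk : ∀ y, x < n → y < n → twist g • c x = c y → P (k y)) :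
    P (dihedral t x g s fail k) := by
  unfold dihedral
  refine next_ind hc hs hfail fun y₁ hx _ h₁ => next_ind hc hg hfail fun y₂ _ _ h₂ =>
    next_ind hc hs hfail fun y₃ _ hy₃ h₃ => ?_
  cases hadj : adjBit g s with
  | zero =>
    refine hk y₃ hx hy₃ ?_
    rw [← h₃, ← h₂, ← h₁, smul_smul, smul_smul, mul_assoc,
      isCoxeterFamily_twist.comm g s hg hs hadj, ← mul_assoc, twist_sq, one_mul]
  | succ m =>
    refine next_ind hc hg hfail fun y₄ _ _ h₄ => next_ind hc hs hfail fun y₅ _ hy₅ h₅ =>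
      hk y₅ hx hy₅ ?_
    rw [← h₅, ← h₄, ← h₃, ← h₂, ← h₁]
    simp only [smul_smul, ← mul_assoc]
    rw [isCoxeterFamily_twist.braid s g hs hg (by rw [adjBit_comm s hs g hg, hadj]; simp)]
    rw [mul_assoc (twist g * twist s), twist_sq, mul_one, mul_assoc, twist_sq, mul_one]

theorem traceFwd_ind {α : Type} {P : α → Prop} {t : Trie} {n : ℕ} {c : ℕ → Q}
    (hc : Describes t n c) {fail : α} {w : List ℕ} (hw : ∀ g ∈ w, g < 9) {x : ℕ} (hx : x < n)
    {k : ℕ → α} (hfail : P fail)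
    (hk : ∀ y, y < n → evalWord twist w • c x = c y → P (k y)) :
    P (traceFwd t fail w x k) := by
  induction w generalizing x with
  | nil => exact hk x hx (one_smul _ _)
  | cons g w ih =>
    change P (next t x g fail fun y => traceFwd t fail w y k)
    refine next_ind hc (hw g (by simp)) hfail fun y _ hy h =>
      ih (fun g hg => hw g (by simp [hg])) hy fun y' hy' h' => hk y' hy' ?_
    rw [evalWord_cons, mul_smul, h, h']

/-- The state describes an action in which the first point is `o`. -/
def EnumState.Valid (o : Q) : EnumState → Prop
  | .mk t n _ => ∃ c : ℕ → Q, c 0 = o ∧ Describes t n c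

theorem stepDihedral_valid {o : Q} {ih : EnumCont}
    (hih : ∀ k t n p, (EnumState.mk t n p).Valid o → (ih k t n p).Valid o) {s k : ℕ} (hs : s < 9)
    {t : Trie} {n p : ℕ} (h : (EnumState.mk t n p).Valid o) :
    (stepDihedral ih s k t n p).Valid o := by
  obtain ⟨c, hc0, hc⟩ := h
  have hg : Nat.mod p 9 < 9 := Nat.mod_lt p (by decide)
  refine dihedral_ind (P := EnumState.Valid o) hc hg hs (hih _ _ _ _ ⟨c, hc0, hc⟩)
    fun y hx hy hxy => ?_
  exact link_ind (P := EnumState.Valid o) hc hg hx hy hxy fun t' ht' =>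
    hih _ _ _ _ ⟨c, hc0, ht'⟩

theorem stepDefine_valid {o : Q} {ih : EnumCont}
    (hih : ∀ k t n p, (EnumState.mk t n p).Valid o → (ih k t n p).Valid o) {k : ℕ}
    {t : Trie} {n p : ℕ} (h : (EnumState.mk t n p).Valid o) :
    (stepDefine ih k t n p).Valid o := by
  obtain ⟨c, hc0, hc⟩ := h
  have hg : Nat.mod p 9 < 9 := Nat.mod_lt p (by decide)
  unfold stepDefine
  cases h1 : Nat.ble (Nat.succ (Nat.div p (nat_lit 9))) n with
  | false => exact hih _ _ _ _ ⟨c, hc0, hc⟩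
  | true =>
    cases h2 : Nat.ble n (nat_lit 65000) with
    | false => exact hih _ _ _ _ ⟨c, hc0, hc⟩
    | true =>
      have h1' : p / 9 < n := Nat.le_of_ble_eq_true h1
      have h2' : n ≤ 65000 := Nat.le_of_ble_eq_true h2
      have hc' := hc.extend h2' (twist (Nat.mod p 9) • c (p / 9))
      refine link_ind (P := EnumState.Valid o) hc' hg (Nat.lt_succ_of_lt h1')
        (Nat.lt_succ_self n) ?_ fun t' ht' => hih _ _ _ _ ⟨_, ?_, ht'⟩
      · change _ • Function.update c n _ (p / 9) = _
        rw [Function.update_of_ne (ne_of_lt h1'), Function.update_self]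
      · rw [Function.update_of_ne (ne_of_lt hc.pos), hc0]

theorem scanRelator_ind {α : Type} {P : α → Prop} {t : Trie} {n : ℕ} {c : ℕ → Q}
    (hc : Describes t n c) {b : ℕ} (hb : b < n) {w : List ℕ} (hw : ∀ g ∈ w, g < 9)
    (hact : ∀ q : Q, evalWord twist w • q = q) {j : ℕ} {fail : α} {k : ℕ → ℕ → ℕ → α}
    (hfail : P fail)
    (hk : ∀ x g y, g < 9 → x < n → y < n → twist g • c x = c y → P (k x g y)) :
    P (scanRelator t b w j fail k) := by
  unfold scanRelator
  cases hv : w.drop j with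
  | nil => exact hfail
  | cons g v =>
    have hsplit : w = w.take j ++ g :: v := by rw [← hv, List.take_append_drop]
    have hmem : ∀ x ∈ g :: v, x < 9 := fun x hx => hw x (by rw [hsplit]; simp [hx])
    refine traceFwd_ind hc (fun x hx => hw x (List.mem_of_mem_take hx)) hb hfail
      fun y hy h1 => ?_
    refine traceFwd_ind hc (fun x hx => hmem x (by simp [List.mem_reverse.1 hx])) hb hfail
      fun x hx h2 => hk x g y (hmem g (by simp)) hx hy ?_
    have h3 := hact (c b)
    rw [hsplit, evalWord_append, evalWord_cons, mul_smul, h1, mul_smul] at h3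
    rw [← h2, ← h3, smul_smul, smul_smul, smul_smul, mul_assoc (twist g * _), mul_assoc (twist g),
      ← mul_assoc (evalWord _ _), evalWord_reverse_mul _ twist_sq, one_mul, twist_sq, one_smul]

variable {ws : List (List ℕ)}

theorem stepRelator_valid {o : Q} (hws : ∀ w ∈ ws, ∀ g ∈ w, g < 9)
    (hact : ∀ w ∈ ws, ∀ q : Q, evalWord twist w • q = q) {ih : EnumCont}
    (hih : ∀ k t n p, (EnumState.mk t n p).Valid o → (ih k t n p).Valid o) {k : ℕ}
    {t : Trie} {n p : ℕ} (h : (EnumState.mk t n p).Valid o) :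
    (stepRelator ws ih k t n p).Valid o := by
  unfold stepRelator
  dsimp only
  have hskip := hih (Nat.div k (nat_lit 268435456)) t n p h
  cases h1 : Nat.ble (Nat.succ (Nat.mod k (nat_lit 65536))) n with
  | false => exact hskip
  | true =>
    cases h2 : ws.drop (Nat.mod (Nat.div k (nat_lit 65536)) (nat_lit 16)) with
    | nil => exact hskip
    | cons w _ =>
      have hmem : w ∈ ws := List.mem_of_mem_drop (by rw [h2]; simp)
      obtain ⟨c, hc0, hc⟩ := h
      refine scanRelator_ind (P := EnumState.Valid o) hc (Nat.le_of_ble_eq_true h1) (hws w hmem)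
        (hact w hmem) hskip fun x g y hg hx hy hxy => ?_
      exact link_ind (P := EnumState.Valid o) hc hg hx hy hxy fun t' ht' =>
        hih _ _ _ _ ⟨c, hc0, ht'⟩

theorem stepOther_valid {o : Q} (hws : ∀ w ∈ ws, ∀ g ∈ w, g < 9)
    (hact : ∀ w ∈ ws, ∀ q : Q, evalWord twist w • q = q) {ih : EnumCont}
    (hih : ∀ k t n p, (EnumState.mk t n p).Valid o → (ih k t n p).Valid o) (m : ℕ) {k : ℕ}
    {t : Trie} {n p : ℕ} (h : (EnumState.mk t n p).Valid o) :
    (stepOther ws ih m k t n p).Valid o := by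
  match m with
  | 0 => exact stepDefine_valid hih h
  | 1 => exact hih _ _ _ _ h
  | 2 => exact hih _ _ _ _ h
  | 3 => exact hih _ _ _ _ h
  | 4 => exact hih _ _ _ _ h
  | _ + 5 => exact stepRelator_valid hws hact hih h

theorem runChunk_valid {o : Q} (hws : ∀ w ∈ ws, ∀ g ∈ w, g < 9)
    (hact : ∀ w ∈ ws, ∀ q : Q, evalWord twist w • q = q) (fuel : ℕ) (k : ℕ) (t : Trie) (n p : ℕ)
    (h : (EnumState.mk t n p).Valid o) : (runChunk ws fuel k t n p).Valid o := by
  induction fuel generalizing k t n p with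
  | zero => exact h
  | succ fuel ih =>
    change (step ws (runChunk ws fuel) (Nat.mod k 16) (Nat.div k 16) t n p).Valid o
    unfold step
    cases Nat.mod k 16 with
    | zero =>
      dsimp only
      rw [forceNat_eq, forceNat_eq]
      exact h
    | succ s =>
      dsimp only
      cases hs : Nat.ble s (nat_lit 8) with
      | false => exact stepOther_valid hws hact ih _ h
      | true => exact stepDihedral_valid ih (Nat.lt_succ_of_le (Nat.le_of_ble_eq_true hs)) h

theorem runChunks_valid {o : Q} (hws : ∀ w ∈ ws, ∀ g ∈ w, g < 9)
    (hact : ∀ w ∈ ws, ∀ q : Q, evalWord twist w • q = q) (ks : List ℕ) (st : EnumState)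
    (h : st.Valid o) : (runChunks ws ks st).Valid o := by
  induction ks generalizing st with
  | nil => exact h
  | cons k ks ih =>
    obtain ⟨t, n, p⟩ := st
    change (runChunks ws ks (Bool.rec (runChunk ws 128 k t n p) (.mk t n 0) (Nat.beq k 0))).Valid o
    apply ih
    cases Nat.beq k 0 with
    | false => exact runChunk_valid hws hact _ _ _ _ _ h
    | true => exact h

theorem get_blank (depth q : ℕ) : (blank depth).get q = 0 := by
  induction depth generalizing q with
  | zero =>
    change (0 >>> (64 + 16 * q)) % 65536 = 0
    simp
  | succ depth ih =>
    change ((blank depth).force fun t => Trie.node t t).get q = 0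
    rw [Trie.force_eq, Trie.get_node, ih, ite_self]

theorem initial_valid {o : Q} (depth : ℕ) {gs : List ℕ} (hgs : ∀ g ∈ gs, g < 9)
    (ho : ∀ g ∈ gs, twist g • o = o) (p : ℕ) :
    (EnumState.mk (initial depth gs) 1 p).Valid o := by
  refine ⟨fun _ => o, rfl, by decide, by decide, ?_⟩
  induction gs with
  | nil =>
    intro q y h
    have : (initial depth []).get q = 0 := get_blank depth q
    omega
  | cons g gs ih =>
    intro q y
    change ((initial depth gs).set g 1).get q = y + 1 → _
    rw [Trie.get_set _ _ _ _ (by decide)]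
    split_ifs with hq
    · intro h
      have := hgs g (by simp)
      refine ⟨by omega, by omega, ?_⟩
      rw [hq, Nat.mod_eq_of_lt this]
      exact ho g (by simp)
    · exact ih (fun g hg => hgs g (by simp [hg])) (fun g hg => ho g (by simp [hg])) q y

theorem enumerate_valid {o : Q} (hws : ∀ w ∈ ws, ∀ g ∈ w, g < 9)
    (hact : ∀ w ∈ ws, ∀ q : Q, evalWord twist w • q = q) (depth : ℕ) {gs : List ℕ}
    (hgs : ∀ g ∈ gs, g < 9) (ho : ∀ g ∈ gs, twist g • o = o) (ks : List ℕ) :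
    (enumerate depth ws gs ks).Valid o :=
  runChunks_valid hws hact _ _ (initial_valid depth hgs ho 0)

theorem allDyadic_spec {P : ℕ → Bool} {depth x : ℕ} (h : allDyadic P depth x = true) (y : ℕ)
    (hy : x * 2 ^ depth ≤ y) (hy' : y < (x + 1) * 2 ^ depth) : P y = true := by
  induction depth generalizing x with
  | zero =>
    obtain rfl : x = y := by omega
    exact h
  | succ depth ih =>
    change (Bool.rec false (forceNat (2 * x + 1) (allDyadic P depth))
      (forceNat (2 * x) (allDyadic P depth)) : Bool) = true at h
    rw [forceNat_eq, forceNat_eq] at h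
    cases h0 : allDyadic P depth (2 * x) with
    | false => rw [h0] at h; simp at h
    | true =>
      rw [h0] at h
      rw [pow_succ] at hy hy'
      by_cases hlt : y < (2 * x + 1) * 2 ^ depth
      · exact ih h0 (by nlinarith) hlt
      · exact ih h (by omega) (by nlinarith)

theorem allBelow_spec {P : ℕ → Bool} {N : ℕ} (h : allBelow P N = true) (x : ℕ) (hx : x < N) :
    P x = true := by
  have hlt : N < 2 ^ (Nat.log2 N + 1) := Nat.lt_log2_self
  have := allDyadic_spec h x (by simp) (by simpa using hx.trans hlt)
  have hble : Nat.ble N x = false := by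
    cases hb : Nat.ble N x with
    | false => rfl
    | true => have := Nat.le_of_ble_eq_true hb; omega
  rw [hble] at this
  exact this

end soundness

/-! ### Double coset decompositions from complete tables -/

section tables

variable {Q : Type*} [MulAction L Q]

/-- The subgroup generated by `z` and some of the generators. -/
def parabolic (gs : List ℕ) : Subgroup L :=
  Subgroup.closure (insert z {x | ∃ g ∈ gs, x = twist g})

theorem z_mem_parabolic (gs : List ℕ) : z ∈ parabolic gs := Subgroup.subset_closure (Or.inl rfl)

theorem twist_mem_parabolic {gs : List ℕ} {x : ℕ} (hx : x ∈ gs) : twist x ∈ parabolic gs :=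
  Subgroup.subset_closure (Or.inr ⟨x, hx, rfl⟩)

theorem evalWord_mem_parabolic {gs w : List ℕ} (hw : ∀ x ∈ w, x ∈ gs) :
    evalWord twist w ∈ parabolic gs := by
  induction w with
  | nil => exact one_mem _
  | cons x w ih =>
    exact mul_mem (ih fun y hy => hw y (by simp [hy])) (twist_mem_parabolic (hw x (by simp)))

/-- Sets stable under involutive generators and `z` are stable under the subgroup. -/
theorem smul_mem_of_mem_parabolic {gs : List ℕ} {Y : Set Q} (hz : ∀ q ∈ Y, z • q ∈ Y)
    (hY : ∀ g ∈ gs, ∀ q ∈ Y, twist g • q ∈ Y) {x : L} (hx : x ∈ parabolic gs) :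
    ∀ q ∈ Y, x • q ∈ Y := by
  have hgen : ∀ y ∈ insert z {x | ∃ g ∈ gs, x = twist g}, ∀ q ∈ Y, y • q ∈ Y := by
    rintro y (rfl | ⟨g, hg, rfl⟩)
    exacts [hz, hY g hg]
  refine Subgroup.closure_induction'' (p := fun x _ => ∀ q ∈ Y, x • q ∈ Y) hgen ?_ ?_ ?_ hx
  · rintro y (rfl | ⟨g, hg, rfl⟩)
    · rw [inv_eq_of_mul_eq_one_left z_mul_z]; exact hz
    · rw [inv_eq_of_mul_eq_one_left (twist_sq g)]; exact hY g hg
  · intro q hq; rwa [one_smul]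
  · intro x y _ _ hx hy q hq
    rw [mul_smul]
    exact hx _ (hy _ hq)

theorem evalWord_relators_smul (hz : ∀ q : Q, z • q = q) :
    ∀ w ∈ relators, ∀ q : Q, evalWord twist w • q = q := by
  intro w hw q
  rcases evalWord_relators w hw with h | h
  · rw [h, one_smul]
  · rw [h, hz]

theorem relators_lt : ∀ w ∈ relators, ∀ g ∈ w, g < 9 := by decide +kernel

theorem smul_eq_of_allEdges {t : Trie} {n : ℕ} {c : ℕ → Q} (hc : Describes t n c) {gs : List ℕ}
    (hgs : ∀ g ∈ gs, g < 9) {x : ℕ} (h : allEdges t gs x = true) :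
    ∀ g ∈ gs, ∃ y < n, twist g • c x = c y := by
  induction gs with
  | nil => simp
  | cons g gs ih =>
    have key : next t x g false (fun _ => allEdges t gs x) = true →
        (∃ y < n, twist g • c x = c y) ∧ allEdges t gs x = true :=
      next_ind (P := fun v => v = true → (∃ y < n, twist g • c x = c y) ∧
        allEdges t gs x = true) hc (hgs g (by simp)) (by simp)
        fun y _ hy hxy h => ⟨⟨y, hy, hxy⟩, h⟩
    obtain ⟨h1, h2⟩ := key h
    intro g' hg'
    rcases List.mem_cons.1 hg' with rfl | hg'
    · exact h1
    · exact ih (fun g hg => hgs g (by simp [hg])) h2 g' hg'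

theorem descends_spec {t : Trie} {n : ℕ} {c : ℕ → Q} (hc : Describes t n c) {us : List (List ℕ)}
    (hus : ∀ u ∈ us, ∀ g ∈ u, g < 9) {x : ℕ} (hx : x < n) (h : descends t us x = true) :
    ∃ u ∈ us, ∃ y < x, evalWord twist u • c x = c y := by
  induction us with
  | nil => exact absurd h (by simp [descends])
  | cons u us ih =>
    have key : traceFwd t (descends t us x) u x
        (fun y => Bool.rec (descends t us x) true (Nat.ble (Nat.succ y) x)) = true →
        (∃ y < x, evalWord twist u • c x = c y) ∨ descends t us x = true := by
      refine traceFwd_ind (P := fun v => v = true → (∃ y < x, evalWord twist u • c x = c y) ∨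
        descends t us x = true) hc (hus u (by simp)) hx Or.inr fun y _ hxy => ?_
      cases hb : Nat.ble (Nat.succ y) x with
      | false => exact Or.inr
      | true => exact fun _ => Or.inl ⟨y, Nat.le_of_ble_eq_true hb, hxy⟩
    rcases key h with h | h
    · exact ⟨u, by simp, h⟩
    · obtain ⟨u', hu', h'⟩ := ih (fun u hu => hus u (by simp [hu])) h
      exact ⟨u', by simp [hu'], h'⟩

theorem reachesRep_spec {t : Trie} {n : ℕ} {c : ℕ → Q} (hc : Describes t n c)
    {us reps : List (List ℕ)} (hus : ∀ u ∈ us, ∀ g ∈ u, g < 9) (hreps : ∀ r ∈ reps, ∀ g ∈ r, g < 9)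
    {x : ℕ} (hx : x < n) (h : reachesRep t us reps x = true) :
    (∃ u ∈ us, ∃ y < x, evalWord twist u • c x = c y) ∨
      ∃ r ∈ reps, evalWord twist r • c 0 = c x := by
  unfold reachesRep at h
  cases hd : descends t us x with
  | true => exact Or.inl (descends_spec hc hus hx hd)
  | false =>
    rw [hd] at h
    right
    clear hd
    dsimp only at h
    induction reps with
    | nil => exact absurd h (by simp)
    | cons r reps ih =>
      have key : traceFwd t (List.rec false (fun r _ ih => traceFwd t ih r 0 fun y =>
            Bool.rec ih true (Nat.beq y x)) reps) r 0 (fun y => Bool.rec (List.rec false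
            (fun r _ ih => traceFwd t ih r 0 fun y => Bool.rec ih true (Nat.beq y x)) reps) true
            (Nat.beq y x)) = true →
          evalWord twist r • c 0 = c x ∨ (List.rec false (fun r _ ih => traceFwd t ih r 0 fun y =>
            Bool.rec ih true (Nat.beq y x)) reps : Bool) = true := by
        refine traceFwd_ind (P := fun v => v = true → _) hc (hreps r (by simp)) hc.pos Or.inr
          fun y _ hxy => ?_
        cases hb : Nat.beq y x with
        | false => exact Or.inr
        | true =>
          obtain rfl := Nat.eq_of_beq_eq_true hb
          exact fun _ => Or.inl hxy
      rcases key h with h | h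
      · exact ⟨r, by simp, h⟩
      · obtain ⟨r', hr', h'⟩ := ih (fun r hr => hreps r (by simp [hr])) h
        exact ⟨r', by simp [hr'], h'⟩

theorem exists_rep_of_checkTable {o : Q} (hz : ∀ q : Q, z • q = q) {st : EnumState}
    (hst : st.Valid o) {gs : List ℕ} {N : ℕ} {os : List (List (List ℕ) × List (List ℕ))}
    (h : checkTable st gs N os = true) (hgs : ∀ g ∈ gs, g < 9)
    (hos : ∀ p ∈ os, (∀ u ∈ p.1, ∀ g ∈ u, g < 9) ∧ ∀ r ∈ p.2, ∀ g ∈ r, g < 9)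
    {p : List (List ℕ) × List (List ℕ)} (hp : p ∈ os) {x : L} (hx : x ∈ parabolic gs) :
    ∃ k ∈ Subgroup.closure {y | ∃ u ∈ p.1, y = evalWord twist u}, ∃ r ∈ p.2,
      k • x • o = evalWord twist r • o := by
  obtain ⟨t, n, m⟩ := st
  obtain ⟨c, rfl, hc⟩ := hst
  change (Nat.beq n N && (allBelow (allEdges t gs) N && checkOrbits t N os)) = true at h
  simp only [Bool.and_eq_true] at h
  obtain ⟨h1, h2, h3⟩ := h
  obtain rfl := Nat.eq_of_beq_eq_true h1
  have hY : x • c 0 ∈ {q | ∃ y < n, q = c y} := by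
    refine smul_mem_of_mem_parabolic (fun q hq => by rwa [hz]) ?_ hx (c 0) ⟨0, hc.pos, rfl⟩
    rintro g hg _ ⟨y, hy, rfl⟩
    obtain ⟨y', hy', h⟩ := smul_eq_of_allEdges hc hgs (allBelow_spec h2 y hy) g hg
    exact ⟨y', hy', h⟩
  obtain ⟨y, hy, hxy⟩ := hY
  rw [hxy]
  clear hxy
  induction y using Nat.strong_induction_on with
  | _ y ih =>
    have hr := allBelow_spec (List.all_eq_true.1 h3 p hp) y hy
    rcases reachesRep_spec hc (hos p hp).1 (hos p hp).2 hy hr with ⟨u, hu, y', hy', hyy⟩ | ⟨r, hr, h⟩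
    · obtain ⟨k, hk, r, hr, h⟩ := ih y' hy' (hy'.trans hy)
      refine ⟨k * evalWord twist u, mul_mem hk (Subgroup.subset_closure ⟨u, hu, rfl⟩), r, hr, ?_⟩
      rw [mul_smul, hyy, h]
    · exact ⟨1, one_mem _, r, hr, by rw [one_smul, h]⟩

theorem smul_eq_of_checkPairs {o : Q} {st : EnumState} (hst : st.Valid o)
    {ps : List (List ℕ × List ℕ)} (h : checkPairs st ps = true)
    (hps : ∀ p ∈ ps, (∀ g ∈ p.1, g < 9) ∧ ∀ g ∈ p.2, g < 9) :
    ∀ p ∈ ps, evalWord twist p.1 • o = evalWord twist p.2 • o := by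
  obtain ⟨t, n, m⟩ := st
  obtain ⟨c, rfl, hc⟩ := hst
  intro p hp
  have hsame : samePoint t p.1 p.2 = true := List.all_eq_true.1 h p hp
  revert hsame
  refine traceFwd_ind (P := fun v => v = true → evalWord twist p.1 • c 0 = evalWord twist p.2 • c 0)
    hc (hps p hp).1 hc.pos (by simp) fun x _ hx => ?_
  refine traceFwd_ind (P := fun v => v = true → evalWord twist p.1 • c 0 = evalWord twist p.2 • c 0)
    hc (hps p hp).2 hc.pos (by simp) fun y _ hy hxy => ?_
  obtain rfl := Nat.eq_of_beq_eq_true hxy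
  rw [hx, hy]

end tables

theorem z_smul_quotient (gs : List ℕ) (q : L ⧸ parabolic gs) : z • q = q := by
  obtain ⟨x, rfl⟩ := QuotientGroup.mk_surjective q
  change ((z * x : L) : L ⧸ parabolic gs) = x
  rw [z_comm, QuotientGroup.mk_mul_of_mem x (z_mem_parabolic gs)]

theorem smul_base_eq_iff (gs : List ℕ) (x : L) :
    x • ((1 : L) : L ⧸ parabolic gs) = ((1 : L) : L ⧸ parabolic gs) ↔ x ∈ parabolic gs := by
  change ((x * 1 : L) : L ⧸ parabolic gs) = _ ↔ _
  rw [mul_one, eq_comm, QuotientGroup.eq, inv_one, one_mul]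

theorem enumerate_parabolic_valid (depth : ℕ) {gs : List ℕ} (hgs : ∀ g ∈ gs, g < 9) (ks : List ℕ) :
    (enumerate depth relators gs ks).Valid ((1 : L) : L ⧸ parabolic gs) :=
  enumerate_valid relators_lt (evalWord_relators_smul (z_smul_quotient gs)) depth hgs
    (fun _ hg => (smul_base_eq_iff gs _).2 (twist_mem_parabolic hg)) ks

/-- Descent of a subgroup `K` from one parabolic subgroup to a smaller one, when a subgroup `S`
containing both meets no nontrivial double coset. -/
theorem mem_parabolic_of_checkTable {K S : Subgroup L} (hKS : K ≤ S) {depth N : ℕ} {gs sub : List ℕ}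
    {ks : List ℕ} {reps : List (List ℕ)}
    (h : checkTable (enumerate depth relators sub ks) gs N
      [(sub.map fun g => [g], [] :: reps)] = true)
    (hgs : ∀ g ∈ gs, g < 9) (hsub : ∀ g ∈ sub, g < 9) (hreps : ∀ r ∈ reps, ∀ g ∈ r, g < 9)
    (hS : parabolic sub ≤ S) (hne : ∀ r ∈ reps, evalWord twist r ∉ S) (hK : K ≤ parabolic gs) :
    K ≤ parabolic sub := by
  intro x hx
  obtain ⟨k, hk, r, hr, hkx⟩ := exists_rep_of_checkTable (z_smul_quotient sub)
    (enumerate_parabolic_valid depth hsub ks) h hgs (by simpa using ⟨hsub, hreps⟩)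
    (List.mem_singleton_self _) (hK hx)
  have hk' : k ∈ parabolic sub := by
    refine (Subgroup.closure_le _).2 ?_ hk
    rintro _ ⟨u, hu, rfl⟩
    obtain ⟨g, hg, rfl⟩ := List.mem_map.1 hu
    exact evalWord_mem_parabolic (by simpa using hg)
  have hmem : (evalWord twist r)⁻¹ * (k * x) ∈ parabolic sub := by
    rw [← smul_base_eq_iff, mul_smul, mul_smul, hkx, inv_smul_smul]
  rcases List.mem_cons.1 hr with rfl | hr
  · rw [evalWord_nil, inv_one, one_mul] at hmem
    exact (Subgroup.mul_mem_cancel_left _ hk').1 hmem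
  · refine absurd ?_ (hne r hr)
    have h1 : k * x ∈ S := mul_mem (hS hk') (hKS hx)
    have h2 := mul_mem h1 (inv_mem (hS hmem))
    rwa [mul_inv_rev, inv_inv, mul_inv_cancel_left] at h2

/-! ### The double cosets of the largest parabolic subgroup -/

/-- A double coset datum: a representative `r`, words `us` stabilising `r`, and for each
representative `p` of a suborbit, the image of its coset under the first generator in the form
`(p, r', y)`. -/
abbrev CosetDatum := List ℕ × List (List ℕ) × List (List ℕ × List ℕ × List ℕ)

/-- The suborbits occurring in a list of double coset data. -/
def suborbits (ds : List CosetDatum) : List (List (List ℕ) × List (List ℕ)) :=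
  ds.map fun δ => (δ.2.1, δ.2.2.map fun t => t.1.reverse)

/-- The coincidences of cosets asserted by a list of double coset data. -/
def coincidences (ds : List CosetDatum) : List (List ℕ × List ℕ) :=
  ds.flatMap fun δ => (δ.2.1.map fun s => (δ.1 ++ s, δ.1)) ++
    δ.2.2.map fun t => (δ.1 ++ t.1 ++ [0], t.2.1 ++ t.2.2)

/-- The letters and representatives occurring in double coset data are the expected ones. -/
def wellFormed (ds : List CosetDatum) : Bool :=
  (ds.map (·.1)).contains [0] && ds.all fun δ => δ.1.all (· < 9) &&
    δ.2.1.all (fun s => s.all fun x => [1, 2, 3, 4, 5, 6, 7, 8].contains x) &&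
    δ.2.2.all fun t => t.1.all (· < 9) && ([] :: ds.map (·.1)).contains t.2.1 &&
      t.2.2.all fun x => [1, 2, 3, 4, 5, 6, 7, 8].contains x

theorem parabolic_eq_top : parabolic [0, 1, 2, 3, 4, 5, 6, 7, 8] = ⊤ := by
  rw [eq_top_iff, ← PresentedGroup.closure_range_of, Subgroup.closure_le]
  have hz := z_mem_parabolic [0, 1, 2, 3, 4, 5, 6, 7, 8]
  have key : ∀ n ∈ [0, 1, 2, 3, 4, 5, 6, 7, 8], ∀ x : L, twist n = x ∨ twist n = x * z →
      x ∈ parabolic [0, 1, 2, 3, 4, 5, 6, 7, 8] := by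
    rintro n hn x (h | h)
    · exact h ▸ twist_mem_parabolic hn
    · exact (Subgroup.mul_mem_cancel_right _ hz).1 (h ▸ twist_mem_parabolic hn)
  rintro _ ⟨x, rfl⟩
  fin_cases x
  · exact key 0 (by decide) _ (Or.inl rfl)
  · exact key 1 (by decide) _ (Or.inl rfl)
  · exact key 2 (by decide) _ (Or.inr rfl)
  · exact key 3 (by decide) _ (Or.inr rfl)
  · exact key 4 (by decide) _ (Or.inr rfl)
  · exact key 5 (by decide) _ (Or.inl rfl)
  · exact key 6 (by decide) _ (Or.inr rfl)
  · exact key 7 (by decide) _ (Or.inr rfl)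
  · exact key 8 (by decide) _ (Or.inr rfl)
  · exact hz

theorem twist_zero_comm {x : L} (hx : x ∈ parabolic [2, 3, 4, 5, 6, 7, 8]) :
    twist 0 * x = x * twist 0 := by
  induction hx using Subgroup.closure_induction with
  | mem x hx =>
    rcases hx with rfl | ⟨g, hg, rfl⟩
    · exact (z_comm _).symm
    · have hlt : ∀ g ∈ [2, 3, 4, 5, 6, 7, 8], g < 9 ∧ adjBit 0 g = 0 := by decide
      exact isCoxeterFamily_twist.comm 0 g (by decide) (hlt g hg).1 (hlt g hg).2
  | one => simp
  | mul x y _ _ hx hy => rw [← mul_assoc, hx, mul_assoc, hy, mul_assoc]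
  | inv x _ hx => rw [eq_inv_mul_iff_mul_eq, ← mul_assoc, ← hx, mul_inv_cancel_right]

/-- The double coset data exhaust the double cosets of `parabolic [1, …, 8]`. -/
theorem exists_rep_of_cosetData {ds : List CosetDatum} (hw : wellFormed ds = true) {d₀ d₁ N : ℕ}
    {ks₀ ks₁ : List ℕ}
    (h₀ : checkPairs (enumerate d₀ relators [1, 2, 3, 4, 5, 6, 7, 8] ks₀) (coincidences ds) = true)
    (h₁ : checkTable (enumerate d₁ relators [2, 3, 4, 5, 6, 7, 8] ks₁) [1, 2, 3, 4, 5, 6, 7, 8] N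
      (suborbits ds) = true) (x : L) :
    ∃ y ∈ parabolic [1, 2, 3, 4, 5, 6, 7, 8], ∃ r ∈ [] :: ds.map (·.1),
      x • ((1 : L) : L ⧸ parabolic [1, 2, 3, 4, 5, 6, 7, 8]) = y • evalWord twist r •
        ((1 : L) : L ⧸ parabolic [1, 2, 3, 4, 5, 6, 7, 8]) := by
  have hlt : ∀ g ∈ [1, 2, 3, 4, 5, 6, 7, 8], g < 9 := by decide
  simp only [wellFormed, Bool.and_eq_true, List.all_eq_true, List.contains_iff_mem,
    decide_eq_true_eq] at hw
  obtain ⟨h0, hw⟩ := hw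
  have hpairs := smul_eq_of_checkPairs (enumerate_parabolic_valid d₀ hlt ks₀) h₀ (by
    intro p hp
    simp only [coincidences, List.mem_flatMap, List.mem_append, List.mem_map] at hp
    obtain ⟨δ, hδ, ⟨s, hs, rfl⟩ | ⟨t, ht, rfl⟩⟩ := hp
    · simp only [List.mem_append]
      exact ⟨fun g hg => hg.elim ((hw δ hδ).1.1 g) fun h => hlt _ ((hw δ hδ).1.2 s hs g h),
        (hw δ hδ).1.1⟩
    · simp only [List.mem_append, List.mem_singleton]
      obtain ⟨⟨ht1, ht2⟩, ht3⟩ := (hw δ hδ).2 t ht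
      refine ⟨fun g hg => ?_, fun g hg => ?_⟩
      · rcases hg with (hg | hg) | rfl
        exacts [(hw δ hδ).1.1 g hg, ht1 g hg, by decide]
      · rcases hg with hg | hg
        · rcases List.mem_cons.1 ht2 with ht2 | ht2
          · simp [ht2] at hg
          · obtain ⟨δ', hδ', h'⟩ := List.mem_map.1 ht2
            exact (hw δ' hδ').1.1 g (h' ▸ hg)
        · exact hlt _ (ht3 g hg))
  set o := ((1 : L) : L ⧸ parabolic [1, 2, 3, 4, 5, 6, 7, 8]) with ho
  let Y : Set (L ⧸ parabolic [1, 2, 3, 4, 5, 6, 7, 8]) :=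
    {q | ∃ y ∈ parabolic [1, 2, 3, 4, 5, 6, 7, 8], ∃ r ∈ [] :: ds.map (·.1),
      q = y • evalWord twist r • o}
  suffices hY : x • o ∈ Y from hY
  have hx : x ∈ parabolic [0, 1, 2, 3, 4, 5, 6, 7, 8] := parabolic_eq_top ▸ Subgroup.mem_top x
  refine smul_mem_of_mem_parabolic (fun q hq => by rwa [z_smul_quotient]) ?_ hx o
    ⟨1, one_mem _, [], by simp, by simp⟩
  rintro g hg _ ⟨y, hy, r, hr, rfl⟩
  rcases List.mem_cons.1 hg with rfl | hg
  swap
  · exact ⟨twist g * y, mul_mem (twist_mem_parabolic hg) hy, r, hr, (mul_smul _ _ _).symm⟩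
  rcases List.mem_cons.1 hr with rfl | hr
  · refine ⟨1, one_mem _, [0], List.mem_cons_of_mem _ h0, ?_⟩
    rw [evalWord_nil, one_smul, one_smul, evalWord_cons, evalWord_nil, one_mul,
      (smul_base_eq_iff _ _).2 hy]
  obtain ⟨δ, hδ, rfl⟩ := List.mem_map.1 hr
  obtain ⟨k, hk, r', hr', hkr⟩ := exists_rep_of_checkTable (z_smul_quotient _)
    (enumerate_parabolic_valid d₁ (by decide) ks₁) h₁ hlt (by
      intro p hp
      obtain ⟨δ, hδ, rfl⟩ := List.mem_map.1 hp
      refine ⟨fun u hu g hg => hlt g ((hw δ hδ).1.2 u hu g hg), fun r hr g hg => ?_⟩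
      obtain ⟨t, ht, rfl⟩ := List.mem_map.1 hr
      exact ((hw δ hδ).2 t ht).1.1 g (List.mem_reverse.1 hg))
    (List.mem_map.2 ⟨δ, hδ, rfl⟩) (inv_mem hy)
  obtain ⟨t, ht, rfl⟩ := List.mem_map.1 hr'
  have hκ : evalWord twist t.1 * (k * y⁻¹) ∈ parabolic [2, 3, 4, 5, 6, 7, 8] := by
    rw [← smul_base_eq_iff, mul_smul, mul_smul, hkr, evalWord_reverse _ twist_sq, smul_inv_smul]
  have hfix : k • evalWord twist δ.1 • o = evalWord twist δ.1 • o := by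
    suffices hle : Subgroup.closure {y | ∃ u ∈ δ.2.1, y = evalWord twist u} ≤
        MulAction.stabilizer L (evalWord twist δ.1 • o) from hle hk
    rw [Subgroup.closure_le]
    rintro _ ⟨u, hu, rfl⟩
    have := hpairs (δ.1 ++ u, δ.1) (List.mem_flatMap.2 ⟨δ, hδ, List.mem_append_left _
      (List.mem_map.2 ⟨u, hu, rfl⟩)⟩)
    rwa [evalWord_append, mul_smul] at this
  have himg := hpairs (δ.1 ++ t.1 ++ [0], t.2.1 ++ t.2.2) (List.mem_flatMap.2 ⟨δ, hδ,
    List.mem_append_right _ (List.mem_map.2 ⟨t, ht, rfl⟩)⟩)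
  set κ := evalWord twist t.1 * (k * y⁻¹) with hκdef
  have hyk : y = κ⁻¹ * (evalWord twist t.1 * k) := by
    rw [hκdef]; group
  have hsub : parabolic [2, 3, 4, 5, 6, 7, 8] ≤ parabolic [1, 2, 3, 4, 5, 6, 7, 8] := by
    refine Subgroup.closure_mono (Set.insert_subset_insert ?_)
    rintro _ ⟨g, hg, rfl⟩
    exact ⟨g, List.mem_cons_of_mem _ hg, rfl⟩
  obtain ⟨⟨-, ht2⟩, ht3⟩ := (hw δ hδ).2 t ht
  refine ⟨κ⁻¹ * evalWord twist t.2.2, mul_mem (inv_mem (hsub hκ)) (evalWord_mem_parabolic ht3),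
    t.2.1, ht2, ?_⟩
  simp only [evalWord_append, evalWord_cons, evalWord_nil, one_mul, mul_smul] at himg
  rw [mul_smul, ← himg, ← mul_smul κ⁻¹, ← twist_zero_comm (inv_mem hκ), mul_smul, hyk, mul_smul,
    mul_smul, hfix]

theorem mem_parabolic_of_cosetData {K S : Subgroup L} (hKS : K ≤ S) {ds : List CosetDatum}
    (hw : wellFormed ds = true) {d₀ d₁ N : ℕ} {ks₀ ks₁ : List ℕ}
    (h₀ : checkPairs (enumerate d₀ relators [1, 2, 3, 4, 5, 6, 7, 8] ks₀) (coincidences ds) = true)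
    (h₁ : checkTable (enumerate d₁ relators [2, 3, 4, 5, 6, 7, 8] ks₁) [1, 2, 3, 4, 5, 6, 7, 8] N
      (suborbits ds) = true)
    (hS : parabolic [1, 2, 3, 4, 5, 6, 7, 8] ≤ S)
    (hne : ∀ r ∈ ds.map (·.1), evalWord twist r ∉ S) : K ≤ parabolic [1, 2, 3, 4, 5, 6, 7, 8] := by
  intro x hx
  obtain ⟨y, hy, r, hr, hxy⟩ := exists_rep_of_cosetData hw h₀ h₁ x
  have hmem : (y * evalWord twist r)⁻¹ * x ∈ parabolic [1, 2, 3, 4, 5, 6, 7, 8] := by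
    rw [← smul_base_eq_iff, mul_smul, hxy, mul_inv_rev, mul_smul, inv_smul_smul, inv_smul_smul]
  rcases List.mem_cons.1 hr with rfl | hr
  · rw [evalWord_nil, mul_one] at hmem
    exact (Subgroup.mul_mem_cancel_left _ (inv_mem hy)).1 hmem
  · refine absurd ?_ (hne r hr)
    have h2 := mul_mem (hKS hx) (inv_mem (hS hmem))
    rw [mul_inv_rev, inv_inv, mul_inv_cancel_left] at h2
    exact (Subgroup.mul_mem_cancel_left _ (hS hy)).1 h2

/-! ### The coset enumerations -/

/-- The double cosets of `parabolic [1, …, 8]`. -/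
def cosetData : List CosetDatum :=
  [([0], [[2], [3], [4], [5], [6], [7], [8]], [([], [], []), ([1], [0], [1]), ([1, 2, 3, 4, 7, 3,
  2, 1], [0], [1, 2, 3, 4, 5, 7, 3, 2, 1, 4, 3, 2, 7, 3, 4, 5]), ([1, 2, 3, 4, 5, 7, 3, 4, 8, 7,
  3, 2, 1], [0, 1, 2, 3, 4, 5, 7, 3, 4, 8, 7, 3, 2, 1, 0], [])]), ([0, 1, 2, 3, 4, 5, 7, 3, 4, 8,
  7, 3, 2, 1, 0], [[1], [2], [4], [5], [7], [8], [3, 2, 4, 7, 3, 8, 7, 4, 3, 7, 5, 4, 2, 3], [3,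
  2, 1, 7, 3, 8, 7, 2, 3], [4, 2, 3, 2, 4, 5, 7, 3, 4, 7, 8, 3, 7, 4, 2, 3, 3, 2, 7, 8, 3, 7, 1,
  2, 3], [1, 8, 3, 2, 4, 5, 7, 3, 4, 7, 8, 3, 7, 4, 2, 3], [8, 7, 3, 2, 4, 5, 7, 3, 4, 7, 8, 3, 7,
  4, 2, 3, 1], [1, 3, 2, 1, 7, 3, 8, 7, 2, 3, 4, 3, 2, 1, 7, 3, 8, 7, 2, 3]], [([], [0], [1, 2, 3,
  4, 5, 7, 3, 4, 8, 7, 3, 2, 1]), ([3, 4, 7, 3, 2, 1], [0, 1, 2, 3, 4, 5, 7, 3, 4, 8, 7, 3, 2, 1,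
  0], [3, 4, 7, 3, 2, 1]), ([6, 5, 4, 3, 2, 1], [0, 1, 2, 3, 4, 5, 7, 3, 4, 8, 7, 3, 2, 1, 0], [6,
  5, 4, 3, 2, 1]), ([3, 4, 5, 6, 5, 4, 7, 3, 2, 1, 4, 5, 8, 7], [0, 1, 2, 3, 4, 5, 7, 3, 4, 8, 7,
  3, 2, 1, 0], [3, 6, 5, 4, 7, 3, 2, 1, 8]), ([3, 4, 5, 6, 5, 4, 7, 3, 4, 5, 8, 7, 3, 2, 1, 4],
  [0], [1, 2, 3, 4, 5, 6, 7, 3, 2, 1, 4, 3, 2, 5, 4, 8, 7, 3, 2, 1])])]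

/-- Coset enumeration of `parabolic [2, …, 8]` in `parabolic [1, …, 8]`. -/
def stepsSuborbits : List ℕ := [
  nat_lit 30061693466123013251981678721388999206372399965083940018109578627485506079067022360775820630956268782154515041452808629675,
  nat_lit 30040488797023999600974656757322792853159105766615073126595623823463838902945447747398580257692591232299455238381804042581,
  nat_lit 133462479910756764249041405147605119459912892294984152823168388567447829583854170178758268051980828001742277085284742073,
  nat_lit 1634618349845892674452962696890363367802750880188990664011197848762811034687989590105706842382357375816460287685916080826,
  nat_lit 29093349761825267237357927022093172879054680028942287512573199755425105896957486274939069015561206559941415135390370804354,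
  nat_lit 29158302759385230987148536753823521030604168988652741227673483399486003882494920582961848484596406172295791604021040655268,
  nat_lit 992798980481897600795325071198008380009111311412251345047406548270198765464380539878251904560078290828770532786178517828,
  nat_lit 1685053205362500213457425704579927837331338609425214237253411225840145887238891538385000174770371792381377316470296027826,
  nat_lit 29006603560704446393550460845856411089121450154906815130966765679947902862720656115694855270210511373331362613455496252551,
  nat_lit 1807595697890993302958867228882268505076322094777917674047350693656568843614561556514068425451737590288262192851451609914,
  nat_lit 924700472597408170375298518454671842163343949456098930352306684919132612175154397301958979498358172021333172036113708373,
  nat_lit 30121873883022858552322058606925787873597128477467868093532114534872270257443059718983586747766030696229635615820545943236,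
  nat_lit 29163894128277494012873992251560785869779297414250658101104429192948388435361439527525795933671234331033547986432518798003,
  nat_lit 693268782296899866359524406773038100609581659408545678159127774874108066934391411566274071769377997360321184496284805670,
  nat_lit 516782066436734596641120892262006949385711697905702849378748037057998492965158013975463989679269681157635415868769159748,
  nat_lit 1646517987790200654694057774077405548237352876525903262714244960206698255852651872807539810133047514110440469446314832083,
  nat_lit 1867593009918157676299978792049508294128593137534223219162439015674896437902029260125710039768215727555005910691686822842,
  nat_lit 30131941552221952515665863607685327730849971598334268124118809531093970393153020090132940148326621251578157831241381342370,
  nat_lit 1731238785050735010089579991072292876465465594400145036218793716647319610429126105623471689397185882452523594362607317946,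
  nat_lit 1731199272793740278922593799876806771715082190674366110935982003106676930703918593263835788249525998421057957781922661444,
  nat_lit 440490530939780917215260943367054711794760232644682710670067186116726074344703097160907643044051312604697471115499801907,
  nat_lit 1818625101066835189308400338747232951368588152500158718317129925284275065294585057611366075932776797781911034338205989674,
  nat_lit 29800790165807097314827459885004877786647355114425999912416064493924263693051044750329228834038698450790432908221542607689,
  nat_lit 1838781385052244176491208673342583906229220401859894865891855795652229698205544294804871376368452481048917910559076794578,
  nat_lit 35215432347559616678434376774977518030386941285335190361882310475372020613576141046647185784650233781968883833282489379510,
  nat_lit 31758050148208641165647931815798093036261293606254777944616484902296779039023510483205334468559709058479162019676885125288,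
  nat_lit 1876684729777821951371915790275868470163753583644413736112991408839443615653500775763277672470537636502105850159584594506,
  nat_lit 29720093924125460801459802374171772742184417625134961308828547863660398875616908989255747621964876350657875804153927543688,
  nat_lit 597443503375512162089281350098829704062249355446044208646422693064738640801787475505958829569001600508568343182375893682,
  nat_lit 29324340589543466928861880164781812725867229147949654939224220797528355152378677408505941443872064465009593631886456214963,
  nat_lit 1812320481258642770815498418120279837562864301025283767028407446384404901498886178402650752556570996583074995888782025651,
  nat_lit 2130373365009313560971747523128826576987526745643166782830579549568189167203627956532826807451846710530548811370727159475,
  nat_lit 1822766827837357298542345052058178149478812304359091302186362236183051246875631488949047077727144980926751253548550671045,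
  nat_lit 2125014598110884727049135594154251357163225897974989331953033979913923101994762155512737325443080223491883993542716409002,
  nat_lit 1242376369118869225977142509264131437678220152261318697596246503994491084206423919204427216905350819413842980186910067498,
  nat_lit 1958578055224448356447593394104216869331476274346369034067113947680483561898418484835988287548661190094626862986030776999,
  nat_lit 29230406206808838672289949289810580499046618693496614683559114966006451705255446737927877620560499398543237795132422173619,
  nat_lit 29265769259945340427872675253954989656233844287058538130141893417365373770158368336078617856535355468906901796132270357178,
  nat_lit 1734949159197072602714043509953267385618657008124844253596752918419034808869548299718028295490779052137413672352944996906,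
  nat_lit 1860027615869172261615290941062344124155375818178398221772941753457628701023200707587536325149589284958045970818219133764,
  nat_lit 1338752832336746860611676318157864318813509837980939456265741199765227124260014408357936067149441582706454716212374587062,
  nat_lit 30132990638784038154287633843610482779193571736012105877413877398507832635308096973363899771863080473310685417638921820852,
  nat_lit 30146452090662729095224845035160828157270496824819207606537820648058030694794035846161675002883083527126520600098566712405,
  nat_lit 1876699455016792712570253551985852025609373733873820417626570881760262652439520532968101161309993718908246524154951125834,
  nat_lit 516469767708634091084260725894049477912199872144862127490136207015425095643348730029714113124595463847004781017344289700,
  nat_lit 1883506295036440469304831498132181221087326375023271754036711384082482332101494859995361018253684585590021421338636486858,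
  nat_lit 1829111723500367653759129795032296883410724669341256338073343362658907100132877520434367074492291865181505639287491966132,
  nat_lit 32718350439231718960855438368117301202175133345909833600436445015618781184431906748321317450075876907763213582892936158088,
  nat_lit 28926262485301279513659614643675984429153301974893154516204865110005778309341766408615352251270057388224099798670105065139,
  nat_lit 1722111083065807875500972376546358267635581568161166338137209304999990593015198619107045382431112842513210793404445996469,
  nat_lit 30132990638784038154455806085229469839196934835452487065828889216295890892707723075981465679941423207475464962252573192404,
  nat_lit 1480678859224427888944875747586473415708173647724179013874761237227347868206414993445416400211762687511090501999396355157,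
  nat_lit 1884153112227637851531339456609326155450503995408221470807250357979238173610849324777786744619768101705150175917152938898,
  nat_lit 331219975687613568568036526792961689861970495487439990655178128800717218609891557649966057994837988028423462659638838458,
  nat_lit 29001592319346891582604142797427890379104888246107338431592708225803180452804405351979413914325615342373769349473799138150,
  nat_lit 30131036071777842708968953442437390537881806236384726886388555903937939584217368058809180133540588874253763196307512113971,
  nat_lit 31847980891228310231703036784845293907585279528053191689363372793482049048870526881088791490263032572661061520605672225173,
  nat_lit 512886885307699299842553763673810791753322710664505447915026360778771016318917215660947425583440979936721988714157684149,
  nat_lit 31586982069306692496455444601597619096002718229826378244137350957667501147164732232886218166573303129731942149110579311418,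
  nat_lit 597466681811430663388981198936567748527209127477473630511644420929250558254947152289082325805618582282865467627231986867,
  nat_lit 29811993356055574600576982242521424189108192907985952707823249812644639175348274011415273844051237875450212895798370940339,
  nat_lit 703812852999637019420089928704676112897981109301689207339636265007475725182919949900525799469084158016386906898035847386,
  nat_lit 32724242107351406406590604933933585709816337866111052912026997574777277029392622866640470315088279567566745635005064837060,
  nat_lit 28926537694495741523669170011940215984000128941560005876150687466081822679741672942001935249951305068367738206276887030565,
  nat_lit 753791576923502591811748186862274950075737409056706317690427957451243187381310973486068002966649801702657270306491843507,
  nat_lit 29904947364193513114481378284112182823264785277219432441700756282395013073922340055834226526408481225146700246467254799026,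
  nat_lit 1086049143544397770305374804864127181108957085839764594060959703572056806560338508145235775519359393836566124434440833737,
  nat_lit 502580550302508173073796010901280634797340342886603573299310514250596266525062354939412777999226871485503700384852062873,
  nat_lit 2014399778504222385424496619799802941911532343636870716800549096771668139851560652397010716543269717439719230849989391155,
  nat_lit 387527847181208501188059037964867256464618388137427663113995742379709089357297284661953645671596356168556547055226702517,
  nat_lit 30135109215675709095938347582276675959716684028245002711363546270957482234477441319943026696480721245509971651485922146994,
  nat_lit 1968965530615859037897011838729098625809393153871777573353856217837489304323561839023491531217036338565903008599164689300,
  nat_lit 28917712650317506068112078098953122577483102979510135411999747532292705666169974256216996651997444718929920154745680117972,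
  nat_lit 1818238774786960842589188154492274684305343389801823394155540660292995560900835235878728287768075874121883418023982912435,
  nat_lit 29098393184177300753250826774085394691913070775608943273322342703305810144337331965059180457499815189627493091444222739620,
  nat_lit 582035769943413343487421148565039596185202266312295363463539575099235416620776846992730937576957066694528527933462197172,
  nat_lit 1990102322960124167769378619476303727004095173865907644083290485061641564355161365462210717262543966190348993442065011507,
  nat_lit 32395595114480331340020668808447184023114496186459488463607489238609682590662091695620715682764206569643935896498061682106,
  nat_lit 1868003893832191896670487173900740872453723717592234813400857316585004873624619008438192744765799330438257555742845864114,
  nat_lit 7287880111216032118536827972719584017798127542904434005464614026818552745082242466868172376725419199188234898125418220707,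
  nat_lit 759445856239323878424777272370804454458021525583359990750134154090987007632628834370390735792955763035045266107311797050,
  nat_lit 398245260494817903851527097544020375393888391007783628988489897681858670067189008505902916144891694715821866523344685748,
  nat_lit 1879543059238427125837827716505639380766053782907436396782289739267795028155862940074021727599314002650772129085248056354,
  nat_lit 1727196058121489577064446442675125791762022066041550346040767361536205552719544438197989899150949602954320852155523378053,
  nat_lit 1873225039893452430701599121638478410845224352584185139620269303334550842582243075039704057387037362255861145104213059779,
  nat_lit 28825632632901645467627684900300402404582818282529236564812927318953853101506727402211127394235608370704017532023202808023,
  nat_lit 600874776825378608953491804636313765323940968782622773652154428850451646218815808070619876590824184083652479674308277194,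
  nat_lit 1799122006037783380161162465527264585657386202324538448659395241371915437577715757531893453371117237609639527914773766362,
  nat_lit 1838839178866829534700298894036764503331528025533894801658564178066862685120247162632726539235009872296022399372295723561,
  nat_lit 597283280625791877619245281315464156548642545212762062217992842324905680522195478551372904189263127030538356230182298290,
  nat_lit 1882596340678439601462917331305731149632691522618011065915578243976552322307289813938054384188023696977222396485442188234,
  nat_lit 2040463257438817184800312476813262741695643039067928971399197767900124144019294156509362067240858302692891975358455462323,
  nat_lit 4788267519758615535883170824376600027351321757035063237978073940232705691137161080852794603502750456498123480266810361992,
  nat_lit 1731611704843801642492399937046038844299113455443085496253182947085719219677537099197521972795453678843166532984065723270,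
  nat_lit 1884025314041441339997060684597440876087826842273007915405175400774603668566716731364060292861580855539927539819836296266,
  nat_lit 1812913809255858461425999001305532081010879287153242725603651673496022445249029403107587656504157835936658604288491886182,
  nat_lit 2041760663247600427071792006960638018616499553255095777009692905542311371300070776498125704170905694335384116203669341114,
  nat_lit 502600174348567618544348932629526328568701484891437782187051893074779270281881172494112926505329624854647571419370273221,
  nat_lit 1829109265719668164926675596274703510652890331661041125327960933996168164501763282220080167211511169743746402955594345530,
  nat_lit 1407453712184722815701497280627644939745145153903868735508878731338802822964950272523607840508552560241320653301670980442,
  nat_lit 1807907310826371397287394928131059902297200449930273646290298682317859265197567245986825763349014961785642467087293397688,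
  nat_lit 1813222779128254464514914184364103700931391198441194895629128262448202543955946893449229378654505708079646250502961411267,
  nat_lit 760751083246734001004598665945304578489573724312384007737707410846893639888857526108917937144602984519011636717239872356,
  nat_lit 566652984093409924716204225768423587846346395559761563669779109999037368175977157411763480608004353894245424864549976500,
  nat_lit 1393161914386954224854811820801714925910955277221757455451374100746404035021271364484748095157236686425235526279796337459,
  nat_lit 1823632082023774670206829308419595144285780899938841486087112002795886077390534333383835427767262988063906717717215525683,
  nat_lit 2030847538033783874879005178223032632913223306917729399110790789340490236064170970794730300348333061172201579211285959828,
  nat_lit 2045465581640065557693273349864362611553420177693087220207539497004007439245081862472865442189236594594043270594228091993,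
  nat_lit 1958562234503449415470440240366074211974654426720320904913480051747601761930268610734652270113364210940369276936298710202,
  nat_lit 137655273957577842473409941950890204412879094648007520393169711124467446359407425314572959974703856105724158862339386276,
  nat_lit 865141647073715753418277489411248507005476953606479540279698956545313404228776055152294154900366549889358482755134761000,
  nat_lit 29592631036044597247664885442707004705179583657237613926256589104487221691357307025063425270079746733127636893938148005301,
  nat_lit 1862369410848025821112656546887349282715373289483910945631980064830390198196832875110801390893125153756149377978559935940,
  nat_lit 4783471436573647721275822498327960096664456483268893951058190371015711437587376223167568815969903163670342903873954800083,
  nat_lit 1033146946498202479137652054085249551167437177476424634016279417198904049450960850128246101405390488887750435826689717130,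
  nat_lit 1883250002745839255577757324199247191448881619472553840714345853725049173534124650762231048323279823188923161243494804150,
  nat_lit 30136100724601409890883909471424374759302939948340334433435203788435427531432542795170524011062211623396003010011087422408,
  nat_lit 733292784292982399674124512208916429235231219564965331382821193125523844180057414901943770840809225787523100324901663298,
  nat_lit 510722140494193286372138262173852161282379850237731826420662222951896030681124404485921141982763749734284106159396010674,
  nat_lit 763281614433583431128874973604978097062040853282569101250614463174796261187245982967112102355572948631918778477602753315,
  nat_lit 34332257499129932008623231999471046183686719516872054182910657830010075606640742715739021483912962220977118466999705603396,
  nat_lit 28936391725243743029389518314174013186140856634926939158259650131902556279765994907305747804133990111171851169744031405498,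
  nat_lit 1971886305548726794367915259873233944149176574177471858132602489518082790962885573936591005290737915902381585332858064292,
  nat_lit 1879221345958329147899037470294820543272534561972857603423221553345906929902742129797544799654770821669353951235366683850,
  nat_lit 923446268060409302515164560952762600256523287856536143642421445655220332251731779896430196633315514266782764433294809770,
  nat_lit 29704212621312754521182006031249516057696848728001192385735646970643581002530354006639591346818056766719739386217957231957,
  nat_lit 934685525136419105101954139179791871908045186503383146573864337956705186028325833667046558017247895163453693748667669192,
  nat_lit 932791766628301097303537177555366851176168635206583872626661811089183272158732282325648479564869318940091453484597349285,
  nat_lit 1823553249122629037250131449775710887225676966079621558374696064364198471811332208694704098385416777333970591822619626392,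
  nat_lit 28775237187707272595982574607273210721928152881595428168983836032001665260518411941989767114844452045429408714723091629114,
  nat_lit 1818611097641890460984127251612958292860817435926897447915527434184146795718802901001014632233365669853700992913209338772,
  nat_lit 29002623122127662515882804754291945116369967249389216499221783367190622240939879771547592178956968184413228060231994094885,
  nat_lit 30066162692105817932249212019649108420261812341876867488410806704205488025913655055969687211891739710663365374084896730019,
  nat_lit 425613740000179291666832360208265370209946649327934541423635595021118929708016506894805357122891598535939257666880422980,
  nat_lit 29158520653026404006774855932025221696018552098431469985579718076127453091153958737794549419358077192203362633062666318771,
  nat_lit 2040523332623935931178041679873436291115720816880239651036793070706751528722330425977842974016280782143948539887706377540,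
  nat_lit 29058634063448463137570604455137120820303222456902080768459882121022427384177659688858355185363976417296211385418242673508,
  nat_lit 2205434768458262008070593229774431310648818441144567738372773010592189097347518407155318846473439205599514445066732940084,
  nat_lit 9872214100663423013321748358076483963394131634805691227458891182547811929973429720657881145718563479351413618231130434358,
  nat_lit 29582817663370817238344192358840045649431892435922938564223374669518157066091044772496786856046621099004941999267508310710,
  nat_lit 299281125043535966931109277813399064981509114728259218218034593710747859980415254865250238123564575020866802035844686039,
  nat_lit 32715358579765430430475238944571247751209017317345374978790372658894084874152863766232815133824546684474568504701149723446,
  nat_lit 1727878251874482183083089415383035796605492738614523177691158566979919914583321595875722410881439315320901271370400942532,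
  nat_lit 1731239299693449462974971700637315499007567833927160780964914866725250337134317233225400072683682034570363133989688558659,
  nat_lit 29239861055925195845867536384920041404438115714380572621680572234227039714016657993495163097729470406183367916212162974788,
  nat_lit 1257538683811566107782831369783595099206157238278849644821242081007487713118630507387173287482448701859172908580167006920,
  nat_lit 1883506289625297109388148394748491541917160321704564647884000715096805598332448505773045930594871448854883716758307113122,
  nat_lit 1853655787235407601780227656142381049213034949675347692612500124861181502222588612992383037455597763360553336507759572034,
  nat_lit 29500879761880278752969108243892981240113186570252729172480107583697562463480127029474669124437491555294813375772436448163,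
  nat_lit 28915880759164603121362811411668996241926223057644509819110271641515865870511772097215753305589137768932291480829608310986,
  nat_lit 1843175117390878081878083587377220919138319709550138752522462853553032583161183018718468864907195296422732816667634914739,
  nat_lit 1806714289847124554528282460730294825195664809894679995282870841165679404515352545730771052560988991066500435841200204708,
  nat_lit 29058911353307914283324369830575964401431707357071863911984887313776006198510301080389048719529446437323915968225128260403,
  nat_lit 1567703123952443052011883737921934912300223364870905715157535434413502206949556614187464215212121386867874945780111223604,
  nat_lit 34328457913108784446590507001940152428021497511099564095242912846538724060361846362621276790004532303730559395336518522314,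
  nat_lit 4787327446162431547300465244901799824600672441377541695267504869825075546443427969735000816372778198849131052055267026355,
  nat_lit 35191485936037116603556430524304639117656023668285170180755591780823982122880115243833889305644773485641173782965477969290,
  nat_lit 35296499667422740050901514569063914024932219091301371356441160148568485108265744138988892909760769901302043610157321722678,
  nat_lit 34987793701526633790038470509216537268155213204009976122262898047773392602516835275920428960647597264260076647476307901334,
  nat_lit 770812543513007406041632494102636247785929772351550008345448963496952620894011360052596009047182695330668047310489168809,
  nat_lit 994677276805913399749701637523802945406398723552084257224343573643674414059527139640850183193367382960879679752225569460,
  nat_lit 2043687734154523662381843330095842361791219966725362159986958942004588799501959693169235796548932670409648318561118116534,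
  nat_lit 1638360463373848943185391356831607741137041988688998264539629588334613979369405692541462669886412877727563404990033277477,
  nat_lit 2125528206225183911582603524913969185454359994729192088758212247245981460742601026661134593595978525074394474293560390328,
  nat_lit 2000175673524125451371531879263446356586739434060624520179911103060059053401163683983616840777713421072723817341609814948,
  nat_lit 29648404749885772879504334759563365565398274629355708050234282783841098916027620550314326884086092178297254536414674401365,
  nat_lit 1838820777703091467847330623563601375181711680215594420472845052669926153030480255976802348328100731440460846838790210234,
  nat_lit 914968176785073624995650907382109708479289696576093729773930483131194008698726678501387013029471289093740966841222458034,
  nat_lit 29001839606757597810748025093718484481039676189772054284071044511787607368334163894017514366845558166935052598103495609685,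
  nat_lit 29292934404214527468334933690707341381999709678595384910914512611945989592904201392500474666092847732546204178074601036963,
  nat_lit 30066202082239268813012386969318269785178231683845317595862467814666084832161450629075574981242268578703845732314124147589,
  nat_lit 1879140234798340061841451586663335112374417226246173466748649137532336888888522602055121704909136650878447737009531079748,
  nat_lit 4788359381056246419740885131231516639393809877840369169371151132366809964719426114292101916140760781887697515806492767418,
  nat_lit 2044352667020472347343066281282630374603106492387634661069541965806765047101611474114202562243966179433274889860309889738,
  nat_lit 299010924567838335408756183802130418676163153754020936562623299859027180037259769034336022305071342625158530232844073142,
  nat_lit 137790872267681779254382213649068329680107271692909312665662298126467679515660102835192099916672178876100991489065831299,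
  nat_lit 605530084584533871979793498716316222544097854233138283812010320769695915513605881893202306942471440713791524685751285687,
  nat_lit 35298970285972667402171618920001408046079988758072536579639492225443520720298878291731344663142989444562752183213543404474,
  nat_lit 511703045452611091540357560135035645833806570619928885876123248568383572058814489279554423787621140114300084158084123813,
  nat_lit 1622289669474179749492566560352877325499546286667431546645082945299370278430123498891382421951356601866778213934990860498,
  nat_lit 29798268437523230590173866741255646431283010940952335746142285721786163682874739895686665780159664850061843050179689394386,
  nat_lit 1883328801433801021117988921306147747290743718521148009711084469792775306939606292427987447681100728813277575400868430034,
  nat_lit 32232287126787220331514315034175470518619287207125064246460860285681063219142239178840341938381168476270008004482200505635,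
  nat_lit 29001911266298836307079126732747429826993137111851275435098049378453165903924436654457452474090624866977220993662632217415,
  nat_lit 857907674439222749678087842595232103936859441324642792740113096101992240974765511737152651510957316984675997343943011412,
  nat_lit 28991588010837444607383737110997397787581110559157959273455041255731484346154976932566045421752533371431390428312466447029,
  nat_lit 405080050886739773909135071179432189037199048448186691712158701226873265009207209266335389073197420560295387449599024179,
  nat_lit 1812716953446302977035235960776816017918459397257737068956402959725865243755421384559878603817292603366692869221165804418,
  nat_lit 12508924770785614569097508424005177733589203737739880035014681642647484573539068124647296750807963981376618316348274363059,
  nat_lit 30133646551486054923609291197357791638114622221204457442841963385340650288768525412819762435195600900033793809510912670387,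
  nat_lit 29658081262324366584913282425888015227672677278960643499218808921802746555833041852799491091551205392212981098817788814518,
  nat_lit 1990698024455878634310588161630942396097259154448194076793069382837492250525403937005322969679781151497918936971761495370,
  nat_lit 992787057916345370825957152864353217092664497905179829791590978334897111603057812870060202769950883921012863771028735926,
  nat_lit 1838826934965388106061435130068105742170093133159842322395646668918120173863739657895392327355295510554391611471523011250,
  nat_lit 1244287461936740748628938032560847837710122782361940297108300823488533068395331048403148549271826633784064226051732454067,
  nat_lit 1843174658029025293841874690140003802698089582509610784167175296639533423660549650750368554812846391272984010039799524026,
  nat_lit 30132962089190325406939769110969373166404772992780039927178109002402402562548209602921551269076965452619063270923929135988,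
  nat_lit 32463298482554931266326170556718835070574521779134350828026369856031076664379869304180976531738414920849209679870053497285,
  nat_lit 29488016199803322981065559398635590087765431036419403522791557948908758660999138884774697169297464971859946945156302920873,
  nat_lit 825378865924261943355913035877296799523304317256748212483267511938955533000295737824155716524984699089485333273128645738,
  nat_lit 929994895932079590519815528383690200321526500046414062413389119765148961989154998077441548543710846515284336677486439253,
  nat_lit 29097721007260584414006265130747279749367028806314270278794542139974576061436524987674891993541312560540329950229910694741,
  nat_lit 563389353583554158988705012981138233442890703606255000045421739632823380414578312639928318864535239235572370471596073262815947556,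
  nat_lit 748136366026740660117681616917452393655384200985871289255013843042804163392294045943015766755776459984205086005495808947,
  nat_lit 29082611584040978355987816310701619355187958867041623723618261306129962071561940631132487219115334257961814778934735878978,
  nat_lit 1418580994509988222945872323237340404785257675066272487100933378649686093061340565474706728753955205009211513298921768627,
  nat_lit 7350603948746122909831450448371528891582671972435198708537362454320201051693628047373690721874402456686767013988289132584,
  nat_lit 438605209582005960590538873520308928946134748200936296561649918746170807886178215895696522792870157777126334125009323210,
  nat_lit 1852920767813504499851651245151617043109290879453489833496224366380253457147063728640431954521148768718074829319323822967,
  nat_lit 29269929708660170720985130646005214099102682938235051624731856370404655839163094372590583309352005432579340197357302236067,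
  nat_lit 1832786422734636224424048633973090916421043782735431294709134244460016067548578773851618586792081581185272033321146540762,
  nat_lit 31588873318138015430984121663613040649821556801582911145267975330053959067426095489331849565170872195437582537137156379594,
  nat_lit 34168347095278248770753876029759796975321925840490962835953370878612056436270853401679728207371358678961823188235336772452,
  nat_lit 29420520630263179989993345525215375215458503828095102898715164880361770860407091877651415319096107883192604810668559127991,
  nat_lit 1200881285244163196298619336892747004736411139846585030765666557347057000682234928348912333700691757619895532088227969718,
  nat_lit 1728896130935138552889030239459855568891881072750942117581654605340028374684220563050719412641878419389283000199656490791,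
  nat_lit 29904946146935315885521457827963511123169339452872363468342365182230632897363024689467683106168289856853847936117376828614,
  nat_lit 28897264456016292942190632298806735589578975396937314425559496712954688353809282403088853101749081641766932635859889726644,
  nat_lit 8331553997749110629776587152625332812584347043683506375236137672379173789047792738705132386189709298557670273450522751002622476837,
  nat_lit 29334744776583559536058808745808585199225805654081816036323511789555277550873777381730368928112652684396913679570077901268,
  nat_lit 1798849837947828150574628450881935840337614200489907912289806134305874719465996536346279232080724487134348540535470051542,
  nat_lit 29001584502079646895080105951171537462007655473701783893140611386326573253703423372649448093407453749637104959113561097523,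
  nat_lit 29178142825630431327001418940555813364536027391340082427366041460856642347667067989230958259437432282444071964596169323303,
  nat_lit 299009926921493207419465047801217499481316625497489918560106866228109539187929006792155234426339128185927919874472686548,
  nat_lit 30133209659724736118164585437121682346493167218144321567913072955587144378544228484597158711928329157391295244490745436362,
  nat_lit 29097781350687921354006243064301887842132218993953780714916999090024073250688975358907355764758866115801888149019293328186,
  nat_lit 32135295721708497155169020245695953936300242074524780943889918457794645244811692687322947324570378089955085669256097479205,
  nat_lit 599983464580706916973849205858531114301797006401317295881536157725567272893184226157379123542542215114454719361033160486,
  nat_lit 522185594336763208091812755478994093829864587669004500887619707709150285577343708035487936903805967162321388624055377210,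
  nat_lit 29265731166678050915218892171131395064794212230733728972743515413633115006130015689322428683541561576546278341946011726643,
  nat_lit 1967467029978431101499648903099862822330480552900364674727879967680825841256903519023931814948430821360970037743112664003,
  nat_lit 32231130915133638694656795606666692773160386773623351422973695319231662157316515090565311083407124133334115230689326351827,
  nat_lit 28765121434541201924376814003372747810416410099081295598854509345553019972744563580809625215684975687119646351989337732021,
  nat_lit 28839932161232402913087540168033679893659123789310652133269081190356156246974104232714888392663397675530363525203295438002,
  nat_lit 1813386786954325679225843096920827664642530770554805651205565576313699852742761818272942496195879337224577554242850828834,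
  nat_lit 920282302037765691425798455148399572238067546606559043363866884196267635234912964262126797261379178933352631940879697075,
  nat_lit 1076399821288105996069858785034729475218995502989265007621091385921120136031416207536706245970055302729999327529495472981,
  nat_lit 31753682882432413282630932480424550869614406968543455693428266637604572394008138389834343110248077624470719755045955249334,
  nat_lit 520552880969203830641550099187181523741592002982946187619691234272780939493755088015500989300839094952636525997737119138788971698,
  nat_lit 28775568671224749819662251297483334157922064902082491510922833558008949608134811296431381353394603359484056890194011573059,
  nat_lit 29097682846226607754707624758159736521137864486274368629002093075849980037061642820370221502713439268458229083797072265939,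
  nat_lit 456911329886715161666871989730485659074853771496721293081852513766735852010481761080759098639688127787002957814497485010,
  nat_lit 537411993702841276068700423263566746947974912486126973792895556433531889655502681445967759058057478356275506611066286983378,
  nat_lit 13054678019207803445971, nat_lit 0, nat_lit 940321642960957944466925063261662676471085296313940135302751144370277963970311810038096828275470121562086080134466099198,
  nat_lit 523513766990328656990631913293828052625371763723664572105353874967752345842592454231499286062053]

/-- A partial coset enumeration of `parabolic [1, …, 8]` in `L`. -/
def stepsCoincidences : List ℕ := [
  nat_lit 26403129250881466292161419567371406078242919357238748925442514430513588964364823207907092373566186285853753979545306,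
  nat_lit 1584598345804307182859110205196403013817761093311394285717748115123078459882780887518506997790875209203465034419116,
  nat_lit 496683098119456190506521898187356877803770912840366265454988273470190854310782443528782244840784561471541665708653,
  nat_lit 25680837226393196037287358442905924252406583429566079533358254083942208955014606342950703234481153450710241523901395,
  nat_lit 733935302473345359397653126848748489637274061786793565478168820804305763127807879968430192546884397028402035563844,
  nat_lit 24109712354201149624756779868574276023169252080324164611332821482231441266836783382425668218498747397984172401511332,
  nat_lit 24114351098085828302455499536496161341162613816450789837119208205369825274699988260346205904640821105348587639580957,
  nat_lit 328350057107220816229453135277036995412514281873480503737086235427506740523463492510834857920062257434021130320141,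
  nat_lit 24908089957136461577967851060242155175275283717024388519463370604420469384208664668725345693282953232034447366740493,
  nat_lit 1647236595939462124666417094640506343461238640854538245285779120920311544262368977388905863534021410763922075925101,
  nat_lit 1026531176146156148461201200890217572478563597168719425878854619735415139857614975589293746787161499673578985661243,
  nat_lit 2029520885970739743022502914072604685497168074572058409578415570864832966824850469647681016068584741067078550513437,
  nat_lit 208964610274637062474914283962113554895833078688671772032986088422091827668596332140152632458770649946348436792268157,
  nat_lit 969938964712536932211975301996755284141499244634390007995411790568647160054754404106035760798106087199233789271467,
  nat_lit 410899892501245363200814423993292685327804478706689738377519995006220969701304200064072621405859819351648588052617053,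
  nat_lit 21627171400202403506883775872307089208535903985969528952310649809403962960575457882351502110243056939864027731511837,
  nat_lit 26571128287754993828350931378997795302316036824795491799223948206141465595915943428688384506480533343062843617171981,
  nat_lit 1605014731304455530276209521954580479200502580541895121982011458328126596402355846883288176720167509281068094768445,
  nat_lit 1646303022761853310778232325430076652094074045684660068560109301557498506609789569325263092669705676636689084935083,
  nat_lit 1556970655473814105795563805049909256161085127307065722985437829817724233450168189309607680381468961571544025969965,
  nat_lit 1034781089517022474935393434580772540694350042303295587174543525824902185677867081974796351900237893139752223084758,
  nat_lit 26365366776172747979156130853762057632921239327244881153431095021220428733907999044967986638500292195470177906359596,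
  nat_lit 25680037220999226650700426162262015620372396997935023397852078571924601137820203279274347462648103537732614410656445,
  nat_lit 762504276262783066480172143845723031979237224864660690353025820252657276760884612216770572038437439409823148,
  nat_lit 0, nat_lit 536914131189767302532474325065628094439727802317175902539075253759505647501598222437992404217573100339190446427407,
  nat_lit 2609470]

theorem wellFormed_cosetData : wellFormed cosetData = true := by decide +kernel

set_option maxHeartbeats 0 in
theorem checkTable_cosetData : checkTable (enumerate 8 relators [2, 3, 4, 5, 6, 7, 8] stepsSuborbits)
    [1, 2, 3, 4, 5, 6, 7, 8] 3159 (suborbits cosetData) = true := by decide +kernel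

set_option maxHeartbeats 0 in
theorem checkPairs_cosetData : checkPairs (enumerate 5 relators [1, 2, 3, 4, 5, 6, 7, 8]
    stepsCoincidences) (coincidences cosetData) = true := by decide +kernel

/-- Generators of a subgroup in the descending chain of parabolic subgroups, together with
representatives of its nontrivial double cosets in the preceding one. -/
abbrev Level := List ℕ × List (List ℕ)

/-- The chain of parabolic subgroups below `parabolic [1, …, 8]`. -/
def levels : List Level :=
  [([1, 2, 3, 4, 5, 7, 8], [[6], [6, 5, 4, 3, 2, 1, 7, 3, 2, 8, 7, 3, 4, 5, 6]]), ([2, 3, 4, 5, 7,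
  8], [[1], [1, 2, 3, 4, 7, 3, 2, 1], [1, 2, 3, 4, 5, 7, 3, 4, 8, 7, 3, 2, 1]]), ([2, 3, 4, 5, 7],
  [[8], [8, 7, 3, 2, 4, 3, 7, 8]]), ([2, 3, 4, 7], [[5], [5, 4, 3, 2, 7, 3, 4, 5]]), ([2, 3, 4],
  [[7], [7, 3, 2, 4, 3, 7]]), ([2, 3], [[4]]), ([2], [[3]]), ([], [[2]])]

/-- Coset enumeration of `parabolic [1, 2, 3, 4, 5, 7, 8]` in `parabolic [1, 2, 3, 4, 5, 6, 7, 8]`. -/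
def stepsBCDEFHI : List ℕ := [
  nat_lit 1281596435671635324962672937280086467374328616125007892757254061007410128070952827279078360930877,
  nat_lit 1686557207718233752740978273224808493544086429392694425029287347202235517580824072844772972222873,
  nat_lit 1691893639906102833565841115612795618517589848541323730213721307072878797821002287994299947821497,
  nat_lit 1691303516699981084030967664189403979149219373150206196413592095006993330824290878417011633338965,
  nat_lit 24208044283548321145403413672181308887182760439400875980899895064688406930850109166748524366826410,
  nat_lit 24924298725665343376743552561583998300812420815745546567476827454882522049470657498192393762745013,
  nat_lit 27060859126821062855086363636480448843410775925791224902626105964316158083336628324049480508980387,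
  nat_lit 1691350122581666838433930014235046887378260850067446061243145907485101051115447440021186990519098,
  nat_lit 23923299311529963486370132939235744112443522901883203214468638981677503800036018963724146896648789,
  nat_lit 1507460109282310066951028327829327519904697414816754619587608554194459219864135600510120487578468,
  nat_lit 24928214918906438656214187140580738752111415769925905821155334951772670038080557841463326543596356,
  nat_lit 25991735986242137823515619661107606093184275815908420670948370335304374644354824956689802365131571,
  nat_lit 370311547569284047433590100680589727548082762337558611589335209778078355478538588592694226985657,
  nat_lit 1557735178090676651003969777481065382994576315537323935278553437126030679835384980141514827113122,
  nat_lit 24336068999018170341644557477177608346284835170130791244821899928318193152636788844984388376212387,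
  nat_lit 25916904651952553946142344522875176402202166233433823073630984186754998264241490693348547917276356,
  nat_lit 762756713947216288741346999947256895588700291974031297020577532810624495590430271753042241049186,
  nat_lit 1791509321830766951253740659554340529906952848008782226720075397101757839278700794754467995421605,
  nat_lit 24208042194547959095829654762621085553377469430451741423940253745736918241348051320550420211442387,
  nat_lit 6063471358913280240769316450089011018233406143954257410211795842828932536533524119912224064820661,
  nat_lit 1691303626394397838470539952422072490089313905677442138128338310672890160616369640487352823139236,
  nat_lit 26063964339739174911520640444526032189421054808894704474329383316263958483752672179592282464528586,
  nat_lit 23922352163409007043202017746094045249923860218861051836564562830382290752607025330360145425410853,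
  nat_lit 494206871417724905664267024968136864613427453098161330062399619039221056715999196348097381412147,
  nat_lit 348147035032696996141992757444508635114300402188137875870695929129581389503050876428710088788682,
  nat_lit 699636789087912506830573235708386000834521398043259196977583200710091442427888903261042085858722,
  nat_lit 1504319074870794970916917841130574487470583339162363053004921385331297261659265953341567231767218,
  nat_lit 24252700011424960514677015729631152343142398358969259195018303778156773114053175307060474778725187,
  nat_lit 1491541714477545028142633143826358292090823265868795050807890961376027354759224389119068737343962,
  nat_lit 62307185276266588907369480826420980751562751578796021972654188413551405004634154680354467845786436,
  nat_lit 1691384381409526239777228121078018266464755739134192804281155865544208293698364230334979714523350,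
  nat_lit 62291747082169430221523810143498125842848057234163565063659939235867812371855953401361169766521685,
  nat_lit 619882867663529173149416253484244187884097186615125659401901776327937604304924785709179381883094,
  nat_lit 24791369969646247905213228544387838190692171165632651465462510542447625405158470496321209438530340,
  nat_lit 1486248608999824519303295201164426642909985001322938885593571226729757547124868183962361409518692,
  nat_lit 5671381658004470758006618730671055394, nat_lit 0, nat_lit 7114738578880337958328573753749625539237734231456284386266006168378674440148553538214405815441805502,
  nat_lit 12436186357846583584705006735379040223283304553190457448803925922467392371114782381333821148532437,
  nat_lit 199062420754681950635863259669224290953457693826929651330934829713735291783411987840626603626136803,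
  nat_lit 131027989727888694656686732167301942734844562682998700494317426799669748311497149551598799565947362,
  nat_lit 67631008830836052787295647029592710063211181769150413814256937375621162872881721181154]

set_option maxHeartbeats 0 in
theorem checkTable_stepsBCDEFHI :
    checkTable (enumerate 5 relators [1, 2, 3, 4, 5, 7, 8] stepsBCDEFHI)
      [1, 2, 3, 4, 5, 6, 7, 8] 364 [(List.map (fun g => [g]) [1, 2, 3, 4, 5, 7, 8], [[], [6], [6, 5, 4, 3, 2, 1, 7, 3, 2, 8, 7, 3, 4, 5, 6]])] = true := by
  decide +kernel

/-- Coset enumeration of `parabolic [2, 3, 4, 5, 7, 8]` in `parabolic [1, 2, 3, 4, 5, 7, 8]`. -/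
def stepsCDEFHI : List ℕ := [
  nat_lit 32718353122049800875175727241494205099771458203525808109843705571112081993715042139939810233980479216382829175059883126187,
  nat_lit 1053320803862968035865752196976617448956512166204536518364798849714537373790856923382152066443920571850273986034934377380,
  nat_lit 1823634515695155049594941282698823754915635762905038642215188429036646038811746060851058274595380062664078768383135015128,
  nat_lit 29269493000865994547759087205648893685198139801574921904892433270646625206740677258461498748996421050091326685564903467844,
  nat_lit 924700472597408188285003166949948293628545158387660505612585204769628835313836834669686653323417682054444069818134115258,
  nat_lit 502639798790883261193717828607739574986503502075288328068275977915070557626125367722112707403259750287123837821096125892,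
  nat_lit 601891999519748846793756158921846952269488344000296093143728652582052452711224730174948184758139636694480779646213045306,
  nat_lit 1818625104072969769000897656411790353049563012636550521084239020285032309878655864206395260382884017442704008182175786419,
  nat_lit 32364198893192522098650005489971922646134198117405476449502833020530132148271969285079380325206126948396498207329276963657,
  nat_lit 31756570621712291401414317511298038179759803337528205956927326203307521912387942783890102747681475754659596443517127991510,
  nat_lit 1980055973665898464004697290245824162935440397454469563918746664658153809304274541871822461309741001269173485275131886394,
  nat_lit 30131991686868846529077798284464386634747935243368206454560815789395514992873390759879360601110543957411234440744385880754,
  nat_lit 34009115305172939431372960884494203632143490016989309517733114525946320660694125039233760829565106825815885808820543734714,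
  nat_lit 1818648265734487471958481031105685646319256598438787325929780804777320394224348626660505156683693663119845121527188163922,
  nat_lit 597506069463727040787804616138482461532950742293523958039116151656160440397155584308724485165415456192434531454026779791,
  nat_lit 2034790214500246443073925898843532720940498603520884009427397528501934259277535353292065475342975404402151533000705942474,
  nat_lit 9882169109863359028911938914841182829585328883420507331536772732595681887430078331882518708319083869805852248081095640006,
  nat_lit 9912430774332115184542938039900640322772007803349441775991339077675593566303542583706991057593838028776594684106544691891,
  nat_lit 2127810173469178978920169279107250159398110770192808991897490495829908380083, nat_lit 0,
  nat_lit 14382]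

set_option maxHeartbeats 0 in
theorem checkTable_stepsCDEFHI :
    checkTable (enumerate 5 relators [2, 3, 4, 5, 7, 8] stepsCDEFHI)
      [1, 2, 3, 4, 5, 7, 8] 243 [(List.map (fun g => [g]) [2, 3, 4, 5, 7, 8], [[], [1], [1, 2, 3, 4, 7, 3, 2, 1], [1, 2, 3, 4, 5, 7, 3, 4, 8, 7, 3, 2, 1]])] = true := by
  decide +kernel

/-- Coset enumeration of `parabolic [2, 3, 4, 5, 7]` in `parabolic [2, 3, 4, 5, 7, 8]`. -/
def stepsCDEFH : List ℕ := [
  nat_lit 620598274851748280159645882404846294078966709333314373847969977110082492844528133688933429816144507776024881857868450397,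
  nat_lit 253096338115471523453852305885607435723879959614700573650021536678001642512960432959779212849828738035393239046662553]

set_option maxHeartbeats 0 in
theorem checkTable_stepsCDEFH :
    checkTable (enumerate 2 relators [2, 3, 4, 5, 7] stepsCDEFH)
      [2, 3, 4, 5, 7, 8] 27 [(List.map (fun g => [g]) [2, 3, 4, 5, 7], [[], [8], [8, 7, 3, 2, 4, 3, 7, 8]])] = true := by
  decide +kernel

/-- Coset enumeration of `parabolic [2, 3, 4, 7]` in `parabolic [2, 3, 4, 5, 7]`. -/
def stepsCDEH : List ℕ := [
  nat_lit 200829642249751643606777431132976657864294109236310210301942754045921250573998637]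

set_option maxHeartbeats 0 in
theorem checkTable_stepsCDEH :
    checkTable (enumerate 2 relators [2, 3, 4, 7] stepsCDEH)
      [2, 3, 4, 5, 7] 10 [(List.map (fun g => [g]) [2, 3, 4, 7], [[], [5], [5, 4, 3, 2, 7, 3, 4, 5]])] = true := by
  decide +kernel

/-- Coset enumeration of `parabolic [2, 3, 4]` in `parabolic [2, 3, 4, 7]`. -/
def stepsCDE : List ℕ := [
  nat_lit 13074422313346526760108519665485805999695945702444161613]

set_option maxHeartbeats 0 in
theorem checkTable_stepsCDE :
    checkTable (enumerate 2 relators [2, 3, 4] stepsCDE)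
      [2, 3, 4, 7] 8 [(List.map (fun g => [g]) [2, 3, 4], [[], [7], [7, 3, 2, 4, 3, 7]])] = true := by
  decide +kernel

/-- Coset enumeration of `parabolic [2, 3]` in `parabolic [2, 3, 4]`. -/
def stepsCD : List ℕ := [
  nat_lit 3696694040550693405]

set_option maxHeartbeats 0 in
theorem checkTable_stepsCD :
    checkTable (enumerate 2 relators [2, 3] stepsCD)
      [2, 3, 4] 4 [(List.map (fun g => [g]) [2, 3], [[], [4]])] = true := by
  decide +kernel

/-- Coset enumeration of `parabolic [2]` in `parabolic [2, 3]`. -/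
def stepsC : List ℕ := [
  nat_lit 14724422157]

set_option maxHeartbeats 0 in
theorem checkTable_stepsC :
    checkTable (enumerate 2 relators [2] stepsC)
      [2, 3] 3 [(List.map (fun g => [g]) [2], [[], [3]])] = true := by
  decide +kernel

/-- Coset enumeration of `parabolic []` in `parabolic [2]`. -/
def stepsNil : List ℕ := [
  nat_lit 172]

set_option maxHeartbeats 0 in
theorem checkTable_stepsNil :
    checkTable (enumerate 2 relators [] stepsNil)
      [2] 2 [(List.map (fun g => [g]) [], [[], [2]])] = true := by
  decide +kernel

/-- A subgroup of `L` lying in suitable subgroups `S` that separate the double cosets at each level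
is contained in the subgroup generated by `z`. -/
theorem le_parabolic_nil {K S : Subgroup L} (hKS : K ≤ S)
    (hS : parabolic [1, 2, 3, 4, 5, 6, 7, 8] ≤ S)
    (hne : ∀ r ∈ cosetData.map (·.1), evalWord twist r ∉ S)
    (hlev : ∀ l ∈ levels, ∃ S : Subgroup L, K ≤ S ∧ parabolic l.1 ≤ S ∧
      ∀ r ∈ l.2, evalWord twist r ∉ S) : K ≤ parabolic [] := by
  have hK := mem_parabolic_of_cosetData hKS wellFormed_cosetData checkPairs_cosetData
    checkTable_cosetData hS hne
  simp only [levels, List.mem_cons, List.not_mem_nil, or_false, forall_eq_or_imp, forall_eq] at hlev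
  obtain ⟨⟨S1, hK1, hS1, hne1⟩, ⟨S2, hK2, hS2, hne2⟩, ⟨S3, hK3, hS3, hne3⟩, ⟨S4, hK4, hS4, hne4⟩, ⟨S5, hK5, hS5, hne5⟩, ⟨S6, hK6, hS6, hne6⟩, ⟨S7, hK7, hS7, hne7⟩, ⟨S8, hK8, hS8, hne8⟩⟩ := hlev
  replace hK := mem_parabolic_of_checkTable hK1 checkTable_stepsBCDEFHI (by decide) (by decide)
    (by decide) hS1 (by simpa using hne1) hK
  replace hK := mem_parabolic_of_checkTable hK2 checkTable_stepsCDEFHI (by decide) (by decide)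
    (by decide) hS2 (by simpa using hne2) hK
  replace hK := mem_parabolic_of_checkTable hK3 checkTable_stepsCDEFH (by decide) (by decide)
    (by decide) hS3 (by simpa using hne3) hK
  replace hK := mem_parabolic_of_checkTable hK4 checkTable_stepsCDEH (by decide) (by decide)
    (by decide) hS4 (by simpa using hne4) hK
  replace hK := mem_parabolic_of_checkTable hK5 checkTable_stepsCDE (by decide) (by decide)
    (by decide) hS5 (by simpa using hne5) hK
  replace hK := mem_parabolic_of_checkTable hK6 checkTable_stepsCD (by decide) (by decide)
    (by decide) hS6 (by simpa using hne6) hK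
  replace hK := mem_parabolic_of_checkTable hK7 checkTable_stepsC (by decide) (by decide)
    (by decide) hS7 (by simpa using hne7) hK
  replace hK := mem_parabolic_of_checkTable hK8 checkTable_stepsNil (by decide) (by decide)
    (by decide) hS8 (by simpa using hne8) hK
  exact hK

/-! ### Matrices over `ZMod 17` with packed rows -/

/-- The leaf of a trie reached by the binary digits of an index. -/
def Trie.row (t : Trie) : ℕ → ℕ :=
  Trie.rec (fun n _ => n)
    (fun _ _ gl gr q => Nat.rec gl (fun _ _ => gr) (Nat.mod q (nat_lit 2)) (Nat.div q (nat_lit 2))) t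

def Trie.setRow (t : Trie) (y : ℕ) : ℕ → Trie :=
  Trie.rec (fun _ _ => .leaf y)
    (fun l r sl sr q => Nat.rec ((sl (Nat.div q (nat_lit 2))).force (nodeLeft r))
      (fun _ _ => (sr (Nat.div q (nat_lit 2))).force (.node l)) (Nat.mod q (nat_lit 2))) t

/-- Partial reduction of all slots of a row modulo `17`, using `256 ≡ 1`. -/
def foldRow {α : Type} (mask n : ℕ) (k : ℕ → α) : α :=
  forceNat n fun n => forceNat (Nat.land n mask) fun l =>
    forceNat (Nat.add l (Nat.shiftRight (Nat.sub n l) (nat_lit 8))) k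

/-- Linear combination of rows; the hexadecimal digits of the second argument are the coefficients
decreased by one. -/
def dotRow (xs : List ℕ) : ℕ → ℕ → ℕ :=
  List.rec (fun _ s => s) (fun x _ ih c s => ih (Nat.div c (nat_lit 16))
    (Nat.add s (Nat.mul (Nat.succ (Nat.mod c (nat_lit 16))) x))) xs

def gatherRows {α : Type} (t : Trie) (b : List (ℕ × ℕ)) : (List ℕ → α) → α :=
  List.rec (fun k => k []) (fun p _ ih k => forceNat (t.row p.1) fun x => ih fun xs => k (x :: xs)) b

def scatterRows (mask : ℕ) (xs : List ℕ) (b : List (ℕ × ℕ)) : Trie → Trie :=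
  List.rec (fun t => t) (fun p _ ih t => foldRow mask (dotRow xs p.2 (nat_lit 0)) fun y =>
    (t.setRow y p.1).force ih) b

/-- Apply a block diagonal matrix to the rows. A block lists row indices and coefficients. -/
def applyBlocks (mask : ℕ) (bs : List (List (ℕ × ℕ))) : Trie → Trie :=
  List.rec (fun t => t)
    (fun b _ ih t => (gatherRows t b fun xs => scatterRows mask xs b t).force ih) bs

def applyWord (mask : ℕ) (gen : ℕ → List (List (ℕ × ℕ))) (w : List ℕ) : Trie → Trie :=
  List.rec (fun t => t) (fun g _ ih t => (applyBlocks mask (gen g) t).force ih) w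

/-- The trie of depth `d` whose row `q` is `f (x + s * q)`. -/
def tabulate (f : ℕ → ℕ) (d : ℕ) : ℕ → ℕ → Trie :=
  Nat.rec (fun _ x => forceNat (f x) .leaf) (fun _ ih s x =>
    (ih (Nat.mul (nat_lit 2) s) x).force fun l =>
      (ih (Nat.mul (nat_lit 2) s) (Nat.add x s)).force fun r => .node l r) d

theorem Trie.row_node (l r : Trie) (q : ℕ) :
    (Trie.node l r).row q = if q % 2 = 0 then l.row (q / 2) else r.row (q / 2) := by
  change (Nat.rec l.row (fun _ _ => r.row) (q % 2) : ℕ → ℕ) (q / 2) = _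
  rcases Nat.mod_two_eq_zero_or_one q with h | h <;> rw [h] <;> rfl

theorem Trie.setRow_node (l r : Trie) (y q : ℕ) : (Trie.node l r).setRow y q =
    if q % 2 = 0 then .node (l.setRow y (q / 2)) r else .node l (r.setRow y (q / 2)) := by
  change (Nat.rec ((l.setRow y (q / 2)).force (nodeLeft r))
    (fun _ _ => (r.setRow y (q / 2)).force (.node l)) (q % 2) : Trie) = _
  rcases Nat.mod_two_eq_zero_or_one q with h | h <;> rw [h] <;> simp [nodeLeft]

/-- All leaves have depth `d`. -/
def Trie.IsFull : ℕ → Trie → Prop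
  | 0, .leaf _ => True
  | d + 1, .node l r => l.IsFull d ∧ r.IsFull d
  | _, _ => False

theorem Trie.IsFull.setRow {d : ℕ} {t : Trie} (ht : t.IsFull d) (y q : ℕ) :
    (t.setRow y q).IsFull d := by
  induction d generalizing t q with
  | zero =>
    cases t with
    | leaf n => trivial
    | node l r => exact ht.elim
  | succ d ih =>
    cases t with
    | leaf n => exact ht.elim
    | node l r =>
      rw [setRow_node]
      split
      exacts [⟨ih ht.1 _, ht.2⟩, ⟨ht.1, ih ht.2 _⟩]

theorem Trie.IsFull.row_setRow {d : ℕ} {t : Trie} (ht : t.IsFull d) (y : ℕ) {q q' : ℕ}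
    (hq : q < 2 ^ d) (hq' : q' < 2 ^ d) :
    (t.setRow y q).row q' = if q' = q then y else t.row q' := by
  induction d generalizing t q q' with
  | zero =>
    cases t with
    | leaf n =>
      rw [if_pos (by omega)]
      rfl
    | node l r => exact ht.elim
  | succ d ih =>
    cases t with
    | leaf n => exact ht.elim
    | node l r =>
      have h1 : q / 2 < 2 ^ d := by omega
      have h2 : q' / 2 < 2 ^ d := by omega
      rw [setRow_node, row_node]
      split <;> rw [row_node]
      · rw [ih ht.1 h1 h2]; split_ifs <;> first | rfl | omega
      · rw [ih ht.2 h1 h2]; split_ifs <;> first | rfl | omega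

theorem tabulate_succ (f : ℕ → ℕ) (d s x : ℕ) : tabulate f (d + 1) s x =
    .node (tabulate f d (2 * s) x) (tabulate f d (2 * s) (x + s)) := by
  change ((tabulate f d (2 * s) x).force fun l => (tabulate f d (2 * s) (x + s)).force fun r =>
    Trie.node l r) = _
  rw [Trie.force_eq, Trie.force_eq]

theorem isFull_tabulate (f : ℕ → ℕ) (d s x : ℕ) : (tabulate f d s x).IsFull d := by
  induction d generalizing s x with
  | zero =>
    change (forceNat (f x) Trie.leaf).IsFull 0
    rw [forceNat_eq]
    trivial
  | succ d ih =>
    rw [tabulate_succ]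
    exact ⟨ih _ _, ih _ _⟩

theorem row_tabulate (f : ℕ → ℕ) (d s x q : ℕ) (hq : q < 2 ^ d) :
    (tabulate f d s x).row q = f (x + s * q) := by
  induction d generalizing s x q with
  | zero =>
    change (forceNat (f x) Trie.leaf).row q = _
    rw [forceNat_eq, show q = 0 by omega]
    rfl
  | succ d ih =>
    rw [tabulate_succ, Trie.row_node, ih _ _ _ (by omega), ih _ _ _ (by omega)]
    split
    · congr 1
      have : 2 * s * (q / 2) = s * (2 * (q / 2)) := by ring
      rw [this, show 2 * (q / 2) = q by omega]
    · congr 1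
      have : x + s + 2 * s * (q / 2) = x + s * (2 * (q / 2) + 1) := by ring
      rw [this, show 2 * (q / 2) + 1 = q by omega]

/-! #### Packed digits -/

/-- The number with base `2 ^ 20` digits `d 0, …, d (m - 1)`. -/
def pack : ℕ → (ℕ → ℕ) → ℕ
  | 0, _ => 0
  | m + 1, d => d 0 + 1048576 * pack m fun k => d (k + 1)

/-- The mask extracting the low eight bits of `m` slots. -/
def slotMask : ℕ → ℕ
  | 0 => 0
  | m + 1 => 255 + 1048576 * slotMask m

theorem pack_zero (m : ℕ) : pack m (fun _ => 0) = 0 := by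
  induction m with
  | zero => rfl
  | succ m ih => rw [pack, ih]

theorem pack_congr {m : ℕ} {x y : ℕ → ℕ} (h : ∀ k < m, x k = y k) : pack m x = pack m y := by
  induction m generalizing x y with
  | zero => rfl
  | succ m ih => rw [pack, pack, h 0 (by omega), ih fun k hk => h (k + 1) (by omega)]

theorem pack_add (m : ℕ) (x y : ℕ → ℕ) : pack m x + pack m y = pack m fun k => x k + y k := by
  induction m generalizing x y with
  | zero => rfl
  | succ m ih => simp only [pack, ← ih]; ring

theorem mul_pack (m c : ℕ) (x : ℕ → ℕ) : c * pack m x = pack m fun k => c * x k := by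
  induction m generalizing x with
  | zero => rfl
  | succ m ih => simp only [pack, ← ih]; ring

theorem pack_mod_div (m : ℕ) (x : ℕ → ℕ) :
    pack m x = pack m (fun k => x k % 256) + 256 * pack m fun k => x k / 256 := by
  rw [mul_pack, pack_add]
  congr 1
  funext k
  omega

theorem land_slotMask (m n : ℕ) : n &&& slotMask m = pack m fun k => n / 1048576 ^ k % 256 := by
  induction m generalizing n with
  | zero => simp [slotMask, pack]
  | succ m ih =>
    have key : n &&& slotMask (m + 1) = n % 256 + 1048576 * (n / 1048576 &&& slotMask m) := by
      apply Nat.eq_of_testBit_eq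
      intro j
      have h1 : slotMask (m + 1) = 2 ^ 20 * slotMask m + 255 := by rw [slotMask]; ring
      have h2 : n % 256 + 1048576 * (n / 1048576 &&& slotMask m) =
        2 ^ 20 * (n / 1048576 &&& slotMask m) + n % 256 := by ring
      have h3 : n % 256 < 2 ^ 20 := lt_trans (Nat.mod_lt _ (by decide)) (by decide)
      rw [h1, h2, Nat.testBit_and, Nat.testBit_two_pow_mul_add _ (by decide),
        Nat.testBit_two_pow_mul_add _ h3]
      split
      · rw [show n % 256 = n &&& (2 ^ 8 - 1) from (Nat.and_two_pow_sub_one_eq_mod n 8).symm,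
          Nat.testBit_and]
        rfl
      · rename_i hj
        rw [Nat.testBit_and, show (1048576 : ℕ) = 2 ^ 20 by rfl, Nat.testBit_div_two_pow,
          show j - 20 + 20 = j by omega]
    rw [key, ih, pack]
    simp only [pow_zero, Nat.div_one, pow_succ', Nat.div_div_eq_div_mul]

theorem pack_div {m : ℕ} {x : ℕ → ℕ} (hx : ∀ k, x k < 1048576) {k : ℕ} (hk : k < m) :
    pack m x / 1048576 ^ k % 1048576 = x k := by
  induction m generalizing x k with
  | zero => omega
  | succ m ih =>
    have h0 := hx 0
    cases k with
    | zero => rw [pack, pow_zero, Nat.div_one]; omega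
    | succ k =>
      rw [pack, pow_succ', ← Nat.div_div_eq_div_mul, Nat.add_mul_div_left _ _ (by decide),
        Nat.div_eq_of_lt h0, zero_add, ih (fun k => hx (k + 1)) (by omega)]

theorem pack_land {m : ℕ} {x : ℕ → ℕ} (hx : ∀ k, x k < 1048576) :
    pack m x &&& slotMask m = pack m fun k => x k % 256 := by
  rw [land_slotMask]
  refine pack_congr fun k hk => ?_
  rw [← pack_div hx hk, Nat.mod_mod_of_dvd _ (by decide)]

theorem foldRow_pack {α : Type} {m : ℕ} {x : ℕ → ℕ} (hx : ∀ k, x k < 1048576) (f : ℕ → α) :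
    foldRow (slotMask m) (pack m x) f = f (pack m fun k => x k % 256 + x k / 256) := by
  unfold foldRow
  simp only [forceNat_eq]
  congr 1
  change (pack m x &&& slotMask m) + (pack m x - (pack m x &&& slotMask m)) >>> 8 = _
  rw [pack_land hx, ← pack_add, Nat.shiftRight_eq_div_pow]
  have := pack_mod_div m x
  omega

theorem pack_single (m i c : ℕ) (hi : i < m) :
    pack m (fun k => if k = i then c else 0) = c * 1048576 ^ i := by
  induction m generalizing i with
  | zero => omega
  | succ m ih =>
    cases i with
    | zero => simp [pack, pack_zero]
    | succ i =>
      simp only [pack, Nat.add_right_cancel_iff, ih i (by omega)]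
      rw [if_neg (by omega)]
      ring

theorem pack_extend (m j : ℕ) (x : ℕ → ℕ) :
    pack m x = pack (m + j) fun k => if k < m then x k else 0 := by
  induction m generalizing x with
  | zero => simp [pack, pack_zero]
  | succ m ih => rw [Nat.add_right_comm, pack, pack, ih]; simp

theorem pack_inj {m m' : ℕ} {x y : ℕ → ℕ} (h : pack m x = pack m' y) (hx : ∀ k, x k < 1048576)
    (hy : ∀ k, y k < 1048576) {k : ℕ} (hk : k < m) (hk' : k < m') : x k = y k := by
  rw [← pack_div hx hk, ← pack_div hy hk', h]

/-! #### Linear maps described by blocks -/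

/-- Column vectors over the field with `17` elements. -/
abbrev Vec := Fin 352 → ZMod 17

def rowIndex (n : ℕ) : Fin 352 := Fin.ofNat 352 n

def dotForm : List (ℕ × ℕ) → ℕ → Vec →ₗ[ZMod 17] ZMod 17
  | [], _ => 0
  | p :: b, c => ((c % 16 + 1 : ℕ) : ZMod 17) • LinearMap.proj (rowIndex p.1) + dotForm b (c / 16)

def scatterForm (b : List (ℕ × ℕ)) :
    List (ℕ × ℕ) → (Fin 352 → Vec →ₗ[ZMod 17] ZMod 17) → Fin 352 → Vec →ₗ[ZMod 17] ZMod 17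
  | [], f => f
  | p :: b', f => scatterForm b b' (Function.update f (rowIndex p.1) (dotForm b p.2))

/-- The linear map described by one block. -/
def blockMap (b : List (ℕ × ℕ)) : Module.End (ZMod 17) Vec :=
  LinearMap.pi (scatterForm b b fun i => LinearMap.proj i)

/-- The linear map described by a list of blocks. -/
def blocksMap : List (List (ℕ × ℕ)) → Module.End (ZMod 17) Vec
  | [] => 1
  | b :: bs => blocksMap bs * blockMap b

/-- The sum of the first `n` coefficients encoded by `c`. -/
def coeffSum : ℕ → ℕ → ℕ
  | 0, _ => 0
  | n + 1, c => c % 16 + 1 + coeffSum n (c / 16)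

/-- The row indices and coefficients of a block are within the range that excludes carries. -/
def isTame (b : List (ℕ × ℕ)) : Bool :=
  b.all fun p => Nat.blt p.1 352 && Nat.ble (coeffSum b.length p.2) 208

/-- The slots of `n` are bounded by `β` and reduce to `x`. -/
def IsPacked (m β n : ℕ) (x : ℕ → ZMod 17) : Prop :=
  ∃ d : ℕ → ℕ, n = pack m d ∧ (∀ k, d k ≤ β) ∧ ∀ k, (d k : ZMod 17) = x k

/-- The columns of the matrix stored in `t` are the vectors `X k`. -/
structure Represents (m : ℕ) (t : Trie) (X : ℕ → Vec) : Prop where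
  full : t.IsFull 9
  rows : ∀ i : Fin 352, IsPacked m 1360 (t.row i) fun k => X k i

theorem rowIndex_of_lt {n : ℕ} (h : n < 352) : (rowIndex n : ℕ) = n := Nat.mod_eq_of_lt h

theorem isPacked_dotRow {m β : ℕ} {t : Trie} {X : ℕ → Vec} (ht : Represents m t X)
    {b : List (ℕ × ℕ)} (hb : ∀ p ∈ b, p.1 < 352) {c s : ℕ} {x : ℕ → ZMod 17}
    (hs : IsPacked m β s x) :
    IsPacked m (β + coeffSum b.length c * 1360) (dotRow (b.map fun p => t.row p.1) c s)
      fun k => x k + dotForm b c (X k) := by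
  induction b generalizing c s x β with
  | nil =>
    simp only [List.length_nil, coeffSum, zero_mul, add_zero, dotForm, LinearMap.zero_apply]
    exact hs
  | cons p b ih =>
    obtain ⟨d, rfl, hd, hdx⟩ := hs
    obtain ⟨e, he, heβ, hex⟩ := ht.rows (rowIndex p.1)
    rw [rowIndex_of_lt (hb p (by simp))] at he
    have hnew : IsPacked m (β + (c % 16 + 1) * 1360) (pack m d + (c % 16 + 1) * t.row p.1)
        fun k => x k + ((c % 16 + 1 : ℕ) : ZMod 17) * X k (rowIndex p.1) := by
      refine ⟨fun k => d k + (c % 16 + 1) * e k, ?_, fun k => ?_, fun k => ?_⟩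
      · rw [he, mul_pack, pack_add]
      · exact add_le_add (hd k) (Nat.mul_le_mul_left _ (heβ k))
      · rw [Nat.cast_add, Nat.cast_mul, hdx, hex]
    have := ih (fun q hq => hb q (by simp [hq])) (c := c / 16) hnew
    have hβ : β + coeffSum (p :: b).length c * 1360 =
        β + (c % 16 + 1) * 1360 + coeffSum b.length (c / 16) * 1360 := by
      rw [List.length_cons, coeffSum]; ring
    rw [hβ]
    simp only [dotForm, LinearMap.add_apply, LinearMap.smul_apply, LinearMap.proj_apply,
      smul_eq_mul, ← add_assoc]
    exact this

theorem natCast_fold (n : ℕ) : ((n % 256 + n / 256 : ℕ) : ZMod 17) = n := by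
  conv_rhs => rw [← Nat.mod_add_div n 256]
  push_cast
  rw [show (256 : ZMod 17) = 1 by decide, one_mul]

theorem foldRow_spec {α : Type} {m n : ℕ} {x : ℕ → ZMod 17} (h : IsPacked m (208 * 1360) n x)
    {P : α → Prop} {f : ℕ → α} (hf : ∀ y, IsPacked m 1360 y x → P (f y)) :
    P (foldRow (slotMask m) n f) := by
  obtain ⟨d, rfl, hd, hdx⟩ := h
  rw [foldRow_pack fun k => by have := hd k; omega]
  refine hf _ ⟨_, rfl, fun k => ?_, fun k => ?_⟩
  · have := hd k; omega
  · rw [natCast_fold, hdx]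

theorem scatterRows_cons (mask : ℕ) (xs : List ℕ) (p : ℕ × ℕ) (b : List (ℕ × ℕ)) (t : Trie) :
    scatterRows mask xs (p :: b) t =
      foldRow mask (dotRow xs p.2 0) fun y => scatterRows mask xs b (t.setRow y p.1) := by
  change (foldRow mask (dotRow xs p.2 0) fun y => (t.setRow y p.1).force
    (scatterRows mask xs b)) = _
  simp only [Trie.force_eq]

theorem gatherRows_eq {α : Type} (t : Trie) (b : List (ℕ × ℕ)) (f : List ℕ → α) :
    gatherRows t b f = f (b.map fun p => t.row p.1) := by
  induction b generalizing f with
  | nil => rfl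
  | cons p b ih =>
    change (forceNat (t.row p.1) fun x => gatherRows t b fun xs => f (x :: xs)) = _
    rw [forceNat_eq, ih]
    rfl

theorem represents_scatterRows {m : ℕ} {X : ℕ → Vec} {xs : List ℕ} {b b' : List (ℕ × ℕ)}
    (hb : ∀ p ∈ b', p.1 < 352 ∧
      IsPacked m (208 * 1360) (dotRow xs p.2 0) fun k => dotForm b p.2 (X k))
    {t : Trie} {f : Fin 352 → Vec →ₗ[ZMod 17] ZMod 17}
    (ht : Represents m t fun k i => f i (X k)) :
    Represents m (scatterRows (slotMask m) xs b' t) fun k i => scatterForm b b' f i (X k) := by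
  induction b' generalizing t f with
  | nil => exact ht
  | cons p b' ih =>
    rw [scatterRows_cons]
    obtain ⟨hlt, hp⟩ := hb p (by simp)
    refine foldRow_spec (P := fun t => Represents m t _) hp fun y hy =>
      ih (fun q hq => hb q (by simp [hq])) ⟨ht.full.setRow y p.1, fun i => ?_⟩
    rw [ht.full.row_setRow y (by omega) (by omega)]
    by_cases hi : i = rowIndex p.1
    · rw [if_pos (by rw [hi, rowIndex_of_lt hlt])]
      simpa [hi] using hy
    · rw [if_neg fun h => hi (Fin.ext (by rw [h, rowIndex_of_lt hlt]))]
      simpa [Function.update_of_ne hi] using ht.rows i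

theorem Represents.applyBlocks {m : ℕ} {bs : List (List (ℕ × ℕ))} (hbs : bs.all isTame = true)
    {t : Trie} {X : ℕ → Vec} (ht : Represents m t X) :
    Represents m (applyBlocks (slotMask m) bs t) fun k => blocksMap bs (X k) := by
  induction bs generalizing t X with
  | nil => exact ht
  | cons b bs ih =>
    rw [List.all_cons, Bool.and_eq_true] at hbs
    change Represents m ((gatherRows t b fun xs => scatterRows (slotMask m) xs b t).force
      (TwoFi22.applyBlocks (slotMask m) bs)) _
    rw [Trie.force_eq, gatherRows_eq]
    refine ih hbs.2 (X := fun k => blockMap b (X k)) ?_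
    have hb : ∀ p ∈ b, p.1 < 352 ∧ coeffSum b.length p.2 ≤ 208 := by
      intro p hp
      have := List.all_eq_true.1 hbs.1 p hp
      rw [Bool.and_eq_true] at this
      exact ⟨Nat.le_of_ble_eq_true this.1, Nat.le_of_ble_eq_true this.2⟩
    refine represents_scatterRows (fun p hp => ⟨(hb p hp).1, ?_⟩) ht
    obtain ⟨d, h1, h2, h3⟩ := isPacked_dotRow ht (fun p hp => (hb p hp).1) (c := p.2)
      (β := 0) (s := 0) (x := 0) ⟨fun _ => 0, (pack_zero m).symm, fun _ => le_rfl, fun _ => by simp⟩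
    refine ⟨d, h1, fun k => (h2 k).trans ?_, fun k => by simpa using h3 k⟩
    rw [zero_add]
    exact Nat.mul_le_mul_right _ (hb p hp).2

theorem Represents.applyWord {m : ℕ} {gen : ℕ → List (List (ℕ × ℕ))}
    (hgen : ∀ g, (gen g).all isTame = true) (w : List ℕ) {t : Trie} {X : ℕ → Vec}
    (ht : Represents m t X) : Represents m (applyWord (slotMask m) gen w t)
      fun k => evalWord (fun g => blocksMap (gen g)) w (X k) := by
  induction w generalizing t X with
  | nil => exact ht
  | cons g w ih =>
    change Represents m ((TwoFi22.applyBlocks (slotMask m) (gen g) t).force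
      (TwoFi22.applyWord (slotMask m) gen w)) _
    rw [Trie.force_eq]
    exact ih (ht.applyBlocks (hgen g))

/-! #### Testing whether a word acts diagonally -/

/-- The mask for rows of `4 + 352` slots; the four low slots only diversify hash values. -/
def wideMask : ℕ := nat_lit 5242154406851595274326379162290373673512070461458760585415819094891730971731914386820108098992583571671596181498380899262969370103141976426354883361663521941149088293378279889609226031144591154282746416472980358395776937593270470848593685513582927278426622157987708483347523847770530861462283639349115970786084111841610261225570691105266006992509576714864754444881605254387553071942357773275835934684374221306026601664838585217586788536962166604923796960666163993573781673912154560856311528697930548772966836362730486149233784400149323698624385471094579680903253334133078401665931314469794508485305697180749964674065974069558186707532958766717352248097718099369106095957745027035131257631482279582058424218370909744669264559761522543996059706260834641959658145487916956582416603909263428393164700197480682512533122224268241458836938403997202540032588475020651493294867591178754421331571237741024996211032417736155307337717565435872453224215849505190003444361686884619553264126970372608164941197583492947969243822025150984656148439529569381077686398133124070144173006695581577482948636999006582613957352875394131841442136558707415978382481684142190149615421470842997161197212927193272468584228172981564326471252174449914909848855652311040454184315773844175592596555849910322022971773375512988567317110261276993523325688019092111781259924385277656001237133875668285917898489769141565399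856063914124152581493904778041365335719317872581958326696570152443495635778868598651554921016298849104629317322657789632460958477977999793115886725777301466050810673923291144408986050164902542250944268379612368827720711232367755167032072628609733113708079068350656390461660799993685761885191809711838428512345346988335919113324386163216758025433233331572727994413355025780768356555858319527336971463116641181447028654381840607035018608424919839937374535556656985015097737217845174760479578024508209234308343278378594144250947767476348480078337038824500088673986193814019835015558482834929008088214436610253987866252334525602523473744939703637474882068727682739177578457383231466394959676582932824903766090360529092945395621056036161834169471799427622502655

def unitRow (i : ℕ) : ℕ :=
  Nat.add (Nat.land (Nat.mul (Nat.succ i) (nat_lit 11954515942386642175605196)) (nat_lit 293995264050478448895))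
    (Nat.shiftLeft (nat_lit 1) (Nat.mul (nat_lit 20) (Nat.add i (nat_lit 4))))

def unitRows : Trie := tabulate unitRow (nat_lit 9) (nat_lit 1) (nat_lit 0)

def isScaledUnit (c i n : ℕ) : Bool :=
  forceNat n fun n =>
  Nat.beq n (Nat.add (Nat.shiftLeft c (Nat.mul (nat_lit 20) i))
    (Nat.mul (nat_lit 17)
      (Nat.land (Nat.shiftRight (Nat.mul n (nat_lit 241)) (nat_lit 12)) wideMask)))

def signAt (s i : ℕ) : ℕ :=
  Nat.succ (Nat.mul (nat_lit 15) (Nat.mod (Nat.shiftRight s i) (nat_lit 2)))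

/-- The matrix is diagonal; the entry at `i` is `-1` if bit `i` of `s` is set and `1` otherwise. -/
def isDiagonal (s : ℕ) (t : Trie) : Bool :=
  allBelow (fun i => isScaledUnit (signAt s i) i (Nat.shiftRight (t.row i) (nat_lit 80)))
    (nat_lit 352)

theorem wideMask_eq : wideMask = slotMask 356 := by decide +kernel

theorem exists_represents_unitRows : ∃ X : ℕ → Vec, Represents 356 unitRows X ∧
    ∀ k : Fin 352, X (k + 4) = Pi.single k 1 := by
  have hrow : ∀ i : Fin 352, ∃ d : ℕ → ℕ, unitRow i = pack 356 d ∧ (∀ k, d k ≤ 1360) ∧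
      ∀ k, d (k + 4) = if k = i then 1 else 0 := by
    intro i
    have hn : 293995264050478448895 = slotMask 4 := by decide
    have : unitRow i = ((i + 1) * 11954515942386642175605196 &&& slotMask 4) +
        1 <<< (20 * ((i : ℕ) + 4)) := by rw [← hn]; rfl
    rw [this, land_slotMask, pack_extend 4 352, Nat.shiftLeft_eq, pow_mul,
      show 2 ^ 20 = 1048576 by rfl, ← pack_single 356 (i + 4) 1 (by omega), pack_add]
    refine ⟨_, rfl, fun k => ?_, fun k => ?_⟩
    · have := Nat.mod_lt ((i + 1) * 11954515942386642175605196 / 1048576 ^ k) (show 0 < 256 by decide)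
      split_ifs <;> omega
    · simp
  choose d hd hle hunit using hrow
  refine ⟨fun k i => d i k, ⟨isFull_tabulate _ _ _ _, fun i => ?_⟩, fun k => ?_⟩
  · refine ⟨d i, ?_, hle i, fun k => rfl⟩
    rw [← hd i, unitRows, row_tabulate _ _ _ _ _ (i.isLt.trans (by decide))]
    exact congrArg unitRow (by change 0 + 1 * (i : ℕ) = i; omega)
  · funext i
    simp only [hunit, Pi.single_apply, Fin.ext_iff, eq_comm]
    split_ifs <;> simp

/-- The diagonal entries described by the bits of `s`. -/
def sign (s : ℕ) (i : Fin 352) : ZMod 17 := if s.testBit i then -1 else 1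

theorem natCast_signAt (s : ℕ) (i : Fin 352) : (signAt s i : ZMod 17) = sign s i := by
  change ((15 * ((s >>> (i : ℕ)) % 2) + 1 : ℕ) : ZMod 17) = _
  rw [sign, Nat.testBit, Nat.one_and_eq_mod_two]
  rcases Nat.mod_two_eq_zero_or_one (s >>> (i : ℕ)) with h | h <;> rw [h]
  · exact Nat.cast_one
  · exact (show ((16 : ℕ) : ZMod 17) = -1 from rfl)

theorem apply_of_isScaledUnit {X : ℕ → Vec} {c n : ℕ} (hc : c ≤ 16) {i : Fin 352}
    (hn : IsPacked 356 1360 n fun k => X k i) (h : isScaledUnit c i (n >>> 80) = true)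
    (k : Fin 352) : X (k + 4) i = if k = i then (c : ZMod 17) else 0 := by
  obtain ⟨d, hnd, hd, hdx⟩ := hn
  rw [isScaledUnit, forceNat_eq] at h
  replace h := Nat.eq_of_beq_eq_true h
  have hshift : n >>> 80 = pack 352 fun k => d (k + 4) := by
    have hd' : pack 356 d = (d 0 + 1048576 * d 1 + 1048576 ^ 2 * d 2 + 1048576 ^ 3 * d 3) +
        1048576 ^ 4 * pack 352 fun k => d (k + 4) := by
      rw [pack, pack, pack, pack]; ring
    have h0 := hd 0
    have h1 := hd 1
    have h2 := hd 2
    have h3 := hd 3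
    rw [hnd, Nat.shiftRight_eq_div_pow, hd', show 2 ^ 80 = 1048576 ^ 4 by rfl,
      Nat.add_mul_div_left _ _ (by decide), Nat.div_eq_of_lt (by omega), zero_add]
  have hc' : Nat.shiftLeft c (Nat.mul 20 i) = c * 1048576 ^ (i : ℕ) := by
    change c <<< (20 * (i : ℕ)) = _
    rw [Nat.shiftLeft_eq, pow_mul]
    rfl
  rw [hshift] at h
  change _ = Nat.shiftLeft c (Nat.mul 20 i) +
    17 * ((pack 352 (fun k => d (k + 4)) * 241) >>> 12 &&& wideMask) at h
  rw [hc', wideMask_eq, land_slotMask, mul_pack, ← pack_single 356 i c (by omega), pack_add] at h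
  have hk := pack_inj h (fun k => (hd _).trans_lt (by decide)) (fun k => ?_) (k := k) (by omega)
    (by omega)
  · refine (hdx _).symm.trans ?_
    rw [hk]
    push_cast
    rw [show (17 : ZMod 17) = 0 from rfl, zero_mul, add_zero]
    simp only [Fin.ext_iff]
  · have := Nat.mod_lt ((pack 352 (fun k => d (k + 4)) * 241) >>> 12 / 1048576 ^ k)
      (show 0 < 256 by decide)
    split_ifs <;> omega

theorem evalWord_apply_of_isDiagonal {gen : ℕ → List (List (ℕ × ℕ))}
    (hgen : ∀ g, (gen g).all isTame = true) {s : ℕ} {w : List ℕ}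
    (h : isDiagonal s (applyWord wideMask gen w unitRows) = true) (v : Vec) (i : Fin 352) :
    evalWord (fun g => blocksMap (gen g)) w v i = sign s i * v i := by
  obtain ⟨X, hX, hunit⟩ := exists_represents_unitRows
  have hw := hX.applyWord hgen w
  rw [wideMask_eq] at h
  have hentry : ∀ k, evalWord (fun g => blocksMap (gen g)) w (Pi.single k 1) i =
      if k = i then sign s i else 0 := by
    intro k
    have hle : signAt s i ≤ 16 := by
      change 15 * (s >>> (i : ℕ) % 2) + 1 ≤ 16
      omega
    have := apply_of_isScaledUnit hle (hw.rows i) (allBelow_spec h i i.isLt) k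
    rwa [hunit, natCast_signAt] at this
  conv_lhs => rw [← Finset.univ_sum_single v, map_sum, Finset.sum_apply]
  rw [Finset.sum_eq_single i]
  · rw [← mul_one (v i), ← smul_eq_mul (v i), Pi.single_smul', map_smul, Pi.smul_apply, hentry,
      if_pos rfl, smul_eq_mul, smul_eq_mul, mul_one, mul_comm]
  · intro k _ hk
    rw [← mul_one (v k), ← smul_eq_mul (v k), Pi.single_smul', map_smul, Pi.smul_apply, hentry,
      if_neg hk, smul_zero]
  · simp

/-! #### The matrices of the generators

Each block lists row indices together with their coefficients, encoded as in `dotRow`; the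
coordinates are numbered by increasing `signCode`. -/

def minusAt (i : ℕ) : List (ℕ × ℕ) := [(i, 15)]

def blocksA : List (List (ℕ × ℕ)) :=
  List.map minusAt [12, 13, 14, 15, 16, 17, 18, 19, 28, 29, 30, 31, 32, 33, 42, 43, 44, 45, 46,
  47, 52, 53, 54, 55, 64, 65, 66, 67, 68, 69, 76, 77, 84, 85, 90, 91, 92, 93, 94, 95, 104, 105,
  106, 107, 108, 109, 116, 117, 124, 125, 130, 131, 132, 133, 134, 135, 140, 141, 142, 143, 148,
  149, 150, 151, 152, 153, 158, 159, 160, 161, 162, 163, 168, 169, 170, 171, 172, 173, 174, 175,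
  184, 185, 186, 187, 194, 195, 196, 197, 204, 205, 206, 207, 212, 213, 214, 215, 222, 223, 224,
  225, 228, 229, 230, 231, 232, 233, 236, 237, 238, 239, 240, 241, 248, 249, 250, 251, 252, 253,
  254, 255, 262, 263, 264, 265, 268, 269, 270, 271, 272, 273, 276, 277, 278, 279, 280, 281, 288,
  289, 290, 291, 292, 293, 294, 295, 300, 301, 302, 303, 310, 311, 312, 313, 314, 315, 316, 317,
  324, 325, 326, 327, 328, 329, 330, 331, 340, 341, 342, 343, 344, 345, 346, 347, 348, 349, 350,
  351]

def blocksB : List (List (ℕ × ℕ)) :=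
  [[(0, 14714160705121238220), (4, 3729891766689805260), (18, 3730040159698959420), (21,
  3689348817309451059), (24, 14754703654502845491), (31, 3691892026217610300), (39,
  14068344477315812556), (41, 4381091203426075596), (43, 14065801345433875395), (52,
  4340401093155241155), (103, 14108717923405935555), (104, 14108866398536285235), (106,
  4340569282204349235), (113, 4378567785425157315), (118, 14757226994873414460), (126,
  14714328966630224700)], [(1, 3689517081092211660), (5, 14757395258967641292), (17,
  3692040458021883075), (20, 14714160702554950860), (23, 3732415104805553100), (33,
  3729891727893580995), (40, 4337877713969495235), (42, 4340401095429010380), (45,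
  14106174794071489740), (51, 14065801306930164675), (101, 4378567783169078220), (102,
  14068344474748271820), (105, 4381091164610903235), (116, 14108717961909646275), (119,
  14716703875506881475), (127, 14754852085995652035)], [(2, 1145851075), (6, 3142339644), (44,
  3032237004), (46, 3274951884), (114, 3024338124), (115, 3284939724), (133, 3426499644), (135,
  3435381564)], [(3, 3032239299), (19, 1270631484), (22, 1145848780), (32, 868469964), (120,
  1152629964), (125, 3435383859), (128, 1020017724), (134, 3284942019)], [(7,
  3689358751578207180), (10, 14714319653261489100), (12, 14714170639371193395), (15,
  3689507765468580915), (25, 14754861984026247996), (28, 14716693977496339260), (34,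
  14108876255495703756), (37, 4380933492217531596), (50, 14068334001739545660), (53,
  14068186147490415555), (97, 14106185267081395260), (108, 14106333121330594755), (110,
  14108708687346610995), (111, 4381101060366545715), (121, 14754693101617167555), (124,
  14716862859905350851)], [(8, 1145851075), (14, 3142339644), (48, 3032237004), (54, 3274951884),
  (96, 3024338124), (109, 3284939724), (129, 3426499644), (132, 3435381564)], [(9,
  3729891727894133820), (13, 3732415143309266115), (16, 14714160702554950860), (26,
  3689517042588503235), (27, 14757395258967641292), (30, 3692040458022435900), (36,
  4378399598961279795), (38, 14068176252036760380), (47, 14065652909099201475), (49,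
  4338026150304166860), (98, 14106343016784249660), (100, 4340569279638061875), (107,
  14108866359740609475), (112, 4380942728276227020), (122, 14754852047492496435), (130,
  14716703914011147315)], [(11, 1145851075), (29, 3142339644), (35, 3032237004), (55, 3274951884),
  (99, 3024338124), (117, 3284939724), (123, 3426499644), (131, 3435381564)], [(56, 3142339779),
  (58, 1145850940), (71, 1270629324), (74, 1010027724), (159, 1262730444), (161, 1020015564),
  (171, 3435381699), (174, 3426499779)], [(57, 3691892606038193100), (59, 3730039579878372300),
  (67, 3692040460287396915), (68, 3729891725629246515), (70, 14757395258967641292), (73,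
  14714160702554950860), (83, 14068176288275547075), (84, 14106175412396375100), (87,
  4337877097910123715), (90, 4338026111800492860), (139, 4380942766779974460), (140,
  4381091780670274755), (145, 14068343856424565820), (149, 14106342980545463235), (154,
  14714329584963957555), (155, 14757226376558555955)], [(60, 3032239299), (72, 1270631484), (81,
  1145848780), (89, 868469964), (141, 1152629964), (150, 3435383859), (162, 1020017724), (173,
  3284942019)], [(61, 1145851075), (76, 3142339644), (78, 3032237004), (93, 3274951884), (138,
  3024338124), (152, 3284939724), (157, 3426499644), (168, 3435381564)], [(62, 3032239299), (66,
  1270631484), (80, 1145848780), (85, 868469964), (144, 1152629964), (153, 3435383859), (165,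
  1020017724), (170, 3284942019)], [(63, 3032239299), (65, 1270631484), (86, 1145848780), (95,
  868469964), (137, 1152629964), (143, 3435383859), (167, 1020017724), (169, 3284942019)], [(64,
  3142339779), (75, 1145850940), (79, 1270629324), (94, 1010027724), (136, 1262730444), (151,
  1020015564), (158, 3435381699), (166, 3426499779)], [(69, 14714171216634891459), (77,
  3732573434338397244), (82, 3729891148073583564), (88, 14757395258967604428), (91,
  14068175633570319564), (92, 4338025529563991244), (142, 14716852348090368819), (146,
  14108717962051243059), (147, 4378567785585036339), (148, 14757394599260701644), (156,
  14754693758737173564), (160, 4380933489810457539), (163, 14106333703567098819), (164,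
  3692050974357310659), (172, 14065811238773048124), (175, 4340410952521139004)], [(176,
  1145851075), (180, 3142339644), (201, 3032237004), (203, 3274951884), (268, 3024338124), (269,
  3284939724), (291, 3426499644), (293, 3435381564)], [(177, 3032239299), (187, 1270631484), (189,
  1145848780), (197, 868469964), (274, 1152629964), (279, 3435383859), (282, 1020017724), (292,
  3284942019)], [(178, 3142339779), (188, 1145850940), (202, 1270629324), (211, 1010027724), (262,
  1262730444), (270, 1020015564), (281, 3435381699), (295, 3426499779)], [(179, 1145851075), (190,
  3142339644), (204, 3032237004), (212, 3274951884), (261, 3024338124), (267, 3284939724), (280,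
  3426499644), (294, 3435381564)], [(181, 3689517042597901260), (182, 14757395258967641292), (186,
  3691892023943285955), (192, 3730040161954483395), (194, 14714160702554950860), (195,
  3732415143318664140), (198, 14106174794071489740), (199, 4340401056915899340), (205,
  4338026148048092355), (208, 14065652911363572675), (257, 14068344474748271820), (260,
  4378567821663388620), (263, 4380942730550000835), (266, 14108866357475132355), (276,
  14716852348080894915), (284, 14754703613422744515)], [(183, 1145851075), (185, 3142339644),
  (209, 3032237004), (215, 3274951884), (258, 3024338124), (265, 3284939724), (287, 3426499644),
  (288, 3435381564)], [(184, 3142339779), (191, 1145850940), (200, 1270629324), (214, 1010027724),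
  (256, 1262730444), (271, 1020015564), (277, 3435381699), (285, 3426499779)], [(193,
  14757395258967641283), (196, 3689349474448886844), (206, 4378558505889350604), (207,
  14068333999333063884), (210, 3732424381943762124), (213, 14714170600566082764), (259,
  3732425041329796044), (264, 14714171255439963084), (272, 14068334581710570444), (273,
  4378557928625618124), (275, 14757226376558555964), (278, 14757227031111650364), (283,
  14106343016935244604), (286, 4340569279779585084), (289, 14106343599029566524), (290,
  4340568702232806204)], [(216, 3024899267), (226, 1263291452), (237, 1153188812), (249,
  859032780), (297, 1145289932), (307, 869020620), (330, 1010580540), (348, 3275504835)], [(217,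
  3142339779), (218, 1145850940), (229, 1270629324), (232, 1010027724), (318, 1262730444), (320,
  1020015564), (347, 3435381699), (351, 3426499779)], [(219, 3024899267), (222, 1263291452), (242,
  1153188812), (251, 859032780), (296, 1145289932), (302, 869020620), (337, 1010580540), (342,
  3275504835)], [(220, 3024899267), (223, 1263291452), (234, 1153188812), (239, 859032780), (304,
  1145289932), (315, 869020620), (336, 1010580540), (340, 3275504835)], [(221,
  14757385363211996355), (228, 3689359369902541884), (240, 3692040419216769996), (244,
  4378399560306539724), (253, 14716703911755107532), (255, 14106343596755832012), (303,
  14754702994805932851), (306, 4378400214859629516), (313, 14716704493831730124), (316,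
  14106343019208979404), (321, 14065643013494551491), (324, 14108708646124993596), (326,
  14714319070874582076), (335, 14714319653270963004), (339, 14108708068862509884), (343,
  4381101715090060092)], [(224, 14716693979912260803), (227, 3730049439244274748), (241,
  3732415143469695948), (243, 14757395258816609484), (252, 4337877095352093900), (254,
  14065801304353852620), (301, 3732414488594562252), (305, 14757394599411696588), (314,
  4380943346600561715), (317, 14108866395978845235), (322, 4378557928475247555), (323,
  14106185269355201475), (325, 14754693758888168508), (338, 3692050974508305603), (341,
  14068185567669830460), (344, 4340559386448741180)], [(225, 14714171257856511171), (231,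
  3732573475560016956), (238, 3729891107153953740), (245, 4340400474538392780), (246,
  14065801304362699980), (248, 14757394601677212876), (298, 3729891766538812620), (309,
  14757395256551093196), (310, 4340401056915899340), (311, 14065800727100142540), (319,
  14754693101767572540), (327, 14108708648541500355), (329, 4378557928484094915), (332,
  3692050317387709635), (345, 14068185567678677820), (349, 4338036007263548220)], [(230,
  14106185267090869443), (233, 4340559384184409148), (235, 14757395258816644044), (236,
  3689517042446908620), (247, 3732414524842822860), (250, 14714160743767133388), (299,
  14714161321029612492), (300, 14714328966488116275), (308, 14757226376407563315), (312,
  14757394599411662028), (328, 14106333703415516220), (331, 4340410952369556675), (333,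
  4378558544534584515), (334, 14068186183729167420), (346, 14068334620374678723), (350,
  4378410113040596028)]]

def blocksC : List (List (ℕ × ℕ)) :=
  List.map minusAt [96, 97, 98, 99, 100, 101, 102, 103, 104, 105, 106, 107, 108, 109, 110, 111,
  112, 113, 114, 115, 116, 117, 118, 119, 120, 121, 122, 123, 124, 125, 126, 127, 128, 129, 130,
  131, 132, 133, 134, 135, 136, 137, 138, 139, 140, 141, 142, 143, 144, 145, 146, 147, 148, 149,
  150, 151, 152, 153, 154, 155, 156, 157, 158, 159, 160, 161, 162, 163, 164, 165, 166, 167, 168,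
  169, 170, 171, 172, 173, 174, 175, 256, 257, 258, 259, 260, 261, 262, 263, 264, 265, 266, 267,
  268, 269, 270, 271, 272, 273, 274, 275, 276, 277, 278, 279, 280, 281, 282, 283, 284, 285, 286,
  287, 288, 289, 290, 291, 292, 293, 294, 295, 296, 297, 298, 299, 300, 301, 302, 303, 304, 305,
  306, 307, 308, 309, 310, 311, 312, 313, 314, 315, 316, 317, 318, 319, 320, 321, 322, 323, 324,
  325, 326, 327, 328, 329, 330, 331, 332, 333, 334, 335, 336, 337, 338, 339, 340, 341, 342, 343,
  344, 345, 346, 347, 348, 349, 350, 351]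

def blocksD : List (List (ℕ × ℕ)) :=
  [[(0, 14714160702554950860), (3, 3732415104805553100), (4, 3729891764132367420), (7,
  14757395258967641292), (9, 3689517081092211660), (10, 3692040421783096380), (57,
  14065652872859861955), (59, 4378399598961279795), (60, 14068176290540473395), (62,
  4338026148038692035), (97, 14106342978280541235), (98, 4340569279638061875), (100,
  14108866395978843075), (103, 4380942730540600515), (136, 14754852049756865340), (139,
  14716703911745667900)], [(1, 3732414488745594060), (2, 14714160702554950860), (5,
  14757395258967641292), (6, 3689517697150995660), (8, 3729891148073548995), (11,
  3692041037843020995), (56, 14065652872859827260), (58, 4338025531979873340), (61,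
  14068176290540473395), (63, 4378400215020063795), (96, 14106342978280541235), (99,
  4340568663578102835), (101, 14108866395978808380), (102, 4380943346600524860), (137,
  14754852049756830915), (138, 14716703911745633475)], [(12, 3689517697150995660), (13,
  3732414488745594060), (15, 14757395258967641292), (16, 14714160702554950860), (18,
  3729891725629246515), (19, 3692040460287396915), (64, 4338026111800458435), (66,
  14065652293039242435), (67, 4378400217284951100), (68, 14068176288275512380), (104,
  14106342980545428540), (106, 4340568661313141820), (107, 14108866975799393475), (108,
  4380942766779940035), (140, 14754851467671358515), (141, 14716704493831179315)], [(14,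
  1145851075), (17, 3142339644), (65, 3032237004), (69, 3274951884), (105, 3024338124), (109,
  3284939724), (142, 3426499644), (143, 3435381564)], [(20, 3142339779), (23, 1145850940), (71,
  1270629324), (74, 1010027724), (114, 1262730444), (115, 1020015564), (146, 3435381699), (147,
  3426499779)], [(21, 14716862243845979196), (22, 14714170636813716675), (24,
  3730050093958352076), (25, 14757385324707695811), (26, 14754693717676538940), (27,
  3691882091958291660), (70, 14065643015900482620), (72, 4378409455910634300), (73,
  4380932871325695180), (75, 4340410950105222195), (110, 4338036007253523660), (111,
  14108876252919352380), (112, 4340559422687527740), (113, 4378557928475249715), (144,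
  14757236929132807116), (145, 14714319032370906060)], [(28, 3032239299), (30, 1270631484), (31,
  1145848780), (32, 868469964), (149, 1152629964), (150, 3435383859), (151, 1020017724), (153,
  3284942019)], [(29, 3142339779), (33, 1145850940), (76, 1270629324), (77, 1010027724), (116,
  1262730444), (117, 1020015564), (148, 3435381699), (152, 3426499779)], [(34,
  3689348814751939644), (36, 3732414488755618755), (37, 3732583371164630076), (38,
  3689517697161020355), (39, 14754852047501970636), (41, 14716703914020621516), (79,
  4337877677730708675), (80, 14065800727108992195), (81, 4378400217284987955), (83,
  14068176288275549235), (118, 4340568661313178675), (120, 14106342980545465395), (121,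
  14108718541729643715), (122, 4381091200849689795), (154, 14754703033611596595), (155,
  14716852927910916915)], [(35, 3142339779), (40, 1145850940), (78, 1270629324), (82, 1010027724),
  (119, 1262730444), (123, 1020015564), (156, 3435381699), (157, 3426499779)], [(42, 1145851075),
  (44, 3142339644), (45, 3032237004), (46, 3274951884), (159, 3024338124), (160, 3284939724),
  (161, 3426499644), (163, 3435381564)], [(43, 1145851075), (47, 3142339644), (84, 3032237004),
  (85, 3274951884), (124, 3024338124), (125, 3284939724), (158, 3426499644), (162, 3435381564)],
  [(48, 3142339779), (51, 1145850940), (86, 1270629324), (88, 1010027724), (127, 1262730444),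
  (129, 1020015564), (164, 3435381699), (167, 3426499779)], [(49, 3142339779), (50, 1145850940),
  (87, 1270629324), (89, 1010027724), (126, 1262730444), (128, 1020015564), (165, 3435381699),
  (166, 3426499779)], [(52, 3142339779), (53, 1145850940), (90, 1270629324), (94, 1010027724),
  (130, 1262730444), (134, 1020015564), (170, 3435381699), (173, 3426499779)], [(54,
  14757395258967641283), (55, 3689349474448886844), (91, 14068334579153683404), (92,
  4378557926068731084), (93, 4340410333903703244), (95, 14106184648606141644), (131,
  14106185308009870284), (132, 4340410988759888844), (133, 4378558508446237644), (135,
  14068334001889950924), (168, 14757226376558555964), (169, 14757227031111650364), (171,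
  14714329548715736124), (172, 14714328966639108924), (174, 3732582752528941884), (175,
  3732583330093415484)], [(176, 14714160702554950860), (179, 3732415143318664140), (180,
  3730040159689559100), (181, 3691892026208209980), (182, 14757395258967641292), (183,
  3689517042597901260), (216, 14068176252046162995), (217, 4378399598961279795), (218,
  14065801345424475075), (219, 4337877713969495235), (257, 4340569279638061875), (258,
  14106343016793652275), (260, 14108717923396535235), (261, 4381091164610903235), (296,
  14754703615687668540), (297, 14716852345815970620)], [(177, 1145851075), (178, 3142339644),
  (220, 3032237004), (221, 3274951884), (256, 3024338124), (259, 3284939724), (298, 3426499644),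
  (299, 3435381564)], [(184, 1145851075), (187, 3142339644), (223, 3032237004), (225, 3274951884),
  (262, 3024338124), (264, 3284939724), (300, 3426499644), (303, 3435381564)], [(185, 3142339779),
  (186, 1145850940), (222, 1270629324), (224, 1010027724), (263, 1262730444), (265, 1020015564),
  (301, 3435381699), (302, 3426499779)], [(188, 3024899267), (189, 1263291452), (191, 1153188812),
  (193, 859032780), (304, 1145289932), (306, 869020620), (308, 1010580540), (309, 3275504835)],
  [(190, 3142339779), (192, 1145850940), (226, 1270629324), (227, 1010027724), (266, 1262730444),
  (267, 1020015564), (305, 3435381699), (307, 3426499779)], [(194, 3142339779), (195, 1145850940),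
  (229, 1270629324), (232, 1010027724), (268, 1262730444), (269, 1020015564), (314, 3435381699),
  (317, 3426499779)], [(196, 3689349474448886979), (197, 14757395258967641148), (228,
  14754693099352277964), (230, 3732573434338360524), (231, 4338035388787707084), (233,
  14068185565253913804), (270, 14754693758737136844), (271, 4338036043643892684), (272,
  14068186147650221004), (273, 3732572857074697164), (310, 14716852348090332099), (311,
  4380943349016478659), (312, 14106343635268387779), (313, 14716852925636005059), (315,
  14106342980696423619), (316, 4380942766939782339)], [(198, 3142339779), (199, 1145850940), (201,
  1270629324), (203, 1010027724), (318, 1262730444), (320, 1020015564), (322, 3435381699), (323,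
  3426499779)], [(200, 1145851075), (202, 3142339644), (234, 3032237004), (235, 3274951884), (274,
  3024338124), (275, 3284939724), (319, 3426499644), (321, 3435381564)], [(204, 3142339779), (205,
  1145850940), (237, 1270629324), (241, 1010027724), (276, 1262730444), (280, 1020015564), (325,
  3435381699), (330, 3426499779)], [(206, 3732573475560017091), (207, 14714171257856511036), (236,
  14757226412646384588), (238, 3689349433227230412), (239, 14106342980554312908), (240,
  4340568661304331468), (277, 4340569320708060108), (278, 14106343635410498508), (279,
  14757226995023822028), (281, 3689348855963567052), (324, 14714319034796225475), (326,
  3732424384360231740), (327, 4378557926219136060), (328, 14068334001739545660), (329,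
  14068185565413719235), (331, 4378409494405463235)], [(208, 1145851075), (209, 3142339644), (242,
  3032237004), (243, 3274951884), (284, 3024338124), (287, 3284939724), (337, 3426499644), (338,
  3435381564)], [(210, 3689359370053536963), (211, 14757385363362991164), (244,
  14754702994956927948), (245, 3730039543488593100), (246, 14068176249478696140), (247,
  4340568699808042188), (282, 14754703654341786828), (283, 3730040198343672780), (285,
  4340569282204349388), (286, 14068175672216138700), (332, 4337867199898401852), (333,
  4380932873600091075), (334, 14714319689359307715), (335, 14714319034786237635), (336,
  14108876291734453443), (339, 4380933451146869955)], [(212, 14754693758898195651), (215,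
  3692050974518332476), (249, 3689348814902969292), (251, 14108718541730233548), (252,
  4378567821672828108), (254, 14716852309426228428), (288, 3689349474287828172), (291,
  14716852964300108748), (293, 4378568404051440588), (294, 14108717964466570188), (341,
  3732573472983663555), (342, 4340410372558959555), (344, 14065811202383266755), (347,
  14714171255280157500), (348, 14106333123604919100), (351, 4380933453420675900)], [(213,
  3689349474448886979), (214, 14757395258967641148), (248, 4340410370143077324), (250,
  14106185266939837644), (253, 14714319032379755724), (255, 3732572818269588684), (289,
  14714319691765789644), (290, 3732573473143469004), (292, 4340410952520514764), (295,
  14106184689676174284), (340, 14757227031111650499), (343, 14757226376558556099), (345,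
  4378567824088710339), (346, 14068344477173662659), (349, 14068343895079271619), (350,
  4378568401635558339)]]

def blocksE : List (List (ℕ × ℕ)) :=
  List.map minusAt [56, 57, 58, 59, 60, 61, 62, 63, 64, 65, 66, 67, 68, 69, 70, 71, 72, 73, 74,
  75, 76, 77, 78, 79, 80, 81, 82, 83, 84, 85, 86, 87, 88, 89, 90, 91, 92, 93, 94, 95, 136, 137,
  138, 139, 140, 141, 142, 143, 144, 145, 146, 147, 148, 149, 150, 151, 152, 153, 154, 155, 156,
  157, 158, 159, 160, 161, 162, 163, 164, 165, 166, 167, 168, 169, 170, 171, 172, 173, 174, 175,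
  216, 217, 218, 219, 220, 221, 222, 223, 224, 225, 226, 227, 228, 229, 230, 231, 232, 233, 234,
  235, 236, 237, 238, 239, 240, 241, 242, 243, 244, 245, 246, 247, 248, 249, 250, 251, 252, 253,
  254, 255, 296, 297, 298, 299, 300, 301, 302, 303, 304, 305, 306, 307, 308, 309, 310, 311, 312,
  313, 314, 315, 316, 317, 318, 319, 320, 321, 322, 323, 324, 325, 326, 327, 328, 329, 330, 331,
  332, 333, 334, 335, 336, 337, 338, 339, 340, 341, 342, 343, 344, 345, 346, 347, 348, 349, 350,
  351]

def blocksF : List (List (ℕ × ℕ)) :=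
  [[(0, 1145851075), (4, 3142339644), (71, 3032237004), (74, 3274951884), (201, 3024338124), (203,
  3284939724), (245, 3426499644), (246, 3435381564)], [(1, 14754693717667136460), (5,
  3691882089693367500), (25, 14757385324708248771), (34, 14716862243836576716), (37,
  3730050096223276236), (51, 14714170636814269635), (61, 14106184651021470915), (70,
  4337867820780801075), (73, 14108708068720952115), (83, 14068186147490380860), (181,
  14065811200118932275), (182, 4381101057799670835), (189, 14068334617798364355), (208,
  14106333121330560060), (216, 14714319034644679740), (234, 14757236926876732476)], [(2,
  3689517697150995660), (6, 3732414488745594060), (26, 14714160702554950860), (27,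
  14757395258967641292), (36, 3729891725629246515), (38, 3692040460287396915), (63,
  14065801306920764355), (72, 4337877097919005635), (81, 14106175412405257020), (86,
  4340401093155275580), (183, 4378567785425191740), (188, 14068343856433447740), (202,
  4381091780679156675), (209, 14108717961900245955), (217, 14716704493831179315), (218,
  14754851467671358515)], [(3, 1145851075), (35, 3142339644), (62, 3032237004), (82, 3274951884),
  (190, 3024338124), (210, 3284939724), (227, 3426499644), (247, 3435381564)], [(7,
  14757395258967641292), (10, 3732414488745594060), (20, 3689517697150995660), (23,
  14714160702554950860), (40, 3691892023952720700), (50, 3730040161963918140), (57,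
  14065800727100142540), (59, 4337877677739553740), (78, 4378400215011179580), (87,
  14068176290549283900), (177, 4340568663569218620), (192, 14106342978289351740), (198,
  14108718541720794060), (199, 4381091200858534860), (220, 14754703035866530620), (226,
  14716852925636002620)], [(8, 3691892026217610300), (21, 3689348814742539459), (24,
  14757227031121677516), (39, 3732583371155229891), (41, 14714328930400914636), (48,
  3730040159698959420), (56, 4340401056925926195), (58, 14106174794072113980), (75,
  4338026150303616060), (79, 14065652909098650675), (176, 14068344474748896060), (180,
  4378567821673415475), (191, 4380942728275676220), (200, 14108866359740058675), (219,
  14716852345815972915), (242, 14754703615687670835)], [(9, 1145851075), (49, 3142339644), (60,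
  3032237004), (89, 3274951884), (178, 3024338124), (211, 3284939724), (221, 3426499644), (244,
  3435381564)], [(11, 3142339779), (22, 1145850940), (80, 1270629324), (88, 1010027724), (179,
  1262730444), (193, 1020015564), (235, 3435381699), (243, 3426499779)], [(12,
  3692040421774246860), (15, 14757395258967641292), (33, 3689517078836137155), (42,
  14714160702554950860), (45, 3729891764123517900), (53, 3732415107079326915), (67,
  14106174794071489740), (68, 4337877677739553740), (76, 4340401093155241155), (90,
  14065801345433875395), (187, 4378567785425157315), (194, 14068344474748271820), (195,
  4381091200858534860), (205, 14108717923405935555), (223, 14716703914010592195), (237,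
  14754852047491941315)], [(13, 3142339779), (16, 1145850940), (44, 1270629324), (46, 1010027724),
  (229, 1262730444), (232, 1020015564), (253, 3435381699), (255, 3426499779)], [(14, 3142339779),
  (31, 1145850940), (43, 1270629324), (54, 1010027724), (222, 1262730444), (231, 1020015564),
  (238, 3435381699), (251, 3426499779)], [(17, 3142339779), (28, 1145850940), (84, 1270629324),
  (93, 1010027724), (186, 1262730444), (197, 1020015564), (239, 3435381699), (249, 3426499779)],
  [(18, 1145851075), (52, 3142339644), (64, 3032237004), (94, 3274951884), (184, 3024338124),
  (214, 3284939724), (225, 3426499644), (248, 3435381564)], [(19, 1145851075), (29, 3142339644),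
  (66, 3032237004), (77, 3274951884), (204, 3024338124), (213, 3284939724), (241, 3426499644),
  (250, 3435381564)], [(30, 1145851075), (47, 3142339644), (65, 3032237004), (95, 3274951884),
  (185, 3024338124), (215, 3284939724), (228, 3426499644), (240, 3435381564)], [(32,
  14757395258967641283), (55, 3689349474448886844), (69, 3692050314972414924), (85,
  14714171216634854604), (91, 4378557889829391564), (92, 14108708066295598284), (196,
  3692050974357273804), (206, 4378558544685577164), (207, 14108708648691905484), (212,
  14714170639371191244), (224, 14716852925636004924), (230, 4380942730692148284), (233,
  14106343016944057404), (236, 14716852348090331964), (252, 14106343599020753724), (254,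
  4380943385264112444)], [(96, 3142339779), (113, 1145850940), (118, 1270629324), (129,
  1010027724), (296, 1262730444), (309, 1020015564), (319, 3435381699), (337, 3426499779)], [(97,
  1145851075), (119, 3142339644), (139, 3032237004), (157, 3274951884), (266, 3024338124), (282,
  3284939724), (307, 3426499644), (336, 3435381564)], [(98, 1145851075), (100, 3142339644), (114,
  3032237004), (115, 3274951884), (318, 3024338124), (320, 3284939724), (335, 3426499644), (339,
  3435381564)], [(99, 3142339779), (120, 1145850940), (144, 1270629324), (164, 1010027724), (261,
  1262730444), (275, 1020015564), (308, 3435381699), (338, 3426499779)], [(101,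
  3732414488745594060), (102, 14714160702554950860), (110, 3689517697150995660), (111,
  14757395258967641292), (121, 3729891727894168515), (127, 3692040458022470595), (138,
  14065652293039276860), (145, 4338026111800492860), (154, 4378400215020063795), (155,
  14068176290540473395), (257, 14106342978280541235), (260, 4340568663578102835), (274,
  14108866975799427900), (284, 4380942766779974460), (297, 14754851469936280515), (304,
  14716704491566252995)], [(103, 1145851075), (126, 3142339644), (136, 3032237004), (166,
  3274951884), (256, 3024338124), (285, 3284939724), (298, 3426499644), (332, 3435381564)], [(104,
  1145851075), (106, 3142339644), (159, 3032237004), (161, 3274951884), (268, 3024338124), (269,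
  3284939724), (345, 3426499644), (349, 3435381564)], [(105, 1145851075), (124, 3142339644), (149,
  3032237004), (168, 3274951884), (263, 3024338124), (279, 3284939724), (315, 3426499644), (348,
  3435381564)], [(107, 3142339779), (130, 1145850940), (141, 1270629324), (173, 1010027724), (262,
  1262730444), (295, 1020015564), (303, 3435381699), (343, 3426499779)], [(108, 1145851075), (116,
  3142339644), (140, 3032237004), (152, 3274951884), (276, 3024338124), (292, 3284939724), (330,
  3426499644), (340, 3435381564)], [(109, 14757395258967641283), (132, 3689349474448886844), (151,
  3692050314972414924), (158, 4378409455760194764), (171, 14108708646125030604), (174,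
  14714319070874619084), (271, 3692050974357273804), (277, 4378410110615274444), (291,
  14714319653270926284), (293, 14108708068862473164), (302, 4381091164761345084), (310,
  14716703911755070524), (311, 14106343596755795004), (327, 14716704493831766844), (329,
  14106343019209016124), (342, 4381091819334415164)], [(112, 3024899267), (122, 1263291452), (137,
  1153188812), (167, 859032780), (258, 1145289932), (287, 869020620), (306, 1010580540), (321,
  3275504835)], [(117, 3689349474448886979), (134, 14757395258967641148), (148,
  14754693099352277964), (160, 4340410949963627724), (163, 14065810620146765004), (170,
  3732572818269588684), (264, 14754693758737136844), (280, 3732573473143469004), (289,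
  14065811202525377484), (290, 4340410372699964364), (300, 14716852964140303299), (314,
  14108717964325565379), (317, 4378568403909329859), (325, 14716852309586033859), (346,
  14108718541871238339), (350, 4378567821814938819)], [(123, 3689359370053536963), (128,
  14757385363362991164), (146, 14068176249479283660), (147, 4378399596394331340), (156,
  14714328927984405708), (165, 3732582713874238668), (259, 14714329587370439628), (267,
  3732583368748118988), (283, 4378400178771837900), (286, 14068175672215551180), (299,
  3689507146993251132), (305, 14757236272163206083), (322, 14106333703424916675), (323,
  4340558806628156355), (333, 14106333121330594755), (334, 4340559384174935235)], [(125,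
  14757385363362991299), (131, 3689359370053536828), (142, 3732414524843410380), (153,
  14714161321030204620), (172, 14106342978289388748), (175, 4340568663569255628), (272,
  14106343637675422668), (273, 4340569318443135948), (278, 3732415107220847820), (294,
  14714160743766541260), (301, 3689507146993251267), (312, 14757236272163205948), (328,
  4378557928484060220), (331, 14068333999474621500), (341, 14068334581569012540), (344,
  4378558506030908220)], [(133, 14068334620375305411), (135, 4378410113041222716), (143,
  3732415104663995340), (150, 14714160741209619660), (162, 14757394601686060236), (169,
  3689517040172584140), (265, 3689517699576312780), (270, 14757395256542245836), (281,
  14714161323587126220), (288, 3732414527400262860), (313, 4378557889980937155), (316,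
  14068185529175520060), (324, 14106333703416069180), (326, 4340410952370109635), (347,
  14106184689525769155), (351, 4340558806619308860)]]

def blocksG : List (List (ℕ × ℕ)) :=
  List.map minusAt [176, 177, 178, 179, 180, 181, 182, 183, 184, 185, 186, 187, 188, 189, 190,
  191, 192, 193, 194, 195, 196, 197, 198, 199, 200, 201, 202, 203, 204, 205, 206, 207, 208, 209,
  210, 211, 212, 213, 214, 215, 216, 217, 218, 219, 220, 221, 222, 223, 224, 225, 226, 227, 228,
  229, 230, 231, 232, 233, 234, 235, 236, 237, 238, 239, 240, 241, 242, 243, 244, 245, 246, 247,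
  248, 249, 250, 251, 252, 253, 254, 255, 256, 257, 258, 259, 260, 261, 262, 263, 264, 265, 266,
  267, 268, 269, 270, 271, 272, 273, 274, 275, 276, 277, 278, 279, 280, 281, 282, 283, 284, 285,
  286, 287, 288, 289, 290, 291, 292, 293, 294, 295, 296, 297, 298, 299, 300, 301, 302, 303, 304,
  305, 306, 307, 308, 309, 310, 311, 312, 313, 314, 315, 316, 317, 318, 319, 320, 321, 322, 323,
  324, 325, 326, 327, 328, 329, 330, 331, 332, 333, 334, 335, 336, 337, 338, 339, 340, 341, 342,
  343, 344, 345, 346, 347, 348, 349, 350, 351]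

def blocksH : List (List (ℕ × ℕ)) :=
  List.map minusAt [2, 3, 6, 9, 11, 13, 16, 19, 22, 26, 27, 29, 30, 32, 35, 36, 38, 44, 46, 47,
  49, 55, 60, 62, 63, 65, 66, 69, 72, 77, 80, 81, 82, 85, 86, 88, 89, 91, 92, 95, 98, 99, 100,
  107, 112, 114, 115, 117, 120, 122, 123, 125, 128, 130, 131, 133, 134, 135, 137, 141, 142, 143,
  144, 146, 147, 148, 150, 153, 156, 160, 162, 163, 164, 165, 167, 169, 170, 172, 173, 175, 178,
  179, 183, 185, 188, 190, 193, 196, 202, 204, 206, 207, 209, 210, 211, 212, 213, 215, 217, 218,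
  221, 224, 227, 228, 229, 230, 232, 233, 235, 236, 240, 241, 243, 244, 247, 250, 252, 253, 254,
  255, 258, 259, 261, 262, 264, 265, 267, 270, 272, 273, 275, 278, 280, 281, 283, 286, 287, 288,
  289, 290, 294, 295, 299, 300, 301, 303, 305, 306, 308, 312, 313, 314, 316, 317, 318, 320, 321,
  322, 323, 324, 325, 326, 328, 331, 333, 334, 335, 338, 339, 341, 343, 344, 346, 347, 350, 351]

def blocksI : List (List (ℕ × ℕ)) :=
  [[(0, 4380943346600559420), (1, 4337877677730708675), (2, 14108718541729643715), (3,
  14065652872859861820), (10, 14068343856424563660), (11, 4340568661313178675), (23,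
  3732414488755618755), (24, 14757395258957611971), (25, 3691892026207580979), (26,
  3692041040097955020), (37, 14716703914020621516), (38, 14716852927910916915), (39,
  3732583371164630076), (40, 14757226376548531260), (48, 4378567785434002380), (49,
  14106342980545465395)], [(4, 14108876252919352380), (5, 14106184651022023875), (6,
  4338036007253523660), (7, 4378409455910634300), (8, 4381101057809068995), (9,
  14065811202383856435), (20, 3692050356033012675), (21, 14757385324707695811), (22,
  14754861981751259955), (27, 3732425041338645555), (34, 3730050093958352076), (35,
  14716862243845979196), (36, 3732573436895834940), (41, 14757236929132807116), (50,
  4378557928475249715), (51, 14106333123604329420)], [(12, 1145851075), (13, 3142339644), (31,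
  3032237004), (32, 3274951884), (45, 3024338124), (46, 3284939724), (54, 3426499644), (55,
  3435381564)], [(14, 3689517081092211660), (15, 14757395258967641292), (16, 3691892023952686275),
  (17, 3732415104805553100), (18, 14714160702554950860), (19, 3730040161963883715), (28,
  4338026148038692035), (29, 4340401095429010380), (30, 14106174794071489740), (33,
  14065652872859861955), (42, 14068344474748271820), (43, 4378567783169078220), (44,
  4380942730540600515), (47, 14108866395978843075), (52, 14716852309577184195), (53,
  14754703651926455235)], [(56, 3032239299), (57, 1270631484), (73, 1145848780), (74, 868469964),
  (81, 1152629964), (82, 3435383859), (88, 1020017724), (89, 3284942019)], [(58,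
  4340401056915899340), (59, 14106174794071489740), (60, 4337877713969495235), (61,
  14065652909098648380), (62, 14068176252046162995), (63, 4378399598961279795), (70,
  14757395258967641292), (71, 3689517042597901260), (72, 3692040458021883075), (75,
  3730040159689559100), (78, 14714328930390887475), (79, 3732583371154600755), (80,
  14716852345815970620), (83, 14754852047501341635), (86, 4380942728285076540), (87,
  14108717923396535235)], [(64, 3032239299), (65, 1270631484), (68, 1145848780), (69, 868469964),
  (90, 1152629964), (91, 3435383859), (94, 1020017724), (95, 3284942019)], [(66, 3142339779), (67,
  1145850940), (76, 1270629324), (77, 1010027724), (84, 1262730444), (85, 1020015564), (92,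
  3435381699), (93, 3426499779)], [(96, 4337877097910158140), (97, 14065652293039242435), (98,
  4338026111800458435), (99, 14065801306929611580), (102, 14068176288275512380), (103,
  4340401093164123075), (111, 14757395258967641292), (112, 3732414488745594060), (113,
  3730039579878372300), (114, 3729891725629246515), (119, 14754703613422154700), (120,
  14754851467671358515), (121, 14757226376558555955), (122, 3732583371154600755), (126,
  4340568661313141820), (127, 14068343856424600515)], [(100, 3032239299), (101, 1270631484), (110,
  1145848780), (115, 868469964), (118, 1152629964), (123, 3435383859), (128, 1020017724), (129,
  3284942019)], [(104, 1145851075), (105, 3142339644), (108, 3032237004), (109, 3274951884), (130,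
  3024338124), (131, 3284939724), (134, 3426499644), (135, 3435381564)], [(106, 1145851075), (107,
  3142339644), (116, 3032237004), (117, 3274951884), (124, 3024338124), (125, 3284939724), (132,
  3426499644), (133, 3435381564)], [(136, 3024927939), (137, 1263320124), (145, 1153217484), (146,
  3435971379), (155, 1145261260), (156, 869057484), (166, 1010617404), (167, 3275541699)], [(138,
  3024927939), (139, 1263320124), (144, 1153217484), (147, 3435971379), (154, 1145261260), (157,
  869057484), (164, 1010617404), (165, 3275541699)], [(140, 3024927939), (141, 1263320124), (149,
  1153217484), (150, 3435971379), (159, 1145261260), (160, 869057484), (174, 1010617404), (175,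
  3275541699)], [(142, 14714171257855882179), (143, 3732573475559387964), (148,
  14716852966556222259), (151, 4378567824230857779), (152, 14108718544287157299), (153,
  14757394601676583884), (158, 3729891766539437004), (161, 14757395256551722188), (162,
  4338026111799905484), (163, 14068175672216141004), (168, 14754693101768196924), (169,
  4380932873600093379), (170, 14106333703425506499), (171, 3692050317388334019), (172,
  14065810622562683964), (173, 4340410952379546684)], [(176, 3691892023952720700), (177,
  3692041037843020995), (178, 3729891148073548995), (179, 3730040161963918140), (182,
  14757395258967641292), (183, 14714160702554950860), (189, 14106175410131448780), (190,
  14068176290540473395), (191, 4338025531979873340), (192, 4337877677730743235), (199,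
  4380943346600524860), (200, 4381091200849724355), (201, 14068343858689487820), (202,
  14106342978280541235), (208, 14714329584963957555), (209, 14757226376558555955)], [(180,
  3142339779), (181, 1145850940), (188, 1270629324), (193, 1010027724), (198, 1262730444), (203,
  1020015564), (210, 3435381699), (211, 3426499779)], [(184, 3032239299), (185, 1270631484), (195,
  1145848780), (196, 868469964), (205, 1152629964), (206, 3435383859), (214, 1020017724), (215,
  3284942019)], [(186, 3032239299), (187, 1270631484), (194, 1145848780), (197, 868469964), (204,
  1152629964), (207, 3435383859), (212, 1020017724), (213, 3284942019)], [(216, 3142339779), (217,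
  1145850940), (220, 1270629324), (221, 1010027724), (242, 1262730444), (243, 1020015564), (246,
  3435381699), (247, 3426499779)], [(218, 1145851075), (219, 3142339644), (226, 3032237004), (227,
  3274951884), (234, 3024338124), (235, 3284939724), (244, 3426499644), (245, 3435381564)], [(222,
  3032239299), (223, 1270631484), (229, 1145848780), (230, 868469964), (237, 1152629964), (238,
  3435383859), (254, 1020017724), (255, 3284942019)], [(224, 4378558505889352899), (225,
  14068186145083935804), (228, 14065800726958621644), (231, 4337877095503641804), (232,
  14757395258967051468), (233, 3732414488746183884), (236, 4380942769205330739), (239,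
  14108866396130393139), (240, 14714328930391477299), (241, 14757394599261254604), (248,
  14716694634616898499), (249, 14754693758737726524), (250, 14106185269506749379), (251,
  4340559386600289084), (252, 3730050093948912444), (253, 3692050974357863619)], [(256,
  3142339779), (257, 1145850940), (258, 1270629324), (259, 1010027724), (284, 1262730444), (285,
  1020015564), (286, 3435381699), (287, 3426499779)], [(260, 1145851075), (261, 3142339644), (266,
  3032237004), (267, 3274951884), (274, 3024338124), (275, 3284939724), (282, 3426499644), (283,
  3435381564)], [(262, 3032239299), (263, 1270631484), (268, 1145848780), (273, 868469964), (276,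
  1152629964), (281, 3435383859), (290, 1020017724), (291, 3284942019)], [(264,
  14068334579153685699), (265, 4378410071819603004), (269, 14757395258967638988), (270,
  3689517042597903564), (271, 3732414524993817804), (272, 14714160743616138444), (277,
  3732582752528944179), (278, 14714328966639111219), (279, 14757226376558558259), (280,
  14757394599260667084), (288, 4378558508446239939), (289, 14068186147640822844), (292,
  14106333739805850684), (293, 4340410988759891139), (294, 14106185308009872579), (295,
  4340559425103412284)], [(296, 3024899267), (297, 1263291452), (304, 1153188812), (309,
  859032780), (318, 1145289932), (323, 869020620), (334, 1010580540), (335, 3275504835)], [(298,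
  3732582750264020163), (299, 14714160741351214140), (305, 4378558546950538188), (306,
  14068333963084840140), (307, 14757236890628508876), (308, 14757384744877634355), (319,
  14757236308250997708), (320, 14757385322141371443), (321, 4378557887564430540), (322,
  4378409455750757427), (332, 3732415104805516092), (333, 3732414527258741820), (336,
  14106342980705895228), (337, 4340569320859647036), (338, 14106175412556807363), (339,
  4340400438450635715)], [(300, 14754852088571966259), (301, 14754851428866247731), (310,
  14757236929132807107), (315, 3730049477889506499), (316, 4340559422829087939), (317,
  4381101096453747516), (324, 3689507803962852156), (329, 14106185305735547964), (330,
  4381101678851312700), (331, 14716694018557492284), (342, 3732414527258741811), (343,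
  4378399596545360844), (344, 4337877713827937331), (345, 14714328968904035532), (346,
  14108867014454688972), (347, 4378400178620808396)], [(302, 14757236929132809267), (303,
  14757236269746697011), (311, 3732582750264017724), (312, 14714329546450811964), (313,
  4378399560296549436), (314, 4378568442705556419), (325, 4378567783018712259), (326,
  4378400214869619516), (327, 3732583332358339644), (328, 14714328968904033084), (340,
  14757385360946482380), (341, 3689359367637027891), (348, 14106184687109225676), (349,
  4340410372709956812), (350, 14106185269506786252), (351, 4340410949953635276)]]

/-- The matrices of the twisted generators. -/
def blocksOf (g : ℕ) : List (List (ℕ × ℕ)) :=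
  Nat.rec blocksA (fun g _ => Nat.rec blocksB (fun g _ => Nat.rec blocksC (fun g _ =>
    Nat.rec blocksD (fun g _ => Nat.rec blocksE (fun g _ => Nat.rec blocksF (fun g _ =>
    Nat.rec blocksG (fun g _ => Nat.rec blocksH (fun g _ =>
    Nat.rec blocksI (fun _ _ => []) g) g) g) g) g) g) g) g) g

theorem isTame_blocksOf (g : ℕ) : (blocksOf g).all isTame = true := by
  match g with
  | 0 => decide +kernel
  | 1 => decide +kernel
  | 2 => decide +kernel
  | 3 => decide +kernel
  | 4 => decide +kernel
  | 5 => decide +kernel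
  | 6 => decide +kernel
  | 7 => decide +kernel
  | 8 => decide +kernel
  | _ + 9 => rfl

/-- The word `w` acts diagonally, with signs given by the bits of `s`. -/
def actsDiagonally (s : ℕ) (w : List ℕ) : Bool :=
  isDiagonal s (applyWord wideMask blocksOf w unitRows)

/-- Pairs of generators together with the order of their product. -/
def pairOrders : List (ℕ × ℕ × ℕ) :=
  [(1, 0, 3), (1, 2, 3), (1, 3, 2), (1, 4, 2), (1, 5, 2), (1, 6, 2), (1, 7, 2), (1, 8, 2), (2, 0,
  2), (3, 0, 2), (3, 2, 3), (3, 4, 3), (3, 5, 2), (3, 6, 2), (3, 7, 3), (3, 8, 2), (4, 0, 2), (4,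
  2, 2), (5, 0, 2), (5, 2, 2), (5, 4, 3), (5, 6, 3), (5, 7, 2), (5, 8, 2), (6, 0, 2), (6, 2, 2),
  (6, 4, 2), (7, 0, 2), (7, 2, 2), (7, 4, 2), (7, 6, 2), (8, 0, 2), (8, 2, 2), (8, 4, 2), (8, 6,
  2), (8, 7, 3)]

set_option maxHeartbeats 0 in
theorem actsDiagonally_involutions :
    ([0, 1, 2, 3, 4, 5, 6, 7, 8].all fun x => actsDiagonally 0 [x, x]) = true := by
  decide +kernel

set_option maxHeartbeats 0 in
theorem actsDiagonally_pairs :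
    (pairOrders.all fun p => actsDiagonally 0 (repeatWord p.2.2 [p.1, p.2.1])) = true := by
  decide +kernel

set_option maxHeartbeats 0 in
theorem actsDiagonally_relatorS : actsDiagonally 0
    (repeatWord 10 [8, 7, 3, 5, 4, 3, 1, 2, 3]) = true := by
  decide +kernel

set_option maxHeartbeats 0 in
theorem actsDiagonally_relatorA : actsDiagonally 0
    (repeatWord 9 [7, 5, 4, 3, 2, 1, 0]) = true := by
  decide +kernel

set_option maxHeartbeats 0 in
theorem actsDiagonally_relatorG : actsDiagonally (2 ^ 352 - 1)
    (repeatWord 9 [7, 6, 5, 4, 3, 2, 1]) = true := by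
  decide +kernel

/-- Words that act diagonally, together with their signs. -/
def diagonalWords : List (List ℕ × ℕ) :=
  [([3, 7, 4, 2, 3, 2, 4, 7, 3],
  6136190484517415087408647110708259604186445958134338641529318695342556732100597480223913485568311248065322),
  ([7],
  7370567689940322163960593686779445171386753096878636172029544828373885171612155667838866416983619295324748),
  ([8, 7, 3, 4, 2, 3, 7, 8, 5, 4, 1, 2, 3, 7, 6, 5, 4, 3, 2, 0, 1, 0, 2, 3, 4, 5, 6, 7, 3, 2, 1,
  4, 5, 8, 7, 3, 2, 4, 3, 7, 8],
  8665475300656333425677029749456773773270047659026676227651641349011971536663513937926025362585401765776496),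
  ([5, 4, 1, 2, 3, 7, 6, 5, 4, 3, 2, 0, 1, 0, 2, 3, 4, 5, 6, 7, 3, 2, 1, 4, 5],
  9104500890949123065830241602070600548953551580455129532894715244748120638912871533853565019236826837028736),
  ([0],
  9171763434577156316051072869205579552781787433996352321427402738709202887147248330466083371089548285046784),
  ([1, 2, 3, 7, 4, 3, 2, 0, 1, 0, 2, 3, 4, 7, 3, 2, 1],
  9173985715491351208107200341103418596959606287106723445100301511827712710051071633069933012966608244572160),
  ([5, 4, 3, 7, 6, 5, 4, 2, 3, 2, 4, 5, 6, 7, 3, 4, 5],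
  9173994463426289414777774227429323763035430457167539289767613757704530205348808538334355643078516079067136),
  ([4],
  9173994463960285919128535060418759460645615314218891952836542047283203515293490994985514281077279408783360),
  ([2],
  9173994463960286046443283581092555673948943761249553605722638753812475167084908636972426340266191209103360),
  ([6],
  9173994463960286046443283581208347763186259956673124399169384053429637856957250035385750236269307609743360)]

set_option maxHeartbeats 0 in
theorem actsDiagonally_diagonalWords :
    (diagonalWords.all fun p => actsDiagonally p.2 p.1) = true := by
  decide +kernel

/-- The signs of the diagonal words at a coordinate, collected into a number. -/
def signCode (i : ℕ) : ℕ := diagonalWords.foldr (fun p c => 2 * c + (p.2 >>> i) % 2) 0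

theorem signCode_lt_succ :
    ((List.range 351).all fun i => Nat.blt (signCode i) (signCode (i + 1))) = true := by
  decide +kernel

/-- Entry of the matrix described by a trie that was obtained from `unitRows`. -/
def entry (t : Trie) (i j : ℕ) : ℕ :=
  Nat.mod (Nat.mod (Nat.shiftRight (t.row i) (20 * (j + 4))) 1048576) 17

/-- Pairs of coordinates that are linked by nonzero entries of the matrix of a generator. -/
def links : List (ℕ × List (ℕ × ℕ)) :=
  [(1, [(0, 4), (1, 5), (7, 12), (9, 13), (8, 14), (7, 15), (9, 16), (1, 17), (0, 18), (3, 19),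
  (1, 20), (0, 21), (3, 22), (0, 24), (7, 28), (11, 29), (9, 30), (0, 31), (3, 32), (1, 33), (0,
  39), (0, 41), (1, 42), (0, 43), (2, 44), (1, 45), (2, 46), (9, 47), (1, 51), (0, 52), (7, 53),
  (8, 54), (11, 55), (1, 101), (1, 102), (0, 103), (0, 104), (1, 105), (0, 106), (9, 107), (7,
  108), (8, 109), (7, 110), (7, 111), (9, 112), (0, 113), (2, 114), (2, 115), (1, 116), (11, 117),
  (0, 118), (1, 119), (3, 120), (7, 121), (9, 122), (11, 123), (7, 124), (3, 125), (0, 126), (1,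
  127), (3, 128), (8, 129), (9, 130), (11, 131), (8, 132), (2, 133), (3, 134), (2, 135)]), (3,
  [(0, 3), (1, 6), (0, 7), (1, 8), (0, 9), (0, 10), (1, 56), (0, 57), (1, 58), (0, 59), (0, 60),
  (1, 61), (0, 62), (1, 63), (12, 64), (14, 65), (12, 66), (12, 67), (12, 68), (14, 69), (1, 96),
  (0, 97), (0, 98), (1, 99), (0, 100), (0, 136), (1, 137), (1, 138), (0, 139), (12, 140), (12,
  141), (14, 142), (14, 143), (21, 144), (21, 145), (20, 146), (20, 147), (29, 148), (28, 149),
  (28, 150), (28, 151), (29, 152), (28, 153), (34, 154), (34, 155), (35, 156), (35, 157), (43,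
  158), (42, 159), (42, 160), (42, 161), (43, 162), (42, 163), (48, 164), (49, 165), (49, 166),
  (48, 167), (54, 168), (54, 169), (52, 170), (54, 171), (54, 172), (52, 173), (54, 174), (54,
  175)]), (5, [(2, 27), (1, 34), (3, 35), (2, 36), (1, 70), (0, 71), (2, 72), (1, 73), (0, 74),
  (8, 75), (12, 76), (19, 77), (7, 78), (8, 79), (11, 80), (2, 81), (3, 82), (1, 83), (17, 84),
  (32, 85), (2, 86), (7, 87), (11, 88), (9, 89), (12, 90), (32, 91), (32, 92), (17, 93), (18, 94),
  (30, 95), (8, 176), (7, 177), (9, 178), (11, 179), (8, 180), (1, 181), (1, 182), (2, 183), (18,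
  184), (30, 185), (17, 186), (12, 187), (2, 188), (1, 189), (3, 190), (8, 191), (7, 192), (11,
  193), (12, 194), (12, 195), (32, 196), (17, 197), (7, 198), (7, 199), (8, 200), (0, 201), (2,
  202), (0, 203), (19, 204), (12, 205), (32, 206), (32, 207), (1, 208), (2, 209), (3, 210), (9,
  211), (32, 212), (19, 213), (18, 214), (30, 215), (1, 216), (2, 217), (2, 218), (8, 219), (7,
  220), (9, 221), (14, 222), (12, 223), (32, 224), (18, 225), (7, 226), (3, 227), (30, 228), (13,
  229), (32, 230), (14, 231), (13, 232), (32, 233), (1, 234), (11, 235), (32, 236), (12, 237),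
  (14, 238), (17, 239), (30, 240), (19, 241), (8, 242), (11, 243), (9, 244), (0, 245), (0, 246),
  (3, 247), (18, 248), (17, 249), (19, 250), (14, 251), (32, 252), (13, 253), (32, 254), (13,
  255), (103, 256), (101, 257), (112, 258), (123, 259), (101, 260), (99, 261), (107, 262), (105,
  263), (117, 264), (133, 265), (97, 266), (123, 267), (104, 268), (104, 269), (133, 270), (109,
  271), (125, 272), (125, 273), (101, 274), (99, 275), (108, 276), (109, 277), (125, 278), (105,
  279), (117, 280), (133, 281), (97, 282), (123, 283), (101, 284), (103, 285), (123, 286), (112,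
  287), (133, 288), (117, 289), (117, 290), (109, 291), (108, 292), (109, 293), (125, 294), (107,
  295), (96, 296), (101, 297), (103, 298), (123, 299), (117, 300), (125, 301), (109, 302), (107,
  303), (101, 304), (123, 305), (112, 306), (97, 307), (99, 308), (96, 309), (109, 310), (109,
  311), (125, 312), (133, 313), (117, 314), (105, 315), (133, 316), (117, 317), (98, 318), (96,
  319), (98, 320), (112, 321), (123, 322), (123, 323), (133, 324), (117, 325), (133, 326), (109,
  327), (125, 328), (109, 329), (108, 330), (125, 331), (103, 332), (123, 333), (123, 334), (98,
  335), (97, 336), (96, 337), (99, 338), (98, 339), (108, 340), (125, 341), (109, 342), (107,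
  343), (125, 344), (104, 345), (117, 346), (133, 347), (105, 348), (104, 349), (117, 350), (133,
  351)]), (8, [(0, 1), (0, 2), (0, 11), (0, 23), (0, 25), (0, 26), (0, 37), (0, 38), (0, 40), (0,
  48), (0, 49), (4, 50)])]

theorem entry_links : (links.all fun l =>
    (applyBlocks wideMask (blocksOf l.1) unitRows).force fun t =>
    l.2.all fun p => Nat.blt 0 (entry t p.1 p.2) && Nat.blt 0 (entry t p.2 p.1)) = true := by
  decide +kernel

theorem exists_link : ((List.range 351).all fun j => links.any fun l => l.2.any fun p =>
    Nat.ble p.1 j && Nat.beq p.2 (j + 1)) = true := by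
  decide +kernel

/-- The column vector with the given nonzero entries. -/
def sparse (l : List (ℕ × ℕ)) : Trie :=
  l.foldr (fun p t => t.setRow p.2 p.1) (tabulate (fun _ => 0) (nat_lit 9) (nat_lit 1) (nat_lit 0))

/-- The second column vector is congruent to `c` times the first one modulo `17`. -/
def isMultiple (c : ℕ) (t t' : Trie) : Bool :=
  (List.range 352).all fun i => Nat.beq (Nat.mod (t'.row i) 17) (Nat.mod (c * t.row i) 17)

/-- The vector `t` is multiplied by `1` or `-1` by the generators in `l.1`, and by neither of them
by the words in `l.2`. -/
def separates (c : ℕ) (t : Trie) (l : Level) : Bool :=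
  (l.1.all fun x => isMultiple c t (applyWord 255 blocksOf [x] t)) &&
  l.2.all fun w => (applyWord 255 blocksOf w t).force fun t' =>
    !isMultiple 1 t t' && !isMultiple 16 t t'

/-- Vectors whose stabilizers separate the parabolic subgroups in `levels`. -/
def levelVectors : List (ℕ × List (ℕ × ℕ)) :=
  [(1, [(0, 1), (4, 1), (7, 1), (10, 1), (34, 1), (37, 1), (39, 1), (41, 1), (176, 1), (180, 1),
  (181, 1), (182, 1), (198, 1), (199, 1), (201, 1), (203, 1)]), (16, [(324, 9), (326, 8), (328,
  9), (331, 8), (341, 8), (344, 9), (347, 9), (351, 8)]), (1, [(34, 1), (37, 1), (39, 1), (41, 1),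
  (176, 1), (180, 1), (181, 1), (182, 1)]), (1, [(176, 1), (180, 1), (181, 1), (182, 1)]), (1,
  [(1, 1), (2, 1), (5, 1), (6, 1), (176, 1), (179, 1), (182, 1), (183, 1)]), (1, [(204, 1), (205,
  1), (208, 1), (209, 1), (237, 1), (241, 1), (242, 1), (243, 1)]), (1, [(11, 1), (210, 1)]), (1,
  [(1, 1), (138, 1)])]

def topVector : List (ℕ × ℕ) :=
  [(318, 7), (320, 9), (322, 8), (323, 9), (324, 8), (326, 9), (328, 8), (331, 9), (333, 8), (334,
  9), (335, 9), (339, 8), (341, 9), (344, 8), (347, 8), (351, 9)]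

theorem separates_topVector : (sparse topVector).force (fun t =>
    separates 16 t ([1, 2, 3, 4, 5, 6, 7, 8], cosetData.map (·.1))) = true := by
  decide +kernel

theorem separates_levelVectors :
    ((levelVectors.zip levels).all fun p => (sparse p.1.2).force fun t =>
    separates p.1.1 t p.2) = true := by
  decide +kernel

/-! ### The representation -/

/-- The action of the twisted generators. -/
def genMap (x : ℕ) : Module.End (ZMod 17) Vec := blocksMap (blocksOf x)

theorem evalWord_genMap_apply {s : ℕ} {w : List ℕ} (h : actsDiagonally s w = true) (v : Vec)
    (i : Fin 352) : evalWord genMap w v i = sign s i * v i :=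
  evalWord_apply_of_isDiagonal isTame_blocksOf h v i

theorem evalWord_genMap_eq_one {w : List ℕ} (h : actsDiagonally 0 w = true) :
    evalWord genMap w = 1 := by
  refine LinearMap.ext fun v => funext fun i => ?_
  rw [evalWord_genMap_apply h, sign]
  simp

theorem genMap_mul_self (x : ℕ) : genMap x * genMap x = 1 := by
  have h : ∀ y ∈ [0, 1, 2, 3, 4, 5, 6, 7, 8], genMap y * genMap y = 1 := fun y hy => by
    simpa using evalWord_genMap_eq_one (List.all_eq_true.1 actsDiagonally_involutions y hy)
  match x with
  | 0 | 1 | 2 | 3 | 4 | 5 | 6 | 7 | 8 => exact h _ (by simp)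
  | _ + 9 => exact mul_one 1

/-- The twisted generators act invertibly. -/
def genUnit (x : ℕ) : (Module.End (ZMod 17) Vec)ˣ :=
  ⟨genMap x, genMap x, genMap_mul_self x, genMap_mul_self x⟩

theorem genUnit_sq (x : ℕ) : genUnit x ^ 2 = 1 :=
  Units.ext (by rw [pow_two]; exact genMap_mul_self x)

theorem val_evalWord_genUnit (w : List ℕ) :
    ((evalWord genUnit w : (Module.End (ZMod 17) Vec)ˣ) : Module.End (ZMod 17) Vec) =
      evalWord genMap w :=
  map_evalWord genUnit (Units.coeHom _) w

theorem mul_pow_eq_one_comm {Γ : Type*} [Group Γ] {x y : Γ} {n : ℕ} (h : (x * y) ^ n = 1) :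
    (y * x) ^ n = 1 := by
  have : y * x = y * (x * y) * y⁻¹ := by group
  rw [this, conj_pow, h, mul_one, mul_inv_cancel]

theorem genUnit_mul_pow (x y n : ℕ) (h : (x, y, n) ∈ pairOrders ∨ (y, x, n) ∈ pairOrders) :
    (genUnit x * genUnit y) ^ n = 1 := by
  have key : ∀ x y n, (x, y, n) ∈ pairOrders → (genUnit y * genUnit x) ^ n = 1 := by
    intro x y n hxy
    have := evalWord_genMap_eq_one (List.all_eq_true.1 actsDiagonally_pairs _ hxy)
    rw [← val_evalWord_genUnit, evalWord_repeatWord] at this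
    simpa using Units.ext this
  rcases h with h | h
  · exact mul_pow_eq_one_comm (key x y n h)
  · exact key y x n h

theorem genUnit_relatorS : evalWord genUnit [8, 7, 3, 5, 4, 3, 1, 2, 3] ^ 10 = 1 := by
  rw [← evalWord_repeatWord]
  exact Units.ext (by rw [val_evalWord_genUnit, evalWord_genMap_eq_one actsDiagonally_relatorS]; rfl)

theorem genUnit_relatorA : evalWord genUnit [7, 5, 4, 3, 2, 1, 0] ^ 9 = 1 := by
  rw [← evalWord_repeatWord]
  exact Units.ext (by rw [val_evalWord_genUnit, evalWord_genMap_eq_one actsDiagonally_relatorA]; rfl)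

theorem genUnit_relatorG : evalWord genUnit [7, 6, 5, 4, 3, 2, 1] ^ 9 = -1 := by
  rw [← evalWord_repeatWord]
  refine Units.ext (LinearMap.ext fun v => funext fun i => ?_)
  rw [val_evalWord_genUnit, evalWord_genMap_apply actsDiagonally_relatorG, sign,
    Nat.testBit_two_pow_sub_one, if_pos (by simp)]
  simp

/-- The images of the ten generators of `L` determined by those of the twisted generators, when `z`
is sent to `-1`. -/
def untwist {Γ : Type*} [Group Γ] [HasDistribNeg Γ] (τ : ℕ → Γ) : Fin 10 → Γ :=
  ![τ 0, τ 1, -τ 2, -τ 3, -τ 4, τ 5, -τ 6, -τ 7, -τ 8, -1]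

theorem lift_untwist_eq_one {Γ : Type*} [Group Γ] [HasDistribNeg Γ] {τ : ℕ → Γ}
    (hsq : ∀ x, τ x ^ 2 = 1)
    (hpair : ∀ x y n, (x, y, n) ∈ pairOrders ∨ (y, x, n) ∈ pairOrders → (τ x * τ y) ^ n = 1)
    (hS : evalWord τ [8, 7, 3, 5, 4, 3, 1, 2, 3] ^ 10 = 1)
    (hA : evalWord τ [7, 5, 4, 3, 2, 1, 0] ^ 9 = 1)
    (hG : evalWord τ [7, 6, 5, 4, 3, 2, 1] ^ 9 = -1) :
    ∀ r ∈ rels, FreeGroup.lift (untwist τ) r = 1 := by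
  rw [forall_rels_iff]
  simp only [evalWord, one_mul] at hS hA hG
  have h0 : untwist τ 0 = τ 0 := rfl
  have h1 : untwist τ 1 = τ 1 := rfl
  have h2 : untwist τ 2 = -τ 2 := rfl
  have h3 : untwist τ 3 = -τ 3 := rfl
  have h4 : untwist τ 4 = -τ 4 := rfl
  have h5 : untwist τ 5 = τ 5 := rfl
  have h6 : untwist τ 6 = -τ 6 := rfl
  have h7 : untwist τ 7 = -τ 7 := rfl
  have h8 : untwist τ 8 = -τ 8 := rfl
  have h9 : untwist τ 9 = -1 := rfl
  simp only [h0, h1, h2, h3, h4, h5, h6, h7, h8, h9, mul_neg, neg_mul, neg_neg, neg_sq, one_pow,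
    hsq, Odd.neg_pow (by decide : Odd 3), Odd.neg_pow (by decide : Odd 9),
    Even.neg_pow (by decide : Even 10), hS, hA, hG, neg_inj, one_mul, mul_one, true_and, and_true]
  repeat' apply And.intro
  all_goals exact hpair _ _ _ (by decide)

/-- The representation of `L` on column vectors. -/
def action : L →* (Module.End (ZMod 17) Vec)ˣ :=
  PresentedGroup.toGroup (lift_untwist_eq_one genUnit_sq genUnit_mul_pow genUnit_relatorS
    genUnit_relatorA genUnit_relatorG)

theorem action_of (k : Fin 10) : action (PresentedGroup.of k) = untwist genUnit k :=
  PresentedGroup.toGroup.of _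

theorem action_z : action z = -1 := action_of 9

theorem action_twist (x : ℕ) : action (twist x) = genUnit x := by
  have key : ∀ (k : Fin 10) (y : ℕ), untwist genUnit k = -genUnit y →
      action (PresentedGroup.of k * z) = genUnit y := by
    intro k y h
    rw [map_mul, action_of, action_z, h]
    exact (neg_mul_neg (genUnit y) 1).trans (mul_one (genUnit y))
  match x with
  | 0 => exact action_of 0
  | 1 => exact action_of 1
  | 2 => exact key 2 2 rfl
  | 3 => exact key 3 3 rfl
  | 4 => exact key 4 4 rfl
  | 5 => exact action_of 5
  | 6 => exact key 6 6 rfl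
  | 7 => exact key 7 7 rfl
  | 8 => exact key 8 8 rfl
  | n + 9 => exact Units.ext (rfl : 1 = genMap (n + 9))

theorem action_evalWord (w : List ℕ) :
    (action (evalWord twist w) : Module.End (ZMod 17) Vec) = evalWord genMap w := by
  rw [map_evalWord, ← val_evalWord_genUnit]
  simp only [action_twist]

/-! #### Faithfulness -/

/-- The elements that fix a vector up to sign. -/
def signStabilizer (v : Vec) : Subgroup L where
  carrier := {x | (action x : Module.End (ZMod 17) Vec) v = v ∨
    (action x : Module.End (ZMod 17) Vec) v = -v}
  one_mem' := Or.inl (by simp)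
  mul_mem' := by
    rintro x y (hx | hx) (hy | hy) <;> simp [hx, hy]
  inv_mem' := by
    intro x hx
    have hinv : ∀ u : Vec, (action x⁻¹ : Module.End (ZMod 17) Vec)
        ((action x : Module.End (ZMod 17) Vec) u) = u := by
      intro u
      rw [← Module.End.mul_apply, ← Units.val_mul, ← map_mul, inv_mul_cancel, map_one]
      rfl
    rcases hx with hx | hx
    · exact Or.inl (by conv_lhs => rw [← hx, hinv])
    · refine Or.inr ?_
      have := hinv v
      rw [hx, map_neg] at this
      exact neg_eq_iff_eq_neg.1 this

theorem ker_le_signStabilizer (v : Vec) : action.ker ≤ signStabilizer v := by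
  intro x hx
  refine Or.inl ?_
  rw [MonoidHom.mem_ker.1 hx]
  rfl

theorem parabolic_le_signStabilizer {gs : List ℕ} {v : Vec}
    (h : ∀ x ∈ gs, genMap x v = v ∨ genMap x v = -v) : parabolic gs ≤ signStabilizer v := by
  rw [parabolic, Subgroup.closure_le]
  rintro _ (rfl | ⟨x, hx, rfl⟩)
  · refine Or.inr ?_
    rw [action_z]
    simp
  · change (action _ : Module.End (ZMod 17) Vec) v = v ∨ (action _ : Module.End (ZMod 17) Vec) v = -v
    rw [action_twist]
    exact h x hx

/-- The vector stored in a trie. -/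
def Trie.toVec (t : Trie) : Vec := fun i => t.row i

theorem slotMask_one : slotMask 1 = 255 := rfl

theorem evalWord_genMap_toVec {t : Trie} (ht : t.IsFull 9) (hle : ∀ i : Fin 352, t.row i ≤ 1360)
    (w : List ℕ) : evalWord genMap w t.toVec = (applyWord 255 blocksOf w t).toVec := by
  have hX : Represents 1 t fun _ => t.toVec :=
    ⟨ht, fun i => ⟨fun _ => t.row i, by simp [pack], fun _ => hle i, fun _ => rfl⟩⟩
  funext i
  obtain ⟨d, hd, -, hdx⟩ := (hX.applyWord isTame_blocksOf w).rows i
  refine (hdx 0).symm.trans ?_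
  rw [← slotMask_one, Trie.toVec, hd]
  simp [pack]

theorem isMultiple_iff {c : ℕ} {t t' : Trie} :
    isMultiple c t t' = true ↔ t'.toVec = (c : ZMod 17) • t.toVec := by
  rw [isMultiple, List.all_eq_true]
  constructor
  · intro h
    funext i
    have := Nat.eq_of_beq_eq_true (h i (List.mem_range.2 i.isLt))
    have := (ZMod.natCast_eq_natCast_iff' _ _ 17).2 this
    rw [Nat.cast_mul] at this
    exact this
  · intro h i hi
    have := congrFun h ⟨i, List.mem_range.1 hi⟩
    change ((t'.row i : ℕ) : ZMod 17) = (c : ZMod 17) * (t.row i : ℕ) at this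
    rw [← Nat.cast_mul] at this
    exact Nat.beq_eq ▸ (ZMod.natCast_eq_natCast_iff' _ _ 17).1 this

theorem separates_spec {c : ℕ} (hc : (c : ZMod 17) = 1 ∨ (c : ZMod 17) = -1) {t : Trie}
    (ht : t.IsFull 9) (hle : ∀ i : Fin 352, t.row i ≤ 1360) {l : Level}
    (h : separates c t l = true) : parabolic l.1 ≤ signStabilizer t.toVec ∧
      ∀ r ∈ l.2, evalWord twist r ∉ signStabilizer t.toVec := by
  rw [separates, Bool.and_eq_true, List.all_eq_true, List.all_eq_true] at h
  refine ⟨parabolic_le_signStabilizer fun x hx => ?_, fun r hr hmem => ?_⟩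
  · have := isMultiple_iff.1 (h.1 x hx)
    rw [← evalWord_genMap_toVec ht hle] at this
    simp only [evalWord, one_mul] at this
    rcases hc with hc | hc <;> simp [this, hc]
  · have := h.2 r hr
    rw [Trie.force_eq, Bool.and_eq_true, Bool.not_eq_true', Bool.not_eq_true', ← Bool.not_eq_true,
      ← Bool.not_eq_true, isMultiple_iff, isMultiple_iff, ← evalWord_genMap_toVec ht hle,
      ← action_evalWord] at this
    rcases hmem with hmem | hmem
    · exact this.1 (by rw [hmem]; simp)
    · refine this.2 (hmem.trans ?_)
      rw [show ((16 : ℕ) : ZMod 17) = -1 from rfl, neg_one_smul]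

theorem isFull_sparse (l : List (ℕ × ℕ)) : (sparse l).IsFull 9 := by
  induction l with
  | nil => exact isFull_tabulate (fun _ => 0) 9 1 0
  | cons p l ih => exact ih.setRow _ _

theorem row_sparse_le {l : List (ℕ × ℕ)} (hl : ∀ p ∈ l, p.1 < 352 ∧ p.2 ≤ 16) (i : Fin 352) :
    (sparse l).row i ≤ 1360 := by
  induction l with
  | nil =>
    rw [sparse, List.foldr_nil, row_tabulate _ _ _ _ _ (i.isLt.trans (by decide))]
    exact Nat.zero_le _
  | cons p l ih =>
    have hp := hl p (by simp)
    rw [sparse, List.foldr_cons, ← sparse,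
      (isFull_sparse l).row_setRow _ (by omega) (by omega)]
    split_ifs
    · omega
    · exact ih fun q hq => hl q (by simp [hq])

theorem separates_sparse {c : ℕ} (hc : c = 1 ∨ c = 16) {s : List (ℕ × ℕ)}
    (hs : ∀ p ∈ s, p.1 < 352 ∧ p.2 ≤ 16) {l : Level}
    (h : ((sparse s).force fun t => separates c t l) = true) :
    ∃ S : Subgroup L, action.ker ≤ S ∧ parabolic l.1 ≤ S ∧ ∀ r ∈ l.2, evalWord twist r ∉ S := by
  rw [Trie.force_eq] at h
  refine ⟨_, ker_le_signStabilizer _, separates_spec ?_ (isFull_sparse s) (row_sparse_le hs) h⟩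
  rcases hc with rfl | rfl
  · exact Or.inl Nat.cast_one
  · exact Or.inr rfl

theorem ker_action_le : action.ker ≤ parabolic [] := by
  obtain ⟨S, hK, hS, hne⟩ := separates_sparse (Or.inr rfl) (by decide) separates_topVector
  refine le_parabolic_nil hK hS hne fun l hl => ?_
  have hmap : (levelVectors.zip levels).map Prod.snd = levels := rfl
  rw [← hmap, List.mem_map] at hl
  obtain ⟨p, hp, rfl⟩ := hl
  have hdata : ∀ q ∈ levelVectors, (q.1 = 1 ∨ q.1 = 16) ∧ ∀ r ∈ q.2, r.1 < 352 ∧ r.2 ≤ 16 := by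
    decide
  obtain ⟨hc, hs⟩ := hdata p.1 (List.of_mem_zip hp).1
  exact separates_sparse hc hs (List.all_eq_true.1 separates_levelVectors p hp)

theorem action_injective : Function.Injective action := by
  rw [← MonoidHom.ker_eq_bot_iff, eq_bot_iff]
  intro x hx
  have hz : ∀ y ∈ parabolic [], y = 1 ∨ y = z := by
    intro y hy
    induction hy using Subgroup.closure_induction with
    | mem y hy =>
      rcases hy with rfl | ⟨g, hg, -⟩
      · exact Or.inr rfl
      · simp at hg
    | one => exact Or.inl rfl
    | mul y y' _ _ h h' =>
      rcases h with rfl | rfl <;> rcases h' with rfl | rfl <;> simp [z_mul_z]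
    | inv y _ h =>
      rcases h with rfl | rfl
      · simp
      · exact Or.inr (inv_eq_of_mul_eq_one_left z_mul_z)
  rcases hz x (ker_action_le hx) with rfl | rfl
  · rfl
  · have h1 : action z = 1 := hx
    rw [action_z] at h1
    have := congrFun (LinearMap.congr_fun (congrArg Units.val h1) fun _ => 1) 0
    exact absurd this (show (-1 : ZMod 17) ≠ 1 by decide)

/-! #### Irreducibility -/

theorem signCode_injective {i j : ℕ} (hi : i < 352) (hj : j < 352)
    (h : signCode i = signCode j) : i = j := by
  have hsucc : ∀ k < 351, signCode k < signCode (k + 1) := fun k hk =>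
    Nat.le_of_ble_eq_true (List.all_eq_true.1 signCode_lt_succ k (List.mem_range.2 hk))
  have hlt : ∀ n k, k + n + 1 < 352 → signCode k < signCode (k + n + 1) := by
    intro n
    induction n with
    | zero => exact fun k hk => hsucc k (by omega)
    | succ n ih => exact fun k hk => (ih k (by omega)).trans (hsucc _ (by omega))
  rcases lt_trichotomy i j with hij | hij | hij
  · have := hlt (j - i - 1) i (by omega)
    rw [show i + (j - i - 1) + 1 = j by omega] at this
    omega
  · exact hij
  · have := hlt (i - j - 1) j (by omega)
    rw [show j + (i - j - 1) + 1 = i by omega] at this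
    omega

theorem mod_two_eq_of_sign_eq {s : ℕ} {i j : Fin 352} (h : sign s i = sign s j) :
    (s >>> (i : ℕ)) % 2 = (s >>> (j : ℕ)) % 2 := by
  have hb : s.testBit i = s.testBit j := by
    rw [sign, sign] at h
    have : (-1 : ZMod 17) ≠ 1 := by decide
    rcases hi : s.testBit i <;> rcases hj : s.testBit j <;> rw [hi, hj] at h
    exacts [absurd h.symm this, absurd h this]
  rw [Nat.testBit, Nat.testBit, Nat.one_and_eq_mod_two, Nat.one_and_eq_mod_two] at hb
  have h1 := Nat.mod_two_eq_zero_or_one (s >>> (i : ℕ))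
  have h2 := Nat.mod_two_eq_zero_or_one (s >>> (j : ℕ))
  rcases h1 with h1 | h1 <;> rcases h2 with h2 | h2 <;> rw [h1, h2] at hb ⊢ <;> cases hb

theorem eq_of_sign_eq {i j : Fin 352} (h : ∀ p ∈ diagonalWords, sign p.2 i = sign p.2 j) :
    i = j := by
  refine Fin.ext (signCode_injective i.isLt j.isLt ?_)
  rw [signCode, signCode]
  exact List.foldr_ext _ _ _ fun p hp c => by rw [mod_two_eq_of_sign_eq (h p hp)]

/-- A subspace that is invariant under the twisted generators. -/
def IsInvariant (U : Submodule (ZMod 17) Vec) : Prop := ∀ x : ℕ, ∀ v ∈ U, genMap x v ∈ U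

theorem IsInvariant.evalWord_mem {U : Submodule (ZMod 17) Vec} (hU : IsInvariant U) (w : List ℕ)
    {v : Vec} (hv : v ∈ U) : evalWord genMap w v ∈ U := by
  induction w generalizing v with
  | nil => exact hv
  | cons x w ih => exact ih (hU x v hv)

/-- Projection to a common eigenspace of the diagonal words in `ps`. -/
theorem IsInvariant.exists_mem_of_ne_zero {U : Submodule (ZMod 17) Vec} (hU : IsInvariant U)
    {ps : List (List ℕ × ℕ)} (hps : ∀ p ∈ ps, actsDiagonally p.2 p.1 = true) {u : Vec} (hu : u ∈ U)
    {i : Fin 352} (hi : u i ≠ 0) :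
    ∃ v ∈ U, v i ≠ 0 ∧ ∀ j, v j ≠ 0 → ∀ p ∈ ps, sign p.2 i = sign p.2 j := by
  induction ps with
  | nil => exact ⟨u, hu, hi, by simp⟩
  | cons p ps ih =>
    obtain ⟨v, hv, hvi, hvj⟩ := ih fun q hq => hps q (by simp [hq])
    have hsign : ∀ j, sign p.2 j = 1 ∨ sign p.2 j = -1 := by
      intro j
      rw [sign]
      split_ifs <;> simp
    have hcoord : ∀ j, (v + sign p.2 i • evalWord genMap p.1 v) j =
        (1 + sign p.2 i * sign p.2 j) * v j := by
      intro j
      rw [Pi.add_apply, Pi.smul_apply, evalWord_genMap_apply (hps p (by simp)), smul_eq_mul]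
      ring
    refine ⟨_, add_mem hv (U.smul_mem (sign p.2 i) (hU.evalWord_mem p.1 hv)), ?_, fun j hj => ?_⟩
    · rw [hcoord]
      have hsq : sign p.2 i * sign p.2 i = 1 := by rcases hsign i with h | h <;> simp [h]
      rw [hsq]
      have : Fact (Nat.Prime 17) := ⟨by norm_num⟩
      exact mul_ne_zero (by decide) hvi
    · rw [hcoord] at hj
      have hvj' := hvj j (right_ne_zero_of_mul hj)
      have hne := left_ne_zero_of_mul hj
      intro q hq
      rcases List.mem_cons.1 hq with rfl | hq
      · rcases hsign i with h | h <;> rcases hsign j with h' | h' <;> simp [h, h'] at hne ⊢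
      · exact hvj' q hq

theorem IsInvariant.single_mem {U : Submodule (ZMod 17) Vec} (hU : IsInvariant U) {u : Vec}
    (hu : u ∈ U) {i : Fin 352} (hi : u i ≠ 0) : Pi.single i 1 ∈ U := by
  obtain ⟨v, hv, hvi, hvj⟩ := hU.exists_mem_of_ne_zero
    (List.all_eq_true.1 actsDiagonally_diagonalWords) hu hi
  have : (Pi.single i 1 : Vec) = (v i)⁻¹ • v := by
    funext j
    by_cases hij : j = i
    · subst hij
      have : Fact (Nat.Prime 17) := ⟨by norm_num⟩
      rw [Pi.single_eq_same, Pi.smul_apply, smul_eq_mul, inv_mul_cancel₀ hvi]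
    · have hj : v j = 0 := by
        by_contra hne
        exact hij (eq_of_sign_eq (hvj j hne)).symm
      simp [hij, hj]
  rw [this]
  exact U.smul_mem _ hv

theorem genMap_single_ne_zero {x i j : ℕ} (hi : i < 352) (hj : j < 352)
    (h : 0 < entry (applyBlocks wideMask (blocksOf x) unitRows) i j) :
    genMap x (Pi.single (rowIndex j) 1) (rowIndex i) ≠ 0 := by
  obtain ⟨X, hX, hunit⟩ := exists_represents_unitRows
  obtain ⟨d, hd, hle, hdx⟩ := (hX.applyBlocks (isTame_blocksOf x)).rows (rowIndex i)
  rw [rowIndex_of_lt hi] at hd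
  have hentry : entry (applyBlocks wideMask (blocksOf x) unitRows) i j = d (j + 4) % 17 := by
    rw [wideMask_eq, entry, hd]
    change pack 356 d >>> (20 * (j + 4)) % 1048576 % 17 = _
    rw [Nat.shiftRight_eq_div_pow, pow_mul, show 2 ^ 20 = 1048576 from rfl,
      pack_div (fun k => (hle k).trans_lt (by decide)) (by omega)]
  have hval := hdx (j + 4)
  have := hunit (rowIndex j)
  rw [rowIndex_of_lt hj] at this
  change _ = genMap x (X (j + 4)) (rowIndex i) at hval
  rw [← this, ← hval, Ne, ZMod.natCast_eq_zero_iff]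
  intro hdvd
  rw [hentry, Nat.mod_eq_zero_of_dvd hdvd] at h
  exact lt_irrefl _ h

theorem exists_smaller_link {j : ℕ} (hj : j + 1 < 352) : ∃ i ≤ j, ∃ x,
    genMap x (Pi.single (rowIndex (j + 1)) 1) (rowIndex i) ≠ 0 ∧
    genMap x (Pi.single (rowIndex i) 1) (rowIndex (j + 1)) ≠ 0 := by
  obtain ⟨l, hl, hl'⟩ := List.any_eq_true.1
    (List.all_eq_true.1 exists_link j (List.mem_range.2 (by omega)))
  obtain ⟨p, hp, hp'⟩ := List.any_eq_true.1 hl'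
  rw [Bool.and_eq_true] at hp'
  have hi := Nat.le_of_ble_eq_true hp'.1
  have hj' := Nat.eq_of_beq_eq_true hp'.2
  have hentry := List.all_eq_true.1 entry_links l hl
  rw [Trie.force_eq] at hentry
  have := List.all_eq_true.1 hentry p hp
  rw [Bool.and_eq_true, hj'] at this
  exact ⟨p.1, hi, l.1,
    genMap_single_ne_zero (by omega) hj (Nat.le_of_ble_eq_true this.1),
    genMap_single_ne_zero hj (by omega) (Nat.le_of_ble_eq_true this.2)⟩

theorem IsInvariant.eq_bot_or_eq_top {U : Submodule (ZMod 17) Vec} (hU : IsInvariant U) :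
    U = ⊥ ∨ U = ⊤ := by
  rw [or_iff_not_imp_left]
  intro hne
  obtain ⟨u, hu, hu0⟩ := U.exists_mem_ne_zero_of_ne_bot hne
  obtain ⟨i, hi⟩ := Function.ne_iff.1 hu0
  have hdown : ∀ j : ℕ, j < 352 → Pi.single (rowIndex j) 1 ∈ U → Pi.single (rowIndex 0) 1 ∈ U := by
    intro j
    induction j using Nat.strong_induction_on with
    | _ j ih =>
      match j with
      | 0 => exact fun _ h => h
      | j + 1 =>
        intro hj h
        obtain ⟨k, hk, x, hx, -⟩ := exists_smaller_link hj
        exact ih k (by omega) (by omega) (hU.single_mem (hU x _ h) hx)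
  have hindex : ∀ k : Fin 352, rowIndex k = k := fun k => Fin.ext (rowIndex_of_lt k.isLt)
  have hzero := hdown i i.isLt (by rw [hindex]; exact hU.single_mem hu hi)
  have hup : ∀ j : ℕ, j < 352 → Pi.single (rowIndex j) 1 ∈ U := by
    intro j
    induction j using Nat.strong_induction_on with
    | _ j ih =>
      match j with
      | 0 => exact fun _ => hzero
      | j + 1 =>
        intro hj
        obtain ⟨k, hk, x, -, hx⟩ := exists_smaller_link hj
        exact hU.single_mem (hU x _ (ih k (by omega) (by omega))) hx
  rw [eq_top_iff, ← (Pi.basisFun (ZMod 17) (Fin 352)).span_eq, Submodule.span_le]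
  rintro _ ⟨k, rfl⟩
  rw [Pi.basisFun_apply, ← hindex k]
  exact hup k k.isLt

end

/-- There is an injective group homomorphism `ρ : L → GL₃₅₂(𝔽₁₇)` whose image acts
irreducibly on the natural module `𝔽₁₇^352`: the only `𝔽₁₇`-subspaces `U` of `𝔽₁₇^352`
with `ρ(g)·U ⊆ U` for all `g ∈ L` are `U = 0` and `U = 𝔽₁₇^352`. -/
theorem twoFi22_has_faithful_irreducible_352_dim_rep :
    ∃ ρ : L →* Matrix.GeneralLinearGroup (Fin 352) (ZMod 17),
      Function.Injective ρ ∧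
      ∀ U : Submodule (ZMod 17) (Fin 352 → ZMod 17),
        (∀ g₀ : L, ∀ v ∈ U,
          ((ρ g₀ : Matrix (Fin 352) (Fin 352) (ZMod 17)).mulVec v) ∈ U) →
        U = ⊥ ∨ U = ⊤ := by
  let θ := Units.mapEquiv
    (Matrix.toLinAlgEquiv' (R := ZMod 17) (n := Fin 352)).symm.toRingEquiv.toMulEquiv
  refine ⟨θ.toMonoidHom.comp action, θ.injective.comp action_injective, fun U hU => ?_⟩
  refine IsInvariant.eq_bot_or_eq_top fun x v hv => ?_
  have := hU (twist x) v hv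
  rw [← Matrix.toLinAlgEquiv'_apply] at this
  change Matrix.toLinAlgEquiv' (Matrix.toLinAlgEquiv'.symm (action (twist x)).val) v ∈ U at this
  rw [AlgEquiv.apply_symm_apply, action_twist] at this
  exact this

end TwoFi22
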